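/- For T a standard shifted Young tableau of doubled staircase shape (2n−1, 2n−3, …, 1), define its promotion sequence Φ(T) = r_1 r_2 ⋯ r_{n²}, where r_i is the row (counted from the bottom up) containing the largest entry n² in p^i(T). Then Φ is a bijection from SYT'(2n−1, 2n−3, …, 1) to R(w_0), the set of reduced words for the longest element w_0 of the type B_n Coxeter group; moreover Φ(p(T)) = c(Φ(T)), where c moves the first letter of a word to the end. -/

import Mathlib

/-! ### Tableau machinery: fillings as functions `ℕ × ℕ → ℕ` (entry `0` = empty/absent cell) -/

/-- One jeu de taquin slide: starting from an empty box at position `c`, repeatedly swap the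
empty box with the smaller of the entries directly to its right and directly below it
(`0` denotes an empty/absent cell), until neither exists.  Returns the resulting filling
together with the final position of the empty box; `fuel` bounds the number of steps. -/
def jdtSlide : ℕ → ((ℕ × ℕ) → ℕ) → (ℕ × ℕ) → (((ℕ × ℕ) → ℕ) × (ℕ × ℕ))
  | 0, f, c => (f, c)
  | fuel+1, f, c =>
    let a := c.1
    let b := c.2
    let r := f (a, b+1)
    let d := f (a+1, b)
    if r = 0 ∧ d = 0 then (f, c)
    else if d = 0 ∨ (r ≠ 0 ∧ r < d) then
      jdtSlide fuel (Function.update (Function.update f (a, b+1) 0) (a, b) r) (a, b+1)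
    else
      jdtSlide fuel (Function.update (Function.update f (a+1, b) 0) (a, b) d) (a+1, b)

/-- Jeu de taquin promotion of a standard filling with `N` boxes: delete the entry `1`
(in the upper left corner `(0,0)`), decrease every other entry by `1`, slide the empty box
by jeu de taquin, and fill the final empty box with `N`. -/
def promote (N : ℕ) (f : (ℕ × ℕ) → ℕ) : (ℕ × ℕ) → ℕ :=
  let s := jdtSlide N (fun c => f c - 1) (0, 0)
  Function.update s.1 s.2 N

/-- The cells of the (straight-shape) Young diagram of a partition `lam`:
row `a` consists of the cells `(a, b)` with `b < lam a`. -/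
def strCell (lam : List ℕ) (c : ℕ × ℕ) : Prop := c.2 < lam.getD c.1 0

/-- The cells of the shifted Young diagram of a strict partition `lam`:
row `a` consists of the cells `(a, b)` with `a ≤ b < a + lam a`. -/
def shiftCell (lam : List ℕ) (c : ℕ × ℕ) : Prop :=
  c.1 ≤ c.2 ∧ c.2 < c.1 + lam.getD c.1 0

/-- `IsStdFilling cells N f` : `f` is a standard tableau on the cell set `cells` with
entries `1, …, N`: it vanishes off `cells`, restricts to a bijection `cells → {1, …, N}`,
and is strictly increasing along rows and columns. -/
def IsStdFilling (cells : ℕ × ℕ → Prop) (N : ℕ) (f : (ℕ × ℕ) → ℕ) : Prop :=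
  (∀ c, ¬ cells c → f c = 0) ∧
  (∀ c, cells c → 1 ≤ f c ∧ f c ≤ N) ∧
  (∀ c c', cells c → cells c' → f c = f c' → c = c') ∧
  (∀ v, 1 ≤ v → v ≤ N → ∃ c, cells c ∧ f c = v) ∧
  (∀ a b, cells (a, b) → cells (a, b+1) → f (a, b) < f (a, b+1)) ∧
  (∀ a b, cells (a, b) → cells (a+1, b) → f (a, b) < f (a+1, b))

/-- The rectangular partition with `b` rows and `n` columns. -/
def rectShape (b n : ℕ) : List ℕ := List.replicate b n

/-- The square partition with `n` rows and `n` columns. -/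
def sqShape (n : ℕ) : List ℕ := List.replicate n n

/-- The doubled staircase strict partition `(2n-1, 2n-3, …, 1)`. -/
def dblStair (n : ℕ) : List ℕ := (List.range n).map (fun i => 2*n - 1 - 2*i)

/-- The index of the row containing the entry `v` of a filling
(rows numbered `0, 1, 2, …` from the top). -/
noncomputable def rowOf (f : (ℕ × ℕ) → ℕ) (v : ℕ) : ℕ := sInf {a | ∃ b, f (a, b) = v}

/-- The promotion sequence `Φ(T) = r₁ r₂ ⋯ r_(n²)` of a standard shifted tableau `T` with
`n²` boxes, where `rᵢ` is the row containing the largest entry `n²` of `pⁱ(T)`, rows being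
counted from the bottom up.  A letter (subscript) `r ∈ {1, …, n}` (row `r` from the bottom,
i.e. row `a = n - r` from the top) is recorded as the index `n - r = a : Fin n`, matching
Mathlib's Coxeter matrix `CoxeterMatrix.Bₙ`, whose `4`-bond joins the indices `n-1` and
`n-2` (so the special generator `s₁` is the index `n - 1`). -/
noncomputable def phiWord (n : ℕ) (hn : 0 < n) (f : (ℕ × ℕ) → ℕ) : List (Fin n) :=
  (List.range (n ^ 2)).map
    (fun i => ⟨(rowOf ((promote (n ^ 2))^[i + 1] f) (n ^ 2)) % n, Nat.mod_lt _ hn⟩)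

namespace PSB

/-- number of occurrences of letter `c` among the first `m` letters of `x` -/
def cnt (x : ℕ → ℕ) (c m : ℕ) : ℕ := Nat.count (fun i => x i = c) m

lemma cnt_zero (x : ℕ → ℕ) (c : ℕ) : cnt x c 0 = 0 := by simp [cnt]

lemma cnt_succ (x : ℕ → ℕ) (c m : ℕ) :
    cnt x c (m + 1) = cnt x c m + if x m = c then 1 else 0 := by
  simp [cnt, Nat.count_succ]

lemma cnt_mono (x : ℕ → ℕ) (c : ℕ) {i j : ℕ} (h : i ≤ j) : cnt x c i ≤ cnt x c j :=
  Nat.count_monotone _ h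

lemma cnt_congr {x y : ℕ → ℕ} {m : ℕ} (h : ∀ i < m, x i = y i) (c : ℕ) :
    cnt x c m = cnt y c m := by
  induction m with
  | zero => simp [cnt_zero]
  | succ m ih =>
    rw [cnt_succ, cnt_succ, ih (fun i hi => h i (by omega)), h m (by omega)]

lemma exists_of_cnt_lt {x : ℕ → ℕ} {c i j : ℕ} (h : cnt x c i < cnt x c j) :
    ∃ l, i ≤ l ∧ l < j ∧ x l = c := by
  induction j with
  | zero => simp [cnt_zero] at h
  | succ j ih =>
    by_cases hj : x j = c
    · refine ⟨j, ?_, by omega, hj⟩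
      by_contra hlt
      have := cnt_mono x c (show j + 1 ≤ i by omega)
      omega
    · rw [cnt_succ, if_neg hj] at h
      obtain ⟨l, h1, h2, h3⟩ := ih h
      exact ⟨l, h1, by omega, h3⟩

lemma cnt_lt_of {x : ℕ → ℕ} {c i j l : ℕ} (h1 : i ≤ l) (h2 : l < j) (h3 : x l = c) :
    cnt x c i < cnt x c j := by
  have a := cnt_mono x c h1
  have b := cnt_mono x c (show l + 1 ≤ j by omega)
  rw [cnt_succ, if_pos h3] at b
  omega

/-- content words of standard fillings of the doubled staircase -/
structure InX (n N : ℕ) (x : ℕ → ℕ) : Prop where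
  lat1 : ∀ m ≤ N, ∀ c, cnt x (c + 1) m ≤ cnt x c m
  lat2 : ∀ m ≤ N, ∀ c, cnt x c m ≤ cnt x (c + 1) m + 1
  tot : ∀ c, cnt x c N = n - (c + 1) / 2
  zer : ∀ i, N ≤ i → x i = 0

/-- two contents that are equal or differ by one -/
def near (a b : ℕ) : Prop := a ≤ b + 1 ∧ b ≤ a + 1

instance (a b : ℕ) : Decidable (near a b) := by unfold near; infer_instance

/-- exchange positions `k` and `k+1` -/
def sw (k : ℕ) (x : ℕ → ℕ) : ℕ → ℕ :=
  fun j => if j = k then x (k + 1) else if j = k + 1 then x k else x j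

/-- toggle -/
def tg (k : ℕ) (x : ℕ → ℕ) : ℕ → ℕ := if near (x k) (x (k + 1)) then x else sw k x

lemma sw_left (k x) : sw k x k = x (k + 1) := by simp [sw]
lemma sw_right (k x) : sw k x (k + 1) = x k := by simp [sw]
lemma sw_ne {k j : ℕ} (x) (h : j ≠ k) (h' : j ≠ k + 1) : sw k x j = x j := by simp [sw, h, h']

lemma sw_sw (k x) : sw k (sw k x) = x := by
  funext j; unfold sw; grind

lemma sw_comm {i j : ℕ} (h : i + 1 < j) (x) : sw i (sw j x) = sw j (sw i x) := by
  funext l; unfold sw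
  have h1 : i ≠ j := by omega
  have h2 : i ≠ j + 1 := by omega
  have h3 : i + 1 ≠ j := by omega
  have h4 : j ≠ i := by omega
  have h5 : j ≠ i + 1 := by omega
  have h6 : j + 1 ≠ i := by omega
  split_ifs <;> omega

lemma tg_ne {k j : ℕ} (x) (h : j ≠ k) (h' : j ≠ k + 1) : tg k x j = x j := by
  unfold tg; split_ifs
  · rfl
  · exact sw_ne x h h'

lemma near_comm {a b : ℕ} : near a b ↔ near b a := by unfold near; omega

lemma tg_tg (k x) : tg k (tg k x) = x := by
  unfold tg
  split_ifs with h1 h2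
  · rfl
  · exact absurd (near_comm.1 (by simpa [sw_left, sw_right] using h2)) h1
  · exact sw_sw k x

lemma tg_comm {i j : ℕ} (h : i + 1 < j) (x) : tg i (tg j x) = tg j (tg i x) := by
  have e1 : tg j x i = x i := tg_ne x (by omega) (by omega)
  have e2 : tg j x (i + 1) = x (i + 1) := tg_ne x (by omega) (by omega)
  have e3 : tg i x j = x j := tg_ne x (by omega) (by omega)
  have e4 : tg i x (j + 1) = x (j + 1) := tg_ne x (by omega) (by omega)
  have L : tg i (tg j x) = if near (x i) (x (i+1)) then tg j x else sw i (tg j x) := by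
    conv_lhs => unfold tg
    rw [← e1, ← e2]; rfl
  have R : tg j (tg i x) = if near (x j) (x (j+1)) then tg i x else sw j (tg i x) := by
    conv_lhs => unfold tg
    rw [← e3, ← e4]; rfl
  rw [L, R]
  unfold tg
  split_ifs <;> first | rfl | exact sw_comm h x

variable {n N : ℕ} {x y : ℕ → ℕ}

namespace InX

lemma sw_mem (hx : InX n N x) {k : ℕ} (hk : k + 1 < N) (h : ¬ near (x k) (x (k + 1))) :
    InX n N (sw k x) := by
  have key : ∀ c m, m ≠ k + 1 → cnt (sw k x) c m = cnt x c m := by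
    intro c m hm
    rcases Nat.lt_or_ge m (k + 1) with h1 | h1
    · exact cnt_congr (fun i hi => sw_ne x (by omega) (by omega)) c
    · obtain ⟨r, rfl⟩ : ∃ r, m = k + 2 + r := ⟨m - (k + 2), by omega⟩
      clear hm h1
      induction r with
      | zero =>
        have := cnt_congr (x := sw k x) (y := x) (m := k)
          (fun i hi => sw_ne x (by omega) (by omega)) c
        simp only [add_zero, cnt_succ, sw_left, sw_right, this]; omega
      | succ r ih =>
        rw [← add_assoc, cnt_succ, cnt_succ, ih, sw_ne x (by omega) (by omega)]
  have k1 : ∀ c, cnt (sw k x) c (k + 1) = cnt x c k + if x (k + 1) = c then 1 else 0 := by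
    intro c; rw [cnt_succ, key c k (by omega), sw_left]
  have k2 : ∀ c, cnt x c (k + 2) =
      cnt x c k + (if x k = c then 1 else 0) + if x (k + 1) = c then 1 else 0 := by
    intro c; rw [cnt_succ, cnt_succ]
  refine ⟨fun m hm c => ?_, fun m hm c => ?_, fun c => ?_, fun i hi => ?_⟩
  · by_cases hm1 : m = k + 1
    · subst hm1
      have a1 := hx.lat1 k (by omega) c
      have a2 := hx.lat1 (k + 2) (by omega) c
      rw [k2, k2] at a2
      rw [k1, k1]
      unfold near at h
      split_ifs at a2 ⊢ <;> omega
    · rw [key _ _ hm1, key _ _ hm1]; exact hx.lat1 m hm c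
  · by_cases hm1 : m = k + 1
    · subst hm1
      have a1 := hx.lat2 k (by omega) c
      have a2 := hx.lat2 (k + 2) (by omega) c
      rw [k2, k2] at a2
      rw [k1, k1]
      unfold near at h
      split_ifs at a2 ⊢ <;> omega
    · rw [key _ _ hm1, key _ _ hm1]; exact hx.lat2 m hm c
  · rw [key _ _ (by omega)]; exact hx.tot c
  · rw [sw_ne x (by omega) (by omega)]; exact hx.zer i hi

lemma tg_mem (hx : InX n N x) {k : ℕ} (hk : k + 1 < N) : InX n N (tg k x) := by
  unfold tg; split_ifs with h
  · exact hx
  · exact hx.sw_mem hk h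

/-- property (A), upper -/
lemma up (hx : InX n N x) {i j : ℕ} (hij : i < j) (hj : j < N) (h : x i = x j) :
    ∃ l, i < l ∧ l < j ∧ x l = x i + 1 := by
  have h1 := cnt_succ x (x i) i
  have h2 := cnt_succ x (x i) j
  have h3 := cnt_succ x (x i + 1) j
  have h4 := cnt_succ x (x i + 1) i
  have h5 := cnt_mono x (x i) (show i + 1 ≤ j by omega)
  have h6 := hx.lat2 (j + 1) (by omega) (x i)
  have h7 := hx.lat1 i (by omega) (x i)
  rw [if_pos rfl] at h1
  rw [if_pos h.symm] at h2
  rw [if_neg (by omega)] at h3 h4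
  obtain ⟨l, a, b, c⟩ := exists_of_cnt_lt (x := x) (c := x i + 1) (i := i + 1) (j := j) (by omega)
  exact ⟨l, by omega, b, c⟩

/-- property (A), lower -/
lemma down (hx : InX n N x) {i j : ℕ} (hij : i < j) (hj : j < N) (h : x i = x j)
    (h0 : 1 ≤ x i) : ∃ l, i < l ∧ l < j ∧ x l + 1 = x i := by
  obtain ⟨c, hc⟩ : ∃ c, x i = c + 1 := ⟨x i - 1, by omega⟩
  have h1 := cnt_succ x (x i) i
  have h2 := cnt_succ x (x i) j
  have h3 := cnt_succ x c j
  have h4 := cnt_succ x c i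
  have h5 := cnt_mono x (x i) (show i + 1 ≤ j by omega)
  have h6 := hx.lat1 (j + 1) (by omega) c
  have h7 := hx.lat2 i (by omega) c
  rw [if_pos rfl] at h1
  rw [if_pos h.symm] at h2
  rw [if_neg (by omega)] at h3 h4
  rw [← hc] at h6 h7
  obtain ⟨l, a, b, d⟩ := exists_of_cnt_lt (x := x) (c := c) (i := i + 1) (j := j) (by omega)
  exact ⟨l, by omega, b, by omega⟩

/-- property (B) -/
lemma pre (hx : InX n N x) {j : ℕ} (hj : j < N) (h0 : 1 ≤ x j) :
    ∃ l, l < j ∧ x l + 1 = x j := by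
  obtain ⟨c, hc⟩ : ∃ c, x j = c + 1 := ⟨x j - 1, by omega⟩
  have h1 := cnt_succ x (x j) j
  have h2 := cnt_succ x c j
  have h3 := hx.lat1 (j + 1) (by omega) c
  rw [if_pos rfl] at h1
  rw [if_neg (by omega)] at h2
  rw [← hc] at h3
  obtain ⟨l, a, b, d⟩ := exists_of_cnt_lt (x := x) (c := c) (i := 0) (j := j)
    (by rw [cnt_zero]; omega)
  exact ⟨l, by omega, by omega⟩

lemma pre_le (hx : InX n N x) {j : ℕ} (hj : j < N) {c : ℕ} (h0 : c < x j) :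
    ∃ l, l < j ∧ x l = c := by
  induction j using Nat.strong_induction_on with
  | _ j ih =>
    obtain ⟨l, hl, h⟩ := hx.pre hj (by omega)
    by_cases hc : x l = c
    · exact ⟨l, hl, hc⟩
    · obtain ⟨l', h1, h2⟩ := ih l hl (by omega) (by omega)
      exact ⟨l', by omega, h2⟩

/-- property (U) -/
lemma odd_up (hx : InX n N x) {j : ℕ} (hj : j < N) (h : x j % 2 = 1) :
    ∃ l, j < l ∧ l < N ∧ x l = x j + 1 := by
  have h1 := cnt_succ x (x j) j
  have h2 := cnt_succ x (x j + 1) j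
  have h3 := hx.lat1 j (by omega) (x j)
  have h4 := hx.tot (x j)
  have h5 := hx.tot (x j + 1)
  have h6 := cnt_mono x (x j) (show j + 1 ≤ N by omega)
  rw [if_pos rfl] at h1
  rw [if_neg (by omega)] at h2
  obtain ⟨l, a, b, d⟩ := exists_of_cnt_lt (x := x) (c := x j + 1) (i := j + 1) (j := N) (by omega)
  exact ⟨l, by omega, b, d⟩

lemma odd_down (hx : InX n N x) {j : ℕ} (hj : j < N) (h : x j % 2 = 1) :
    ∃ l, j < l ∧ l < N ∧ x l + 1 = x j := by
  obtain ⟨c, hc⟩ : ∃ c, x j = c + 1 := ⟨x j - 1, by omega⟩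
  have h1 := cnt_succ x (x j) j
  have h2 := cnt_succ x c j
  have h3 := hx.lat2 j (by omega) c
  have h4 := hx.tot (x j)
  have h5 := hx.tot c
  have h6 := cnt_mono x (x j) (show j + 1 ≤ N by omega)
  rw [if_pos rfl] at h1
  rw [if_neg (by omega)] at h2
  rw [← hc] at h3
  obtain ⟨l, a, b, d⟩ := exists_of_cnt_lt (x := x) (c := c) (i := j + 1) (j := N) (by omega)
  exact ⟨l, by omega, b, by omega⟩

lemma bound (hx : InX n N x) {j : ℕ} (hj : j < N) : x j + 2 ≤ 2 * n := by
  have := cnt_lt_of (x := x) (Nat.zero_le j) hj rfl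
  rw [hx.tot] at this
  omega

lemma occurs (hx : InX n N x) {c : ℕ} (hc : c + 2 ≤ 2 * n) : ∃ l < N, x l = c := by
  have := hx.tot c
  obtain ⟨l, a, b, d⟩ := exists_of_cnt_lt (x := x) (c := c) (i := 0) (j := N)
    (by rw [cnt_zero]; omega)
  exact ⟨l, b, d⟩

/-- local forms of (A) -/
lemma l1 (hx : InX n N x) {k : ℕ} (hk : k + 1 < N) : x k ≠ x (k + 1) := by
  intro h
  obtain ⟨l, h1, h2, -⟩ := hx.up (by omega) hk h
  omega

lemma l2 (hx : InX n N x) {k : ℕ} (hk : k + 2 < N) (h : x k = x (k + 2)) :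
    x k = 0 ∧ x (k + 1) = 1 := by
  obtain ⟨l, h1, h2, h3⟩ := hx.up (by omega) hk h
  obtain rfl : l = k + 1 := by omega
  by_cases h0 : 1 ≤ x k
  · obtain ⟨l, h1', h2', h3'⟩ := hx.down (by omega) hk h h0
    obtain rfl : l = k + 1 := by omega
    omega
  · omega

lemma l3 (hx : InX n N x) {k : ℕ} (hk : k + 3 < N) (h : x k = x (k + 3)) :
    (x (k + 1) = x k + 1 ∨ x (k + 2) = x k + 1) ∧
    (x k = 0 ∨ x (k + 1) + 1 = x k ∨ x (k + 2) + 1 = x k) := by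
  constructor
  · obtain ⟨l, h1, h2, h3⟩ := hx.up (by omega) hk h
    obtain rfl | rfl : l = k + 1 ∨ l = k + 2 := by omega
    all_goals omega
  · by_cases h0 : 1 ≤ x k
    · obtain ⟨l, h1', h2', h3'⟩ := hx.down (by omega) hk h h0
      obtain rfl | rfl : l = k + 1 ∨ l = k + 2 := by omega
      all_goals omega
    · omega

lemma l4 (hx : InX n N x) {k : ℕ} (hk : k + 4 < N) (h : x k = x (k + 4)) :
    (x (k + 1) = x k + 1 ∨ x (k + 2) = x k + 1 ∨ x (k + 3) = x k + 1) ∧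
    (x k = 0 ∨ x (k + 1) + 1 = x k ∨ x (k + 2) + 1 = x k ∨ x (k + 3) + 1 = x k) := by
  constructor
  · obtain ⟨l, h1, h2, h3⟩ := hx.up (by omega) hk h
    obtain rfl | rfl | rfl : l = k + 1 ∨ l = k + 2 ∨ l = k + 3 := by omega
    all_goals omega
  · by_cases h0 : 1 ≤ x k
    · obtain ⟨l, h1', h2', h3'⟩ := hx.down (by omega) hk h h0
      obtain rfl | rfl | rfl : l = k + 1 ∨ l = k + 2 ∨ l = k + 3 := by omega
      all_goals omega
    · omega

end InX
end PSB

namespace PSB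

/-- the involution `*` acting on the window at position `k` -/
def sta (k : ℕ) (x : ℕ → ℕ) : ℕ → ℕ :=
  if ((x k < x (k+2) ∧ x (k+2) < x (k+1)) ∨ (x (k+1) < x (k+2) ∧ x (k+2) < x k)) ∧ x (k+3) < x (k+2)
    then sw k x
  else if (x k < x (k+1) ∨ x k < x (k+2)) ∧ (x (k+3) < x (k+1) ∨ x (k+3) < x (k+2)) ∧
      ((x (k+1) < x k ∨ x (k+2) < x k) ∨ (x (k+1) < x (k+3) ∨ x (k+2) < x (k+3)))
    then sw (k+1) x
  else if ((x (k+2) < x (k+1) ∧ x (k+1) < x (k+3)) ∨ (x (k+3) < x (k+1) ∧ x (k+1) < x (k+2)))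
      ∧ x k < x (k+1)
    then sw (k+2) x
  else x

/-- overwrite five consecutive letters -/
def w5 (k a b c d e : ℕ) (y : ℕ → ℕ) : ℕ → ℕ :=
  fun j => if j = k then a else if j = k + 1 then b else if j = k + 2 then c
    else if j = k + 3 then d else if j = k + 4 then e else y j

section
variable (k a b c d e : ℕ) (y : ℕ → ℕ)
lemma w5_0 : w5 k a b c d e y k = a := by simp [w5]
lemma w5_1 : w5 k a b c d e y (k + 1) = b := by simp [w5]
lemma w5_2 : w5 k a b c d e y (k + 2) = c := by simp [w5]
lemma w5_3 : w5 k a b c d e y (k + 3) = d := by simp [w5]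
lemma w5_4 : w5 k a b c d e y (k + 4) = e := by simp [w5]
lemma w5_self : w5 k (y k) (y (k+1)) (y (k+2)) (y (k+3)) (y (k+4)) y = y := by
  funext j; unfold w5; split_ifs <;> simp_all
lemma w5_ne {j : ℕ} (h : j < k ∨ k + 4 < j) : w5 k a b c d e y j = y j := by
  unfold w5; split_ifs <;> omega
lemma sw_w5_0 : sw k (w5 k a b c d e y) = w5 k b a c d e y := by
  funext j; unfold sw w5; grind
lemma sw_w5_1 : sw (k+1) (w5 k a b c d e y) = w5 k a c b d e y := by
  funext j; unfold sw w5; grind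
lemma sw_w5_2 : sw (k+2) (w5 k a b c d e y) = w5 k a b d c e y := by
  funext j; unfold sw w5; grind
lemma sw_w5_3 : sw (k+3) (w5 k a b c d e y) = w5 k a b c e d y := by
  funext j; unfold sw w5; grind
lemma tg_w5_0 : tg k (w5 k a b c d e y) =
    if a ≤ b + 1 ∧ b ≤ a + 1 then w5 k a b c d e y else w5 k b a c d e y := by
  unfold tg near; rw [sw_w5_0, w5_0, w5_1]
lemma tg_w5_1 : tg (k+1) (w5 k a b c d e y) =
    if b ≤ c + 1 ∧ c ≤ b + 1 then w5 k a b c d e y else w5 k a c b d e y := by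
  unfold tg near; rw [sw_w5_1, w5_1, w5_2]
lemma tg_w5_2 : tg (k+2) (w5 k a b c d e y) =
    if c ≤ d + 1 ∧ d ≤ c + 1 then w5 k a b c d e y else w5 k a b d c e y := by
  unfold tg near; rw [sw_w5_2, w5_2, w5_3]
lemma tg_w5_3 : tg (k+3) (w5 k a b c d e y) =
    if d ≤ e + 1 ∧ e ≤ d + 1 then w5 k a b c d e y else w5 k a b c e d y := by
  unfold tg near; rw [sw_w5_3, w5_3, w5_4]
lemma sta_w5_0 : sta k (w5 k a b c d e y) =
    if ((a < c ∧ c < b) ∨ (b < c ∧ c < a)) ∧ d < c then w5 k b a c d e y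
    else if (a < b ∨ a < c) ∧ (d < b ∨ d < c) ∧ ((b < a ∨ c < a) ∨ (b < d ∨ c < d))
      then w5 k a c b d e y
    else if ((c < b ∧ b < d) ∨ (d < b ∧ b < c)) ∧ a < b then w5 k a b d c e y
    else w5 k a b c d e y := by
  unfold sta; rw [sw_w5_0, sw_w5_1, sw_w5_2, w5_0, w5_1, w5_2, w5_3]
lemma sta_w5_1 : sta (k+1) (w5 k a b c d e y) =
    if ((b < d ∧ d < c) ∨ (c < d ∧ d < b)) ∧ e < d then w5 k a c b d e y
    else if (b < c ∨ b < d) ∧ (e < c ∨ e < d) ∧ ((c < b ∨ d < b) ∨ (c < e ∨ d < e))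
      then w5 k a b d c e y
    else if ((d < c ∧ c < e) ∨ (e < c ∧ c < d)) ∧ b < c then w5 k a b c e d y
    else w5 k a b c d e y := by
  unfold sta
  rw [show k+1+1 = k+2 from rfl, show k+1+2 = k+3 from rfl, show k+1+3 = k+4 from rfl,
    sw_w5_1, sw_w5_2, sw_w5_3, w5_1, w5_2, w5_3, w5_4]
end

end PSB

namespace PSB
set_option linter.unusedTactic false
set_option linter.unreachableTactic false

/-- local consequences of property (A) for five consecutive letters -/
def H5 (a b c d e : ℕ) : Prop :=
    (a ≠ b) ∧ (b ≠ c) ∧ (c ≠ d) ∧ (d ≠ e) ∧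
    (a = c → a = 0 ∧ b = 1) ∧ (b = d → b = 0 ∧ c = 1) ∧ (c = e → c = 0 ∧ d = 1) ∧
    (a = d → (b = a + 1 ∨ c = a + 1) ∧ (a = 0 ∨ b + 1 = a ∨ c + 1 = a)) ∧
    (b = e → (c = b + 1 ∨ d = b + 1) ∧ (b = 0 ∨ c + 1 = b ∨ d + 1 = b)) ∧
    (a = e → (b = a + 1 ∨ c = a + 1 ∨ d = a + 1) ∧
      (a = 0 ∨ b + 1 = a ∨ c + 1 = a ∨ d + 1 = a))

lemma InX.h5 {n N : ℕ} {x : ℕ → ℕ} (hx : InX n N x) {k : ℕ} (hk : k + 4 < N) :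
    H5 (x k) (x (k+1)) (x (k+2)) (x (k+3)) (x (k+4)) :=
  ⟨hx.l1 (by omega), hx.l1 (k := k+1) (by omega), hx.l1 (k := k+2) (by omega),
    hx.l1 (k := k+3) (by omega), hx.l2 (by omega), hx.l2 (k := k+1) (by omega),
    hx.l2 (k := k+2) (by omega), hx.l3 (by omega), hx.l3 (k := k+1) (by omega), hx.l4 hk⟩

lemma H5.rev {a b c d e : ℕ} (h : H5 a b c d e) : H5 e d c b a := by
  unfold H5 at *
  obtain ⟨h1, h2, h3, h4, h5, h6, h7, h8, h9, h10⟩ := h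
  refine ⟨h4.symm, h3.symm, h2.symm, h1.symm, ?_, ?_, ?_, ?_, ?_, ?_⟩ <;> omega

set_option maxHeartbeats 4000000 in
lemma slc1 (k a b c d e : ℕ) (y : ℕ → ℕ) (H : H5 a b c d e)
    (hc : ((b < d ∧ d < c) ∨ (c < d ∧ d < b)) ∧ e < d) :
    tg (k+3) (tg (k+2) (tg (k+1) (tg k (w5 k a c b d e y)))) =
      sta k (tg (k+3) (tg (k+2) (tg (k+1) (tg k (w5 k a b c d e y))))) := by
  obtain ⟨h1, h2, h3, h4, h5, h6, h7, h8, h9, h10⟩ := H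
  have hc' := hc
  clear hc
  simp only [tg_w5_0]
  split_ifs
  all_goals first | (exfalso; omega) | skip
  all_goals simp only [tg_w5_1]
  all_goals try split_ifs
  all_goals first | (exfalso; omega) | skip
  all_goals simp only [tg_w5_2]
  all_goals try split_ifs
  all_goals first | (exfalso; omega) | skip
  all_goals simp only [tg_w5_3]
  all_goals try split_ifs
  all_goals first | (exfalso; omega) | skip
  all_goals rw [sta_w5_0]
  all_goals first
    | rw [if_pos (by omega)]
    | rw [if_neg (by omega), if_pos (by omega)]
    | rw [if_neg (by omega), if_neg (by omega), if_pos (by omega)]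


set_option maxHeartbeats 4000000 in
lemma slc2 (k a b c d e : ℕ) (y : ℕ → ℕ) (H : H5 a b c d e)
    (hc : (b < c ∨ b < d) ∧ (e < c ∨ e < d) ∧ ((c < b ∨ d < b) ∨ (c < e ∨ d < e))) :
    tg (k+3) (tg (k+2) (tg (k+1) (tg k (w5 k a b d c e y)))) =
      sta k (tg (k+3) (tg (k+2) (tg (k+1) (tg k (w5 k a b c d e y))))) := by
  obtain ⟨h1, h2, h3, h4, h5, h6, h7, h8, h9, h10⟩ := H
  have hc' := hc
  clear hc
  simp only [tg_w5_0]
  split_ifs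
  all_goals first | (exfalso; omega) | skip
  all_goals simp only [tg_w5_1]
  all_goals try split_ifs
  all_goals first | (exfalso; omega) | skip
  all_goals simp only [tg_w5_2]
  all_goals try split_ifs
  all_goals first | (exfalso; omega) | skip
  all_goals simp only [tg_w5_3]
  all_goals try split_ifs
  all_goals first | (exfalso; omega) | skip
  all_goals rw [sta_w5_0]
  all_goals first
    | rw [if_pos (by omega)]
    | rw [if_neg (by omega), if_pos (by omega)]
    | rw [if_neg (by omega), if_neg (by omega), if_pos (by omega)]


set_option maxHeartbeats 4000000 in
lemma slc3 (k a b c d e : ℕ) (y : ℕ → ℕ) (H : H5 a b c d e)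
    (hc : ((d < c ∧ c < e) ∨ (e < c ∧ c < d)) ∧ b < c) :
    tg (k+3) (tg (k+2) (tg (k+1) (tg k (w5 k a b c e d y)))) =
      sta k (tg (k+3) (tg (k+2) (tg (k+1) (tg k (w5 k a b c d e y))))) := by
  obtain ⟨h1, h2, h3, h4, h5, h6, h7, h8, h9, h10⟩ := H
  have hc' := hc
  clear hc
  simp only [tg_w5_0]
  split_ifs
  all_goals first | (exfalso; omega) | skip
  all_goals simp only [tg_w5_1]
  all_goals try split_ifs
  all_goals first | (exfalso; omega) | skip
  all_goals simp only [tg_w5_2]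
  all_goals try split_ifs
  all_goals first | (exfalso; omega) | skip
  all_goals simp only [tg_w5_3]
  all_goals try split_ifs
  all_goals first | (exfalso; omega) | skip
  all_goals rw [sta_w5_0]
  all_goals first
    | rw [if_pos (by omega)]
    | rw [if_neg (by omega), if_pos (by omega)]
    | rw [if_neg (by omega), if_neg (by omega), if_pos (by omega)]


/-- reversal of a window of five letters -/
def rev5 (k : ℕ) (x : ℕ → ℕ) : ℕ → ℕ := w5 k (x (k+4)) (x (k+3)) (x (k+2)) (x (k+1)) (x k) x

lemma rev5_w5 (k a b c d e : ℕ) (y : ℕ → ℕ) : rev5 k (w5 k a b c d e y) = w5 k e d c b a y := by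
  unfold rev5
  rw [w5_0, w5_1, w5_2, w5_3, w5_4]
  funext j; unfold w5; split_ifs <;> rfl

lemma rev5_inj {k : ℕ} {x y : ℕ → ℕ} (h : rev5 k x = rev5 k y) : x = y := by
  have := congrArg (rev5 k) h
  unfold rev5 at this
  simp only [w5_0, w5_1, w5_2, w5_3, w5_4] at this
  have h2 := this
  funext j
  have := congrFun this j
  unfold w5 at this
  split_ifs at this <;> simp_all

lemma rev5_tg0 (k : ℕ) (x : ℕ → ℕ) : rev5 k (tg k x) = tg (k+3) (rev5 k x) := by
  rw [← w5_self k x]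
  generalize x k = a, x (k+1) = b, x (k+2) = c, x (k+3) = d, x (k+4) = e
  rw [rev5_w5, tg_w5_0, tg_w5_3]
  split_ifs <;> first | (exfalso; omega) | rw [rev5_w5]

lemma rev5_tg1 (k : ℕ) (x : ℕ → ℕ) : rev5 k (tg (k+1) x) = tg (k+2) (rev5 k x) := by
  rw [← w5_self k x]
  generalize x k = a, x (k+1) = b, x (k+2) = c, x (k+3) = d, x (k+4) = e
  rw [rev5_w5, tg_w5_1, tg_w5_2]
  split_ifs <;> first | (exfalso; omega) | rw [rev5_w5]

lemma rev5_tg2 (k : ℕ) (x : ℕ → ℕ) : rev5 k (tg (k+2) x) = tg (k+1) (rev5 k x) := by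
  rw [← w5_self k x]
  generalize x k = a, x (k+1) = b, x (k+2) = c, x (k+3) = d, x (k+4) = e
  rw [rev5_w5, tg_w5_2, tg_w5_1]
  split_ifs <;> first | (exfalso; omega) | rw [rev5_w5]

lemma rev5_tg3 (k : ℕ) (x : ℕ → ℕ) : rev5 k (tg (k+3) x) = tg k (rev5 k x) := by
  rw [← w5_self k x]
  generalize x k = a, x (k+1) = b, x (k+2) = c, x (k+3) = d, x (k+4) = e
  rw [rev5_w5, tg_w5_3, tg_w5_0]
  split_ifs <;> first | (exfalso; omega) | rw [rev5_w5]

lemma rev5_sta (k : ℕ) (x : ℕ → ℕ) : rev5 k (sta k x) = sta (k+1) (rev5 k x) := by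
  rw [← w5_self k x]
  generalize x k = a, x (k+1) = b, x (k+2) = c, x (k+3) = d, x (k+4) = e
  rw [rev5_w5, sta_w5_0, sta_w5_1]
  split_ifs <;> first | (exfalso; omega) | rw [rev5_w5]

/-- `sl k` carries a letter through the window -/
def sl (k : ℕ) (x : ℕ → ℕ) : ℕ → ℕ := tg (k+3) (tg (k+2) (tg (k+1) (tg k x)))

/-- inverse of `sl k` -/
def Cc (k : ℕ) (x : ℕ → ℕ) : ℕ → ℕ := tg k (tg (k+1) (tg (k+2) (tg (k+3) x)))

lemma Cc_sl (k : ℕ) (x : ℕ → ℕ) : Cc k (sl k x) = x := by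
  unfold Cc sl; rw [tg_tg, tg_tg, tg_tg, tg_tg]

lemma sl_Cc (k : ℕ) (x : ℕ → ℕ) : sl k (Cc k x) = x := by
  unfold Cc sl; rw [tg_tg, tg_tg, tg_tg, tg_tg]

lemma rev5_sl (k : ℕ) (x : ℕ → ℕ) : rev5 k (Cc k x) = sl k (rev5 k x) := by
  unfold Cc sl
  rw [rev5_tg0, rev5_tg1, rev5_tg2, rev5_tg3]

lemma sl_sta_or (k : ℕ) (x : ℕ → ℕ) (H : H5 (x k) (x (k+1)) (x (k+2)) (x (k+3)) (x (k+4))) :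
    sta (k+1) x = x ∨ sl k (sta (k+1) x) = sta k (sl k x) := by
  rw [← w5_self k x]
  revert H
  generalize x k = a, x (k+1) = b, x (k+2) = c, x (k+3) = d, x (k+4) = e
  intro H
  unfold sl
  rw [sta_w5_1]
  split_ifs with h1 h2 h3
  · exact Or.inr (slc1 k a b c d e x H h1)
  · exact Or.inr (slc2 k a b c d e x H h2)
  · exact Or.inr (slc3 k a b c d e x H h3)
  · exact Or.inl rfl

lemma Cc_sta_or (k : ℕ) (x : ℕ → ℕ) (H : H5 (x k) (x (k+1)) (x (k+2)) (x (k+3)) (x (k+4))) :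
    sta k x = x ∨ Cc k (sta k x) = sta (k+1) (Cc k x) := by
  have key := sl_sta_or k (rev5 k x) (by
    unfold rev5; rw [w5_0, w5_1, w5_2, w5_3, w5_4]; exact H.rev)
  rcases key with h | h
  · left; apply rev5_inj (k := k); rw [rev5_sta, h]
  · right
    apply rev5_inj (k := k)
    have h' : ∀ z, sta k (rev5 k z) = rev5 k (sta (k+1) z) := by
      intro z
      have e := rev5_sta k (rev5 k z)
      have rr : ∀ z, rev5 k (rev5 k z) = z := by
        intro z
        conv_lhs => rw [← w5_self k z]
        rw [rev5_w5, rev5_w5, w5_self]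
      rw [rr] at e
      rw [← e, rr]
    rw [rev5_sl, rev5_sta, h, ← rev5_sl, h']

section
variable {n N : ℕ} {x : ℕ → ℕ}

lemma InX.sl_mem (hx : InX n N x) {k : ℕ} (hk : k + 4 < N) : InX n N (sl k x) :=
  (((hx.tg_mem (by omega)).tg_mem (by omega)).tg_mem (by omega)).tg_mem (by omega)

lemma InX.Cc_mem (hx : InX n N x) {k : ℕ} (hk : k + 4 < N) : InX n N (Cc k x) :=
  (((hx.tg_mem (by omega)).tg_mem (by omega)).tg_mem (by omega)).tg_mem (by omega)

lemma sl_sta (hx : InX n N x) {k : ℕ} (hk : k + 4 < N) :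
    sl k (sta (k+1) x) = sta k (sl k x) := by
  rcases sl_sta_or k x (hx.h5 hk) with h | h
  · rcases Cc_sta_or k (sl k x) ((hx.sl_mem hk).h5 hk) with h' | h'
    · rw [h, h']
    · rw [Cc_sl, h] at h'
      rw [h]
      have := congrArg (sl k) h'
      rw [sl_Cc] at this
      exact this.symm
  · exact h

lemma Cc_sta (hx : InX n N x) {k : ℕ} (hk : k + 4 < N) :
    Cc k (sta k x) = sta (k+1) (Cc k x) := by
  have := sl_sta (hx.Cc_mem hk) hk
  rw [sl_Cc] at this
  rw [← this, Cc_sl]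

end

end PSB

namespace PSB

/-- the action of `*` on promotion sequences (letters doubled) -/
def wst (k : ℕ) (x : ℕ → ℕ) : ℕ → ℕ :=
  if x k = 0 ∧ x (k+1) = 2 ∧ x (k+2) = 0 ∧ x (k+3) = 2 then w5 k 2 0 2 0 (x (k+4)) x
  else if x k = 2 ∧ x (k+1) = 0 ∧ x (k+2) = 2 ∧ x (k+3) = 0 then w5 k 0 2 0 2 (x (k+4)) x
  else if x k < x (k+1) ∧ x (k+1) = x (k+3) ∧ (x (k+1) = x (k+2) + 2 ∨ x (k+2) = x (k+1) + 2)
    then w5 k (x k) (x (k+2)) (x (k+1)) (x (k+2)) (x (k+4)) x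
  else if x k = x (k+2) ∧ x (k+3) < x (k+2) ∧ (x (k+1) = x k + 2 ∨ x k = x (k+1) + 2)
    then w5 k (x (k+1)) (x k) (x (k+1)) (x (k+3)) (x (k+4)) x
  else sta k x

lemma wst_w5 (k a b c d e : ℕ) (y : ℕ → ℕ) : wst k (w5 k a b c d e y) =
    if a = 0 ∧ b = 2 ∧ c = 0 ∧ d = 2 then w5 k 2 0 2 0 e y
    else if a = 2 ∧ b = 0 ∧ c = 2 ∧ d = 0 then w5 k 0 2 0 2 e y
    else if a < b ∧ b = d ∧ (b = c + 2 ∨ c = b + 2) then w5 k a c b c e y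
    else if a = c ∧ d < c ∧ (b = a + 2 ∨ a = b + 2) then w5 k b a b d e y
    else sta k (w5 k a b c d e y) := by
  have h : ∀ a' b' c' d' e', w5 k a' b' c' d' e' (w5 k a b c d e y) = w5 k a' b' c' d' e' y := by
    intro a' b' c' d' e'
    funext j; unfold w5; split_ifs <;> rfl
  unfold wst; simp only [w5_0, w5_1, w5_2, w5_3, w5_4, h]

/-- the six toggles acting on the last four letters -/
def Dw (k : ℕ) (y : ℕ → ℕ) : ℕ → ℕ :=
  tg (k+2) (tg (k+1) (tg k (tg (k+2) (tg (k+1) (tg (k+2) y)))))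

/-- the four promotion letters read off the last four letters -/
def Lw (k : ℕ) (y : ℕ → ℕ) (i : ℕ) : ℕ :=
  if i = 0 then y (k+3) else if i = 1 then tg (k+2) y (k+3)
  else if i = 2 then tg (k+2) (tg (k+1) (tg (k+2) y)) (k+3) else Dw k y (k+3)

/-- facts about the last four letters -/
def U4 (a b c d : ℕ) : Prop :=
  a ≠ b ∧ b ≠ c ∧ c ≠ d ∧ c % 2 = 0 ∧ d % 2 = 0 ∧ (a = c → a = 0 ∧ b = 1) ∧
  (b = d → b = 0 ∧ c = 1) ∧
  (a = d → (b = a + 1 ∨ c = a + 1) ∧ (a = 0 ∨ b + 1 = a ∨ c + 1 = a)) ∧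
  (b % 2 = 1 → (c = b + 1 ∧ d + 1 = b) ∨ (d = b + 1 ∧ c + 1 = b)) ∧
  (a % 2 = 1 → (b = a + 1 ∨ c = a + 1 ∨ d = a + 1) ∧ (b + 1 = a ∨ c + 1 = a ∨ d + 1 = a))

lemma InX.last_even {n N : ℕ} {x : ℕ → ℕ} (hx : InX n N x) {k : ℕ} (hk : k + 1 = N) :
    x k % 2 = 0 := by
  by_contra h
  obtain ⟨l, h1, h2, -⟩ := hx.odd_up (j := k) (by omega) (by omega)
  omega

lemma InX.last2_even {n N : ℕ} {x : ℕ → ℕ} (hx : InX n N x) {k : ℕ} (hk : k + 2 = N) :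
    x k % 2 = 0 := by
  by_contra h
  obtain ⟨l, h1, h2, h3⟩ := hx.odd_up (j := k) (by omega) (by omega)
  obtain ⟨l', h1', h2', h3'⟩ := hx.odd_down (j := k) (by omega) (by omega)
  obtain rfl : l = k + 1 := by omega
  obtain rfl : l' = k + 1 := by omega
  omega

lemma InX.last3 {n N : ℕ} {x : ℕ → ℕ} (hx : InX n N x) {k : ℕ} (hk : k + 3 = N)
    (h : x k % 2 = 1) : (x (k+1) = x k + 1 ∧ x (k+2) + 1 = x k) ∨
      (x (k+2) = x k + 1 ∧ x (k+1) + 1 = x k) := by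
  obtain ⟨l, h1, h2, h3⟩ := hx.odd_up (j := k) (by omega) (by omega)
  obtain ⟨l', h1', h2', h3'⟩ := hx.odd_down (j := k) (by omega) (by omega)
  obtain rfl | rfl : l = k + 1 ∨ l = k + 2 := by omega
  all_goals obtain rfl | rfl : l' = k + 1 ∨ l' = k + 2 := by omega
  all_goals omega

lemma InX.u4 {n N : ℕ} {x : ℕ → ℕ} (hx : InX n N x) {k : ℕ} (hk : k + 4 = N) :
    U4 (x k) (x (k+1)) (x (k+2)) (x (k+3)) := by
  refine ⟨hx.l1 (by omega), hx.l1 (k := k+1) (by omega), hx.l1 (k := k+2) (by omega),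
    hx.last2_even (by omega), hx.last_even (by omega), hx.l2 (by omega),
    hx.l2 (k := k+1) (by omega), hx.l3 (by omega), hx.last3 (k := k+1) (by omega), fun h => ?_⟩
  obtain ⟨l, h1, h2, h3⟩ := hx.odd_up (j := k) (by omega) (by omega)
  obtain ⟨l', h1', h2', h3'⟩ := hx.odd_down (j := k) (by omega) (by omega)
  constructor
  · obtain rfl | rfl | rfl : l = k + 1 ∨ l = k + 2 ∨ l = k + 3 := by omega
    all_goals omega
  · obtain rfl | rfl | rfl : l' = k + 1 ∨ l' = k + 2 ∨ l' = k + 3 := by omega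
    all_goals omega

/-- all arrangements with an odd letter, apart from the exceptional ones -/
def Arr (a b c d m z : ℕ) : Prop :=
  (a = m + 1 ∧ b = m ∧ c = z ∧ d = m + 2) ∨ (a = m + 1 ∧ b = z ∧ c = m ∧ d = m + 2) ∨
  (a = m + 1 ∧ b = m + 2 ∧ c = z ∧ d = m) ∨ (a = m + 1 ∧ b = z ∧ c = m + 2 ∧ d = m) ∨
  (a = m + 1 ∧ b = m ∧ c = m + 2 ∧ d = z) ∨ (a = m + 1 ∧ b = m + 2 ∧ c = m ∧ d = z) ∨
  (a = z ∧ b = m + 1 ∧ c = m ∧ d = m + 2) ∨ (a = z ∧ b = m + 1 ∧ c = m + 2 ∧ d = m)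

lemma even_sep {m z : ℕ} (hm : m % 2 = 0) (hz : z % 2 = 0) (h1 : z ≠ m) (h2 : z ≠ m + 2) :
    z + 2 ≤ m ∨ m + 4 ≤ z := by omega

lemma U4.cases {a b c d : ℕ} (h : U4 a b c d) :
    (a % 2 = 0 ∧ b % 2 = 0 ∧ c % 2 = 0 ∧ d % 2 = 0 ∧ a ≠ b ∧ a ≠ c ∧ a ≠ d ∧ b ≠ c ∧ b ≠ d ∧ c ≠ d)
    ∨ (a = 0 ∧ b = 1 ∧ ((c = 0 ∧ d = 2) ∨ (c = 2 ∧ d = 0)))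
    ∨ (∃ m z, m % 2 = 0 ∧ z % 2 = 0 ∧ (z + 2 ≤ m ∨ m + 4 ≤ z) ∧ Arr a b c d m z) := by
  obtain ⟨h1, h2, h3, h4, h5, h6, h7, h8, h9, h10⟩ := h
  rcases Nat.mod_two_eq_zero_or_one a with ha | ha <;>
    rcases Nat.mod_two_eq_zero_or_one b with hb | hb
  · clear h9 h10
    refine Or.inl ⟨ha, hb, h4, h5, h1, fun e => ?_, fun e => ?_, h2, fun e => ?_, h3⟩
    · have := h6 e; omega
    · have := (h8 e).1; omega
    · have := h7 e; omega
  · have h9 := h9 hb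
    clear h10 h7
    by_cases e : a = c
    · have := h6 e; clear h6 h8; right; left; omega
    by_cases e' : a = d
    · have := h8 e'; clear h6 h8; right; left; omega
    clear h6 h8
    right; right
    rcases h9 with ⟨e1, e2⟩ | ⟨e1, e2⟩
    · exact ⟨d, a, h5, ha, even_sep h5 ha e' (by omega), Or.inr (Or.inr (Or.inr (Or.inr (Or.inr (Or.inr (Or.inr (⟨by omega, by omega, by omega, by omega⟩)))))))⟩
    · exact ⟨c, a, h4, ha, even_sep h4 ha e (by omega), Or.inr (Or.inr (Or.inr (Or.inr (Or.inr (Or.inr (Or.inl ⟨by omega, by omega, by omega, by omega⟩))))))⟩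
  · have h10 := h10 ha
    have hbd : b ≠ d := fun e => by have := h7 e; omega
    clear h9 h8 h7 h6
    right; right
    obtain ⟨u, v⟩ := h10
    rcases u with u | u | u <;> rcases v with v | v | v
    · omega
    · exact ⟨c, d, h4, h5, even_sep h4 h5 (by omega) (by omega), Or.inr (Or.inr (Or.inr (Or.inr (Or.inr (Or.inl ⟨by omega, by omega, by omega, by omega⟩)))))⟩
    · exact ⟨d, c, h5, h4, even_sep h5 h4 (by omega) (by omega), Or.inr (Or.inr (Or.inl ⟨by omega, by omega, by omega, by omega⟩))⟩
    · exact ⟨b, d, hb, h5, even_sep hb h5 (by omega) (by omega), Or.inr (Or.inr (Or.inr (Or.inr (Or.inl ⟨by omega, by omega, by omega, by omega⟩))))⟩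
    · omega
    · exact ⟨d, b, h5, hb, even_sep h5 hb (by omega) (by omega), Or.inr (Or.inr (Or.inr (Or.inl ⟨by omega, by omega, by omega, by omega⟩)))⟩
    · exact ⟨b, c, hb, h4, even_sep hb h4 (by omega) (by omega), Or.inl ⟨by omega, by omega, by omega, by omega⟩⟩
    · exact ⟨c, b, h4, hb, even_sep h4 hb (by omega) (by omega), Or.inr (Or.inl ⟨by omega, by omega, by omega, by omega⟩)⟩
    · omega
  · exfalso
    have h9 := h9 hb
    have h10 := h10 ha
    clear h8 h7 h6
    omega

section
variable (k a b c d e : ℕ) (y : ℕ → ℕ)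

/-- explicit values of `Dw` and `Lw` -/
def DL (k a b c d e : ℕ) (y : ℕ → ℕ) (p q r s l2 l3 : ℕ) : Prop :=
  Dw k (w5 k a b c d e y) = w5 k p q r s e y ∧ Lw k (w5 k a b c d e y) 0 = d ∧
  Lw k (w5 k a b c d e y) 1 = c ∧ Lw k (w5 k a b c d e y) 2 = l2 ∧
  Lw k (w5 k a b c d e y) 3 = l3

lemma DL1 (h : a % 2 = 0 ∧ b % 2 = 0 ∧ c % 2 = 0 ∧ d % 2 = 0 ∧ a ≠ b ∧ a ≠ c ∧ a ≠ d ∧ b ≠ c ∧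
    b ≠ d ∧ c ≠ d) : DL k a b c d e y d c b a b a := by
  unfold DL Lw Dw
  have ev : ∀ u v : ℕ, u % 2 = 0 → v % 2 = 0 → u ≠ v → ¬ (u ≤ v + 1 ∧ v ≤ u + 1) := by omega
  obtain ⟨ha, hb, hc, hd, h1, h2, h3, h4, h5, h6⟩ := h
  simp only [tg_w5_2, if_neg (ev c d hc hd h6), tg_w5_1, if_neg (ev b d hb hd h5),
    if_neg (ev b c hb hc h4), tg_w5_0, if_neg (ev a d ha hd h3), if_neg (ev a c ha hc h2),
    if_neg (ev a b ha hb h1), w5_3]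
  simp

lemma DL2 (h1 : a ≤ d + 1 ∧ d ≤ a + 1) (h2 : ¬ (b ≤ c + 1 ∧ c ≤ b + 1))
    (h3 : ¬ (b ≤ d + 1 ∧ d ≤ b + 1)) (h4 : ¬ (c ≤ d + 1 ∧ d ≤ c + 1)) :
    DL k a b c d e y a c b d b d := by
  unfold DL Lw Dw
  simp only [tg_w5_2, if_neg h4, tg_w5_1, if_neg h3, if_neg (show ¬ (d ≤ b + 1 ∧ b ≤ d + 1) by omega),
    if_neg (show ¬ (d ≤ c + 1 ∧ c ≤ d + 1) by omega), if_neg h2, tg_w5_0, if_pos h1, w5_3]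
  simp

lemma DL3 (h1 : ¬ (a ≤ d + 1 ∧ d ≤ a + 1)) (h2 : ¬ (b ≤ c + 1 ∧ c ≤ b + 1))
    (h3 : ¬ (b ≤ d + 1 ∧ d ≤ b + 1)) (h4 : ¬ (c ≤ d + 1 ∧ d ≤ c + 1))
    (h5 : a ≤ c + 1 ∧ c ≤ a + 1) : DL k a b c d e y d a b c b c := by
  unfold DL Lw Dw
  simp only [tg_w5_2, if_neg h4, tg_w5_1, if_neg h3, if_neg h2,
    if_neg (show ¬ (c ≤ b + 1 ∧ b ≤ c + 1) by omega), tg_w5_0, if_neg h1, if_pos h5, w5_3]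
  simp

lemma DL4 (h : a = 0 ∧ b = 1 ∧ ((c = 0 ∧ d = 2) ∨ (c = 2 ∧ d = 0))) :
    DL k a b c d e y a b d c d c := by
  obtain ⟨rfl, rfl, ⟨rfl, rfl⟩ | ⟨rfl, rfl⟩⟩ := h <;> unfold DL Lw Dw <;>
  simp [tg_w5_2, tg_w5_1, tg_w5_0, w5_3]

lemma DL5 (h1 : ¬ (a ≤ d + 1 ∧ d ≤ a + 1)) (h2 : ¬ (a ≤ c + 1 ∧ c ≤ a + 1))
    (h3 : (b ≤ d + 1 ∧ d ≤ b + 1)) (h4 : ¬ (c ≤ d + 1 ∧ d ≤ c + 1))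
    (h5 : ¬ (a ≤ b + 1 ∧ b ≤ a + 1)) : DL k a b c d e y b c d a d a := by
  unfold DL Lw Dw
  simp only [tg_w5_2, if_neg h4, tg_w5_1, if_pos h3,
    if_neg (show ¬ (d ≤ c + 1 ∧ c ≤ d + 1) by omega), tg_w5_0, if_neg h1, if_neg h2, if_neg h5, w5_3]
  simp
end

/-- the desired compatibility -/
def Good (k : ℕ) (w w' : ℕ → ℕ) : Prop :=
  Dw k w' = sta k (Dw k w) ∧ ∀ (j e : ℕ) (z : ℕ → ℕ),
    w5 j (Lw k w' 0) (Lw k w' 1) (Lw k w' 2) (Lw k w' 3) e z =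
    wst j (w5 j (Lw k w 0) (Lw k w 1) (Lw k w 2) (Lw k w 3) e z)

lemma good_of {k a b c d e : ℕ} {y : ℕ → ℕ} {p q r s l2 l3 a' b' c' d' p' q' r' s' l2' l3' : ℕ}
    (h : DL k a b c d e y p q r s l2 l3) (h' : DL k a' b' c' d' e y p' q' r' s' l2' l3')
    (h1 : w5 k p' q' r' s' e y = sta k (w5 k p q r s e y))
    (h2 : ∀ (j e : ℕ) (z : ℕ → ℕ), w5 j d' c' l2' l3' e z = wst j (w5 j d c l2 l3 e z)) :
    Good k (w5 k a b c d e y) (w5 k a' b' c' d' e y) := by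
  obtain ⟨u0, u1, u2, u3, u4⟩ := h
  obtain ⟨v0, v1, v2, v3, v4⟩ := h'
  refine ⟨by rw [u0, v0, h1], fun j e z => ?_⟩
  rw [u1, u2, u3, u4, v1, v2, v3, v4, h2]

lemma sta_w5_rev {k a b c d e : ℕ} {y : ℕ → ℕ} {a' b' c' d' : ℕ}
    (h : (((a < c ∧ c < b) ∨ (b < c ∧ c < a)) ∧ d < c ∧ a' = b ∧ b' = a ∧ c' = c ∧ d' = d) ∨
      ((a < b ∨ a < c) ∧ (d < b ∨ d < c) ∧ ((b < a ∨ c < a) ∨ (b < d ∨ c < d)) ∧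
        a' = a ∧ b' = c ∧ c' = b ∧ d' = d) ∨
      (((c < b ∧ b < d) ∨ (d < b ∧ b < c)) ∧ a < b ∧ a' = a ∧ b' = b ∧ c' = d ∧ d' = c) ∨
      (¬ (((a < c ∧ c < b) ∨ (b < c ∧ c < a)) ∧ d < c) ∧
        ¬ ((a < b ∨ a < c) ∧ (d < b ∨ d < c) ∧ ((b < a ∨ c < a) ∨ (b < d ∨ c < d))) ∧
        ¬ (((c < b ∧ b < d) ∨ (d < b ∧ b < c)) ∧ a < b) ∧ a' = a ∧ b' = b ∧ c' = c ∧ d' = d)) :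
    w5 k d' c' b' a' e y = sta k (w5 k d c b a e y) := by
  rw [sta_w5_0]
  rcases h with ⟨h1, h2, rfl, rfl, rfl, rfl⟩ | ⟨h1, h2, h3, rfl, rfl, rfl, rfl⟩ |
    ⟨h1, h2, rfl, rfl, rfl, rfl⟩ | ⟨h1, h2, h3, rfl, rfl, rfl, rfl⟩
  · rw [if_neg (by omega), if_neg (by omega), if_pos (by omega)]
  · rw [if_neg (by omega), if_pos (by omega)]
  · rw [if_pos (by omega)]
  · rw [if_neg (by omega), if_neg (by omega), if_neg (by omega)]

lemma wst_distinct {k a b c d e : ℕ} {y : ℕ → ℕ} (h1 : a ≠ c) (h2 : b ≠ d) :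
    wst k (w5 k a b c d e y) = sta k (w5 k a b c d e y) := by
  rw [wst_w5, if_neg (by omega), if_neg (by omega), if_neg (by omega), if_neg (by omega)]

lemma Dw_sta_even (k a b c d e : ℕ) (y : ℕ → ℕ)
    (h : a % 2 = 0 ∧ b % 2 = 0 ∧ c % 2 = 0 ∧ d % 2 = 0 ∧ a ≠ b ∧ a ≠ c ∧ a ≠ d ∧ b ≠ c ∧
      b ≠ d ∧ c ≠ d) :
    Good k (w5 k a b c d e y) (sta k (w5 k a b c d e y)) := by
  have D0 := DL1 k _ _ _ _ e y h
  obtain ⟨ha, hb, hc, hd, h1, h2, h3, h4, h5, h6⟩ := h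
  rw [sta_w5_0]; split_ifs with g1 g2 g3
  · refine good_of D0 (DL1 k _ _ _ _ e y
      ⟨hb, ha, hc, hd, h1.symm, h4, h5, h2, h3, h6⟩) ?_ (fun j e z => ?_)
    · exact sta_w5_rev (Or.inl ⟨g1.1, g1.2, rfl, rfl, rfl, rfl⟩)
    · rw [wst_distinct h5.symm h2.symm]
      exact sta_w5_rev (Or.inl ⟨g1.1, g1.2, rfl, rfl, rfl, rfl⟩)
  · refine good_of D0 (DL1 k _ _ _ _ e y
      ⟨ha, hc, hb, hd, h2, h1, h3, h4.symm, h6, h5⟩) ?_ (fun j e z => ?_)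
    · exact sta_w5_rev (Or.inr (Or.inl ⟨g2.1, g2.2.1, g2.2.2, rfl, rfl, rfl, rfl⟩))
    · rw [wst_distinct h5.symm h2.symm]
      exact sta_w5_rev (Or.inr (Or.inl ⟨g2.1, g2.2.1, g2.2.2, rfl, rfl, rfl, rfl⟩))
  · refine good_of D0 (DL1 k _ _ _ _ e y
      ⟨ha, hb, hd, hc, h1, h3, h2, h5, h4, h6.symm⟩) ?_ (fun j e z => ?_)
    · exact sta_w5_rev (Or.inr (Or.inr (Or.inl ⟨g3.1, g3.2, rfl, rfl, rfl, rfl⟩)))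
    · rw [wst_distinct h5.symm h2.symm]
      exact sta_w5_rev (Or.inr (Or.inr (Or.inl ⟨g3.1, g3.2, rfl, rfl, rfl, rfl⟩)))
  · refine good_of D0 D0 ?_ (fun j e z => ?_)
    · exact sta_w5_rev (Or.inr (Or.inr (Or.inr ⟨g1, g2, g3, rfl, rfl, rfl, rfl⟩)))
    · rw [wst_distinct h5.symm h2.symm]
      exact sta_w5_rev (Or.inr (Or.inr (Or.inr ⟨g1, g2, g3, rfl, rfl, rfl, rfl⟩)))

section
variable {k a b c d e : ℕ} {y : ℕ → ℕ}
lemma sb1 (h : ((a < c ∧ c < b) ∨ (b < c ∧ c < a)) ∧ d < c) :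
    sta k (w5 k a b c d e y) = w5 k b a c d e y := by
  rw [sta_w5_0, if_pos h]
lemma sb2 (h' : ¬ (((a < c ∧ c < b) ∨ (b < c ∧ c < a)) ∧ d < c))
    (h : (a < b ∨ a < c) ∧ (d < b ∨ d < c) ∧ ((b < a ∨ c < a) ∨ (b < d ∨ c < d))) :
    sta k (w5 k a b c d e y) = w5 k a c b d e y := by
  rw [sta_w5_0, if_neg h', if_pos h]
lemma sb3 (h' : ¬ (((a < c ∧ c < b) ∨ (b < c ∧ c < a)) ∧ d < c))
    (h : ¬ ((a < b ∨ a < c) ∧ (d < b ∨ d < c) ∧ ((b < a ∨ c < a) ∨ (b < d ∨ c < d))))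
    (h2 : ((c < b ∧ b < d) ∨ (d < b ∧ b < c)) ∧ a < b) :
    sta k (w5 k a b c d e y) = w5 k a b d c e y := by
  rw [sta_w5_0, if_neg h', if_neg h, if_pos h2]
lemma sb4 (h' : ¬ (((a < c ∧ c < b) ∨ (b < c ∧ c < a)) ∧ d < c))
    (h : ¬ ((a < b ∨ a < c) ∧ (d < b ∨ d < c) ∧ ((b < a ∨ c < a) ∨ (b < d ∨ c < d))))
    (h2 : ¬ (((c < b ∧ b < d) ∨ (d < b ∧ b < c)) ∧ a < b)) :
    sta k (w5 k a b c d e y) = w5 k a b c d e y := by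
  rw [sta_w5_0, if_neg h', if_neg h, if_neg h2]
lemma wb3 (h3 : ¬ (a = 0 ∧ b = 2 ∧ c = 0 ∧ d = 2)) (h4 : ¬ (a = 2 ∧ b = 0 ∧ c = 2 ∧ d = 0))
    (h : a < b ∧ b = d ∧ (b = c + 2 ∨ c = b + 2)) :
    wst k (w5 k a b c d e y) = w5 k a c b c e y := by
  rw [wst_w5, if_neg h3, if_neg h4, if_pos h]
lemma wb4 (h3 : ¬ (a = 0 ∧ b = 2 ∧ c = 0 ∧ d = 2)) (h4 : ¬ (a = 2 ∧ b = 0 ∧ c = 2 ∧ d = 0))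
    (h5 : ¬ (a < b ∧ b = d ∧ (b = c + 2 ∨ c = b + 2)))
    (h : a = c ∧ d < c ∧ (b = a + 2 ∨ a = b + 2)) :
    wst k (w5 k a b c d e y) = w5 k b a b d e y := by
  rw [wst_w5, if_neg h3, if_neg h4, if_neg h5, if_pos h]
lemma wb5 (h3 : ¬ (a = 0 ∧ b = 2 ∧ c = 0 ∧ d = 2)) (h4 : ¬ (a = 2 ∧ b = 0 ∧ c = 2 ∧ d = 0))
    (h5 : ¬ (a < b ∧ b = d ∧ (b = c + 2 ∨ c = b + 2)))
    (h : ¬ (a = c ∧ d < c ∧ (b = a + 2 ∨ a = b + 2))) :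
    wst k (w5 k a b c d e y) = sta k (w5 k a b c d e y) := by
  rw [wst_w5, if_neg h3, if_neg h4, if_neg h5, if_neg h]
end

lemma good_of' {k a b c d e : ℕ} {y : ℕ → ℕ} {p q r s l2 l3 a' b' c' d' p' q' r' s' l2' l3' : ℕ}
    (h0 : sta k (w5 k a b c d e y) = w5 k a' b' c' d' e y)
    (h : DL k a b c d e y p q r s l2 l3) (h' : DL k a' b' c' d' e y p' q' r' s' l2' l3')
    (h1 : sta k (w5 k p q r s e y) = w5 k p' q' r' s' e y)
    (h2 : ∀ (j e : ℕ) (z : ℕ → ℕ), wst j (w5 j d c l2 l3 e z) = w5 j d' c' l2' l3' e z) :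
    Good k (w5 k a b c d e y) (sta k (w5 k a b c d e y)) := by
  rw [h0]; exact good_of h h' h1.symm (fun j e z => (h2 j e z).symm)

lemma Dw_arr_lo (k a b c d e m z : ℕ) (y : ℕ → ℕ) (hs : z + 2 ≤ m) (h : Arr a b c d m z) :
    Good k (w5 k a b c d e y) (sta k (w5 k a b c d e y)) := by
  obtain ⟨rfl, rfl, rfl, rfl⟩ | ⟨rfl, rfl, rfl, rfl⟩ | ⟨rfl, rfl, rfl, rfl⟩ | ⟨rfl, rfl, rfl, rfl⟩ | ⟨rfl, rfl, rfl, rfl⟩ | ⟨rfl, rfl, rfl, rfl⟩ | ⟨rfl, rfl, rfl, rfl⟩ | ⟨rfl, rfl, rfl, rfl⟩ := h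
  · exact good_of' (sb4 (by omega) (by omega) (by omega))
      (DL2 k _ _ _ _ e y (by omega) (by omega) (by omega) (by omega))
      (DL2 k _ _ _ _ e y (by omega) (by omega) (by omega) (by omega))
      (sb4 (by omega) (by omega) (by omega))
      (fun _ _ _ => (wb5 (by omega) (by omega) (by omega) (by omega)).trans (sb4 (by omega) (by omega) (by omega)))
  · exact good_of' (sb4 (by omega) (by omega) (by omega))
      (DL2 k _ _ _ _ e y (by omega) (by omega) (by omega) (by omega))
      (DL2 k _ _ _ _ e y (by omega) (by omega) (by omega) (by omega))
      (sb4 (by omega) (by omega) (by omega))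
      (fun _ _ _ => (wb5 (by omega) (by omega) (by omega) (by omega)).trans (sb4 (by omega) (by omega) (by omega)))
  · exact good_of' (sb2 (by omega) (by omega))
      (DL2 k _ _ _ _ e y (by omega) (by omega) (by omega) (by omega))
      (DL2 k _ _ _ _ e y (by omega) (by omega) (by omega) (by omega))
      (sb2 (by omega) (by omega))
      (fun _ _ _ => (wb5 (by omega) (by omega) (by omega) (by omega)).trans (sb2 (by omega) (by omega)))
  · exact good_of' (sb2 (by omega) (by omega))
      (DL2 k _ _ _ _ e y (by omega) (by omega) (by omega) (by omega))
      (DL2 k _ _ _ _ e y (by omega) (by omega) (by omega) (by omega))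
      (sb2 (by omega) (by omega))
      (fun _ _ _ => (wb5 (by omega) (by omega) (by omega) (by omega)).trans (sb2 (by omega) (by omega)))
  · exact good_of' (sb2 (by omega) (by omega))
      (DL3 k _ _ _ _ e y (by omega) (by omega) (by omega) (by omega) (by omega))
      (DL3 k _ _ _ _ e y (by omega) (by omega) (by omega) (by omega) (by omega))
      (sb3 (by omega) (by omega) (by omega))
      (fun _ _ _ => wb3 (by omega) (by omega) (by omega))
  · exact good_of' (sb2 (by omega) (by omega))
      (DL3 k _ _ _ _ e y (by omega) (by omega) (by omega) (by omega) (by omega))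
      (DL3 k _ _ _ _ e y (by omega) (by omega) (by omega) (by omega) (by omega))
      (sb3 (by omega) (by omega) (by omega))
      (fun _ _ _ => wb3 (by omega) (by omega) (by omega))
  · exact good_of' (sb3 (by omega) (by omega) (by omega))
      (DL5 k _ _ _ _ e y (by omega) (by omega) (by omega) (by omega) (by omega))
      (DL5 k _ _ _ _ e y (by omega) (by omega) (by omega) (by omega) (by omega))
      (sb2 (by omega) (by omega))
      (fun _ _ _ => wb4 (by omega) (by omega) (by omega) (by omega))
  · exact good_of' (sb3 (by omega) (by omega) (by omega))
      (DL5 k _ _ _ _ e y (by omega) (by omega) (by omega) (by omega) (by omega))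
      (DL5 k _ _ _ _ e y (by omega) (by omega) (by omega) (by omega) (by omega))
      (sb2 (by omega) (by omega))
      (fun _ _ _ => wb4 (by omega) (by omega) (by omega) (by omega))

lemma Dw_arr_hi (k a b c d e m z : ℕ) (y : ℕ → ℕ) (hs : m + 4 ≤ z) (h : Arr a b c d m z) :
    Good k (w5 k a b c d e y) (sta k (w5 k a b c d e y)) := by
  obtain ⟨rfl, rfl, rfl, rfl⟩ | ⟨rfl, rfl, rfl, rfl⟩ | ⟨rfl, rfl, rfl, rfl⟩ | ⟨rfl, rfl, rfl, rfl⟩ | ⟨rfl, rfl, rfl, rfl⟩ | ⟨rfl, rfl, rfl, rfl⟩ | ⟨rfl, rfl, rfl, rfl⟩ | ⟨rfl, rfl, rfl, rfl⟩ := h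
  · exact good_of' (sb2 (by omega) (by omega))
      (DL2 k _ _ _ _ e y (by omega) (by omega) (by omega) (by omega))
      (DL2 k _ _ _ _ e y (by omega) (by omega) (by omega) (by omega))
      (sb2 (by omega) (by omega))
      (fun _ _ _ => (wb5 (by omega) (by omega) (by omega) (by omega)).trans (sb2 (by omega) (by omega)))
  · exact good_of' (sb2 (by omega) (by omega))
      (DL2 k _ _ _ _ e y (by omega) (by omega) (by omega) (by omega))
      (DL2 k _ _ _ _ e y (by omega) (by omega) (by omega) (by omega))
      (sb2 (by omega) (by omega))
      (fun _ _ _ => (wb5 (by omega) (by omega) (by omega) (by omega)).trans (sb2 (by omega) (by omega)))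
  · exact good_of' (sb3 (by omega) (by omega) (by omega))
      (DL2 k _ _ _ _ e y (by omega) (by omega) (by omega) (by omega))
      (DL3 k _ _ _ _ e y (by omega) (by omega) (by omega) (by omega) (by omega))
      (sb1 (by omega))
      (fun _ _ _ => (wb5 (by omega) (by omega) (by omega) (by omega)).trans (sb1 (by omega)))
  · exact good_of' (sb1 (by omega))
      (DL2 k _ _ _ _ e y (by omega) (by omega) (by omega) (by omega))
      (DL5 k _ _ _ _ e y (by omega) (by omega) (by omega) (by omega) (by omega))
      (sb3 (by omega) (by omega) (by omega))
      (fun _ _ _ => (wb5 (by omega) (by omega) (by omega) (by omega)).trans (sb3 (by omega) (by omega) (by omega)))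
  · exact good_of' (sb4 (by omega) (by omega) (by omega))
      (DL3 k _ _ _ _ e y (by omega) (by omega) (by omega) (by omega) (by omega))
      (DL3 k _ _ _ _ e y (by omega) (by omega) (by omega) (by omega) (by omega))
      (sb4 (by omega) (by omega) (by omega))
      (fun _ _ _ => (wb5 (by omega) (by omega) (by omega) (by omega)).trans (sb4 (by omega) (by omega) (by omega)))
  · exact good_of' (sb3 (by omega) (by omega) (by omega))
      (DL3 k _ _ _ _ e y (by omega) (by omega) (by omega) (by omega) (by omega))
      (DL2 k _ _ _ _ e y (by omega) (by omega) (by omega) (by omega))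
      (sb1 (by omega))
      (fun _ _ _ => (wb5 (by omega) (by omega) (by omega) (by omega)).trans (sb1 (by omega)))
  · exact good_of' (sb4 (by omega) (by omega) (by omega))
      (DL5 k _ _ _ _ e y (by omega) (by omega) (by omega) (by omega) (by omega))
      (DL5 k _ _ _ _ e y (by omega) (by omega) (by omega) (by omega) (by omega))
      (sb4 (by omega) (by omega) (by omega))
      (fun _ _ _ => (wb5 (by omega) (by omega) (by omega) (by omega)).trans (sb4 (by omega) (by omega) (by omega)))
  · exact good_of' (sb1 (by omega))
      (DL5 k _ _ _ _ e y (by omega) (by omega) (by omega) (by omega) (by omega))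
      (DL2 k _ _ _ _ e y (by omega) (by omega) (by omega) (by omega))
      (sb3 (by omega) (by omega) (by omega))
      (fun _ _ _ => (wb5 (by omega) (by omega) (by omega) (by omega)).trans (sb3 (by omega) (by omega) (by omega)))

lemma Dw_sta_aux (k a b c d e : ℕ) (y : ℕ → ℕ) (H : U4 a b c d) :
    Good k (w5 k a b c d e y) (sta k (w5 k a b c d e y)) := by
  rcases H.cases with h | h | ⟨m, z, hm, hz, hs, h⟩
  · exact Dw_sta_even k a b c d e y h
  · rw [sta_w5_0]; split_ifs with h1 h2 h3
    all_goals first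
      | (exfalso; omega)
      | refine good_of (DL4 k _ _ _ _ e y h) (DL4 k _ _ _ _ e y (by omega)) ?_ (fun j e z => ?_)
    all_goals obtain ⟨rfl, rfl, ⟨rfl, rfl⟩ | ⟨rfl, rfl⟩⟩ := h
    all_goals first
      | (rw [sta_w5_0]; simp; done)
      | (rw [wst_w5]; simp; done)
  · rcases hs with hs | hs
    · exact Dw_arr_lo k a b c d e m z y hs h
    · exact Dw_arr_hi k a b c d e m z y hs h

lemma Dw_sta {n N : ℕ} {x : ℕ → ℕ} (hx : InX n N x) {k : ℕ} (hk : k + 4 = N) :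
    Good k x (sta k x) := by
  have := Dw_sta_aux k _ _ _ _ (x (k+4)) x (hx.u4 hk)
  rwa [w5_self] at this

/-- peak at `j`, `j+1`, `j+2` -/
def Pk (x : ℕ → ℕ) (j : ℕ) : Prop := x j < x (j+1) ∧ x (j+2) < x (j+1)

lemma Lw_Pk {n N : ℕ} {x : ℕ → ℕ} (hx : InX n N x) {k : ℕ} (hk : k + 4 = N) :
    (Lw k x 0 < Lw k x 1 ∧ Lw k x 2 < Lw k x 1) ↔ Pk x (k+1) := by
  unfold Pk
  have H := hx.u4 hk
  rw [← w5_self k x]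
  revert H
  generalize x k = a, x (k+1) = b, x (k+2) = c, x (k+3) = d, x (k+4) = e
  intro H
  rw [w5_1, show k+1+1 = k+2 from rfl, show k+1+2 = k+3 from rfl, w5_2, w5_3]
  rcases H.cases with h | h | ⟨m, z, hm, hz, hs, h⟩
  · obtain ⟨u0, u1, u2, u3, u4⟩ := DL1 k _ _ _ _ e x h
    rw [u1, u2, u3, and_comm]
  · obtain ⟨u0, u1, u2, u3, u4⟩ := DL4 k _ _ _ _ e x h
    rw [u1, u2, u3]; omega
  · clear hm hz H
    obtain ⟨e1, e2, e3, e4⟩ | ⟨e1, e2, e3, e4⟩ | ⟨e1, e2, e3, e4⟩ |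
      ⟨e1, e2, e3, e4⟩ | ⟨e1, e2, e3, e4⟩ | ⟨e1, e2, e3, e4⟩ |
      ⟨e1, e2, e3, e4⟩ | ⟨e1, e2, e3, e4⟩ := h
    · obtain ⟨u0, u1, u2, u3, u4⟩ := DL2 k a b c d e x (by omega) (by omega) (by omega) (by omega)
      rw [u1, u2, u3]; omega
    · obtain ⟨u0, u1, u2, u3, u4⟩ := DL2 k a b c d e x (by omega) (by omega) (by omega) (by omega)
      rw [u1, u2, u3]; omega
    · obtain ⟨u0, u1, u2, u3, u4⟩ := DL2 k a b c d e x (by omega) (by omega) (by omega) (by omega)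
      rw [u1, u2, u3]; omega
    · obtain ⟨u0, u1, u2, u3, u4⟩ := DL2 k a b c d e x (by omega) (by omega) (by omega) (by omega)
      rw [u1, u2, u3]; omega
    · obtain ⟨u0, u1, u2, u3, u4⟩ := DL3 k a b c d e x (by omega) (by omega) (by omega) (by omega) (by omega)
      rw [u1, u2, u3]; omega
    · obtain ⟨u0, u1, u2, u3, u4⟩ := DL3 k a b c d e x (by omega) (by omega) (by omega) (by omega) (by omega)
      rw [u1, u2, u3]; omega
    · obtain ⟨u0, u1, u2, u3, u4⟩ := DL5 k a b c d e x (by omega) (by omega) (by omega) (by omega) (by omega)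
      rw [u1, u2, u3]; omega
    · obtain ⟨u0, u1, u2, u3, u4⟩ := DL5 k a b c d e x (by omega) (by omega) (by omega) (by omega) (by omega)
      rw [u1, u2, u3]; omega

end PSB

namespace PSB
variable {n N : ℕ} {x : ℕ → ℕ}

/-- partial promotion -/
def pr : ℕ → (ℕ → ℕ) → (ℕ → ℕ)
  | 0, x => x
  | m+1, x => tg m (pr m x)

lemma sta_ne {k j : ℕ} (x : ℕ → ℕ) (h : j < k ∨ k + 3 < j) : sta k x j = x j := by
  unfold sta; split_ifs
  · exact sw_ne x (by omega) (by omega)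
  · exact sw_ne x (by omega) (by omega)
  · exact sw_ne x (by omega) (by omega)
  · rfl

lemma tg_sw_comm {i j : ℕ} (h : i + 1 < j ∨ j + 1 < i) (x : ℕ → ℕ) :
    tg i (sw j x) = sw j (tg i x) := by
  unfold tg
  rw [sw_ne (k := j) (j := i) x (by omega) (by omega),
    sw_ne (k := j) (j := i+1) x (by omega) (by omega)]
  split_ifs
  · rfl
  · rcases h with h | h
    · exact sw_comm h x
    · exact (sw_comm h x).symm

lemma tg_sta_comm {i k : ℕ} (h : i + 1 < k ∨ k + 3 < i) (x : ℕ → ℕ) :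
    tg i (sta k x) = sta k (tg i x) := by
  unfold sta
  rw [tg_ne (k := i) (j := k) x (by omega) (by omega),
    tg_ne (k := i) (j := k+1) x (by omega) (by omega),
    tg_ne (k := i) (j := k+2) x (by omega) (by omega),
    tg_ne (k := i) (j := k+3) x (by omega) (by omega)]
  split_ifs
  · exact tg_sw_comm (by omega) x
  · exact tg_sw_comm (by omega) x
  · exact tg_sw_comm (by omega) x
  · rfl

lemma pr_ne {m j : ℕ} (x : ℕ → ℕ) (h : m < j) : pr m x j = x j := by
  induction m with
  | zero => rfl
  | succ m ih => rw [pr, tg_ne _ (by omega) (by omega), ih (by omega)]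

lemma pr_tg {m j : ℕ} (x : ℕ → ℕ) (h : m < j) : pr m (tg j x) = tg j (pr m x) := by
  induction m with
  | zero => rfl
  | succ m ih => rw [pr, pr, ih (by omega), tg_comm (by omega)]

lemma pr_sta {m k : ℕ} (x : ℕ → ℕ) (h : m < k) : pr m (sta k x) = sta k (pr m x) := by
  induction m with
  | zero => rfl
  | succ m ih => rw [pr, pr, ih (by omega), tg_sta_comm (by omega)]

lemma InX.pr_mem (hx : InX n N x) {m : ℕ} (hm : m < N) : InX n N (pr m x) := by
  induction m with
  | zero => exact hx
  | succ m ih => exact (ih (by omega)).tg_mem hm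

lemma pr_sta' (hx : InX n N x) {k m : ℕ} (hm : m < N) (h : k + 4 ≤ m) :
    pr m (sta (k+1) x) = sta k (pr m x) := by
  induction m with
  | zero => omega
  | succ m ih =>
    by_cases hk : k + 4 ≤ m
    · rw [pr, pr, ih (by omega) hk, tg_sta_comm (by omega)]
    · obtain rfl : m = k + 3 := by omega
      have := sl_sta (hx.pr_mem (m := k) (by omega)) (k := k) (by omega)
      unfold sl at this
      simp only [pr]
      rw [pr_sta _ (by omega), this]

/-- promotion on content words -/
def P (N : ℕ) (x : ℕ → ℕ) : ℕ → ℕ := pr (N-1) x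

lemma InX.P_mem (hx : InX n N x) (hN : 0 < N) : InX n N (P N x) := hx.pr_mem (by omega)

lemma InX.Pi_mem (hx : InX n N x) (hN : 0 < N) (i : ℕ) : InX n N ((P N)^[i] x) := by
  induction i with
  | zero => exact hx
  | succ i ih => rw [Function.iterate_succ_apply']; exact ih.P_mem hN

lemma P_sta (hx : InX n N x) {k : ℕ} (hk : k + 4 < N) :
    P N (sta (k+1) x) = sta k (P N x) := pr_sta' hx (by omega) (by omega)

lemma nn1 {a b c : ℕ} (h : (a < c ∧ c < b) ∨ (b < c ∧ c < a)) : ¬ near a b := by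
  unfold near; omega
lemma nn2 {a b c d : ℕ} (hbc : b ≠ c) (h : (a < b ∨ a < c) ∧ (d < b ∨ d < c) ∧
    ((b < a ∨ c < a) ∨ (b < d ∨ c < d))) : ¬ near b c := by
  unfold near; omega

lemma InX.sta_mem (hx : InX n N x) {k : ℕ} (hk : k + 3 < N) : InX n N (sta k x) := by
  have h2 := hx.l1 (k := k+1) (by omega)
  unfold sta; split_ifs with g1 g2 g3
  · exact hx.sw_mem (by omega) (nn1 g1.1)
  · exact hx.sw_mem (by omega) (nn2 h2 g2)
  · exact hx.sw_mem (k := k+2) (by omega) (nn1 g3.1)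
  · exact hx

/-- staircase part of the fourth power of promotion -/
def G (m : ℕ) (x : ℕ → ℕ) : ℕ → ℕ := pr m (pr (m+1) (pr (m+2) (pr (m+3) x)))

lemma G_succ (m : ℕ) (x : ℕ → ℕ) : G (m+1) x = Cc m (G m x) := by
  unfold G Cc
  have e : ∀ i y, pr (i+1) y = tg i (pr i y) := fun _ _ => rfl
  rw [e m, show m+1+1 = m+2 from rfl, e (m+1), show m+1+2 = m+3 from rfl, e (m+2),
    show m+1+3 = m+4 from rfl, e (m+3), pr_tg (m := m+2) (j := m+3) _ (by omega),
    pr_tg (m := m+1) (j := m+2) _ (by omega), pr_tg (m := m+1) (j := m+3) _ (by omega),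
    pr_tg (m := m) (j := m+1) _ (by omega), pr_tg (m := m) (j := m+2) _ (by omega),
    pr_tg (m := m) (j := m+3) _ (by omega)]

lemma InX.G_mem (hx : InX n N x) {m : ℕ} (hm : m + 3 < N) : InX n N (G m x) :=
  (((hx.pr_mem (by omega)).pr_mem (by omega)).pr_mem (by omega)).pr_mem (by omega)

lemma P_iter (k : ℕ) (x : ℕ → ℕ) :
    P (k+4) x = pr (k+3) x ∧
    P (k+4) (P (k+4) x) = tg (k+2) (pr (k+2) (pr (k+3) x)) ∧
    P (k+4) (P (k+4) (P (k+4) x)) = tg (k+2) (tg (k+1) (tg (k+2)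
      (pr (k+1) (pr (k+2) (pr (k+3) x))))) ∧
    P (k+4) (P (k+4) (P (k+4) (P (k+4) x))) = Dw k (G k x) := by
  have e : ∀ i y, pr (i+1) y = tg i (pr i y) := fun _ _ => rfl
  have e1 : ∀ x, P (k+4) x = pr (k+3) x := fun _ => rfl
  have e2 : P (k+4) (P (k+4) x) = tg (k+2) (pr (k+2) (pr (k+3) x)) := by rw [e1, e1]; rfl
  have e3 : P (k+4) (P (k+4) (P (k+4) x)) = tg (k+2) (tg (k+1) (tg (k+2)
      (pr (k+1) (pr (k+2) (pr (k+3) x))))) := by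
    rw [e2, e1, e (k+2), e (k+1), pr_tg (m := k+1) (j := k+2) _ (by omega)]
  refine ⟨rfl, e2, e3, ?_⟩
  rw [e3, e1, e (k+2), e (k+1), e k, pr_tg (m := k) (j := k+2) _ (by omega),
    pr_tg (m := k) (j := k+1) _ (by omega), pr_tg (m := k) (j := k+2) _ (by omega)]
  rfl

/-- promotion letters -/
def La (N : ℕ) (x : ℕ → ℕ) (j : ℕ) : ℕ := (P N)^[j+1] x (N-1)

lemma La_Lw (k : ℕ) (x : ℕ → ℕ) : La (k+4) x 0 = Lw k (G k x) 0 ∧ La (k+4) x 1 = Lw k (G k x) 1 ∧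
    La (k+4) x 2 = Lw k (G k x) 2 ∧ La (k+4) x 3 = Lw k (G k x) 3 := by
  obtain ⟨h1, h2, h3, h4⟩ := P_iter k x
  have e : k + 4 - 1 = k + 3 := rfl
  refine ⟨?_, ?_, ?_, ?_⟩
  · unfold La Lw
    simp only [zero_add, Function.iterate_one, e, if_true, h1]
    unfold G
    rw [pr_ne (m := k) _ (by omega), pr_ne (m := k+1) _ (by omega), pr_ne (m := k+2) _ (by omega)]
  · unfold La Lw
    simp only [Function.iterate_succ, Function.iterate_zero, Function.comp_apply, id, e, h2]
    simp only [one_ne_zero, if_false, if_true]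
    unfold G
    rw [← pr_tg (m := k) _ (by omega), pr_ne (m := k) _ (by omega),
      ← pr_tg (m := k+1) _ (by omega), pr_ne (m := k+1) _ (by omega)]
  · unfold La Lw
    simp only [Function.iterate_succ, Function.iterate_zero, Function.comp_apply, id, e, h3]
    simp only [OfNat.ofNat_ne_zero, OfNat.ofNat_ne_one, if_false, if_true]
    unfold G
    rw [← pr_tg (m := k) (j := k+2) _ (by omega), ← pr_tg (m := k) (j := k+1) _ (by omega),
      ← pr_tg (m := k) (j := k+2) _ (by omega), pr_ne _ (by omega)]
  · unfold La Lw
    simp only [Function.iterate_succ, Function.iterate_zero, Function.comp_apply, id, e, h4]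
    simp

/-- first four letters -/
lemma InX.first4 (hx : InX n N x) (hN : 4 ≤ N) : x 0 = 0 ∧ x 1 = 1 ∧
    ((x 2 = 2 ∧ x 3 = 3) ∨ (x 2 = 2 ∧ x 3 = 0) ∨ (x 2 = 0 ∧ x 3 = 2)) := by
  have p0 : x 0 = 0 := by
    by_contra h
    obtain ⟨l, h1, -⟩ := hx.pre (j := 0) (by omega) (by omega)
    omega
  have p1 : x 1 = 1 := by
    have := hx.l1 (k := 0) (by omega)
    rw [zero_add] at this
    obtain ⟨l, h1, h2⟩ := hx.pre (j := 1) (by omega) (by rw [p0] at this; omega)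
    obtain rfl : l = 0 := by omega
    omega
  refine ⟨p0, p1, ?_⟩
  have p2 : x 2 = 0 ∨ x 2 = 2 := by
    by_cases h : x 2 = 0
    · exact Or.inl h
    have : x 1 ≠ x 2 := hx.l1 (k := 1) (by omega)
    obtain ⟨l, h1, h2⟩ := hx.pre (j := 2) (by omega) (by omega)
    obtain rfl | rfl : l = 0 ∨ l = 1 := by omega
    all_goals omega
  have l1 := hx.l1 (k := 2) (by omega)
  have l2 := hx.l2 (k := 1) (by omega)
  simp only [show 1+2 = 3 from rfl, show 1+1 = 2 from rfl, show 2+1=3 from rfl] at l1 l2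
  by_cases h : x 3 = 0
  · omega
  obtain ⟨l, h1, h2⟩ := hx.pre (j := 3) (by omega) (by omega)
  obtain rfl | rfl | rfl : l = 0 ∨ l = 1 ∨ l = 2 := by omega
  all_goals omega

lemma G0_w5 (a b c d e : ℕ) (y : ℕ → ℕ) (h : a = 0 ∧ b = 1 ∧
    ((c = 2 ∧ d = 3) ∨ (c = 2 ∧ d = 0) ∨ (c = 0 ∧ d = 2))) :
    G 0 (w5 0 a b c d e y) = sta 0 (w5 0 a b c d e y) := by
  obtain ⟨rfl, rfl, ⟨rfl, rfl⟩ | ⟨rfl, rfl⟩ | ⟨rfl, rfl⟩⟩ := h <;> unfold G <;> simp only [pr] <;>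
  simp [sta_w5_0, tg_w5_0, tg_w5_1 0, tg_w5_2 0]

lemma G0_eq (hx : InX n N x) (hN : 4 ≤ N) : G 0 x = sta 0 x := by
  have := G0_w5 _ _ _ _ (x (0+4)) x (hx.first4 hN)
  have e := w5_self 0 x
  simp only [zero_add] at e this
  rwa [e] at this

lemma G_sta (hx : InX n N x) {m : ℕ} (hm : m + 4 ≤ N) : G m (sta 0 x) = sta m (G m x) := by
  induction m with
  | zero =>
    rw [G0_eq hx (by omega), G0_eq (hx.sta_mem (by omega)) (by omega)]
  | succ m ih =>
    rw [G_succ, G_succ, ih (by omega), Cc_sta (hx.G_mem (by omega)) (by omega)]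

lemma Pk_loc_aux (k a b c d e : ℕ) (y : ℕ → ℕ) (h1 : a ≠ b) (h2 : b ≠ c) (h3 : c ≠ d)
    (h4 : a = c → a = 0 ∧ b = 1) (h5 : b = d → b = 0 ∧ c = 1)
    (h6 : a = d → (b = a + 1 ∨ c = a + 1) ∧ (a = 0 ∨ b + 1 = a ∨ c + 1 = a)) :
    Pk (tg (k+2) (tg (k+1) (tg k (w5 k a b c d e y)))) k ↔ Pk (w5 k a b c d e y) (k+1) := by
  rw [tg_w5_0]
  unfold Pk
  rw [show k+1+1=k+2 from rfl, show k+1+2 = k+3 from rfl]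
  split_ifs with g1 <;> rw [tg_w5_1] <;> split_ifs with g2 <;> rw [tg_w5_2] <;>
    split_ifs with g3 <;> simp only [w5_0, w5_1, w5_2, w5_3]
  all_goals by_cases e : a = d
  all_goals first
    | (clear h6; omega)
    | (have h6 := h6 e; omega)

lemma Pk_loc (hx : InX n N x) {k : ℕ} (hk : k + 3 < N) :
    Pk (tg (k+2) (tg (k+1) (tg k x))) k ↔ Pk x (k+1) := by
  have := Pk_loc_aux k _ _ _ _ (x (k+4)) x (hx.l1 (by omega)) (hx.l1 (k := k+1) (by omega))
    (hx.l1 (k := k+2) (by omega)) (hx.l2 (by omega)) (hx.l2 (k := k+1) (by omega)) (hx.l3 hk)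
  rwa [w5_self] at this

lemma Pk_congr {x y : ℕ → ℕ} {k : ℕ} (h1 : x k = y k) (h2 : x (k+1) = y (k+1))
    (h3 : x (k+2) = y (k+2)) : Pk x k ↔ Pk y k := by unfold Pk; rw [h1, h2, h3]

lemma Pk_pr (hx : InX n N x) {k m : ℕ} (hm : m < N) (h : k + 3 ≤ m) :
    Pk (pr m x) k ↔ Pk x (k+1) := by
  induction m with
  | zero => omega
  | succ m ih =>
    by_cases hk : k + 3 ≤ m
    · rw [← ih (by omega) hk]
      exact Pk_congr (tg_ne _ (by omega) (by omega)) (tg_ne _ (by omega) (by omega))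
        (tg_ne _ (by omega) (by omega))
    · obtain rfl : m = k + 2 := by omega
      rw [show pr (k+2+1) x = tg (k+2) (tg (k+1) (tg k (pr k x))) from rfl,
        Pk_loc (hx.pr_mem (by omega)) (by omega)]
      exact Pk_congr (pr_ne _ (by omega)) (pr_ne _ (by omega)) (pr_ne _ (by omega))

lemma Pk_Cc (hx : InX n N x) {m : ℕ} (hm : m + 4 < N) : Pk (Cc m x) (m+2) ↔ Pk x (m+1) := by
  have h := Pk_loc (x := tg (m+1) (tg (m+2) (tg (m+3) x)))
    (((hx.tg_mem (k := m+3) (by omega)).tg_mem (k := m+2) (by omega)).tg_mem (k := m+1) (by omega))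
    (k := m+1) (by omega)
  rw [show m+1+2=m+3 from rfl, show m+1+1=m+2 from rfl, tg_tg, tg_tg, tg_tg] at h
  rw [h]
  unfold Cc
  exact Pk_congr (tg_ne _ (by omega) (by omega)) (tg_ne _ (by omega) (by omega))
        (tg_ne _ (by omega) (by omega))

lemma Pk_G (hx : InX n N x) {m : ℕ} (hm : m + 4 ≤ N) : Pk (G m x) (m+1) ↔ Pk x 0 := by
  induction m with
  | zero =>
    rw [G0_eq hx (by omega)]
    have h := hx.first4 (by omega)
    have e := w5_self 0 x
    simp only [zero_add] at e
    generalize x 0 = a, x 1 = b, x 2 = c, x 3 = d, x 4 = f at *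
    have s := sta_w5_0 0 a b c d f x
    have q0 := w5_0 0 a b c d f x
    have q1 := w5_1 0 a b c d f x
    have q2 := w5_2 0 a b c d f x
    have q3 := w5_3 0 a b c d f x
    rw [← e, s]
    unfold Pk
    simp only [zero_add, show 1+1=2 from rfl, show 1+2=3 from rfl] at *
    rw [q0, q1, q2]
    obtain ⟨rfl, rfl, ⟨rfl, rfl⟩ | ⟨rfl, rfl⟩ | ⟨rfl, rfl⟩⟩ := h
    · simp [q1, q2, q3]
    · simp [w5]
    · simp [w5]
  | succ m ih =>
    rw [G_succ, ← ih (by omega)]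
    exact Pk_Cc (hx.G_mem (by omega)) (by omega)

lemma La_iter (N : ℕ) (x : ℕ → ℕ) (i j : ℕ) : La N ((P N)^[i] x) j = La N x (i + j) := by
  unfold La
  rw [← Function.iterate_add_apply, show j + 1 + i = i + j + 1 by omega]

lemma Pk_P_iter (hx : InX n N x) (hN : 4 ≤ N) {j i : ℕ} (h : i + j + 2 < N) :
    Pk ((P N)^[i] x) j ↔ Pk x (i + j) := by
  induction i generalizing j with
  | zero => simp
  | succ i ih =>
    rw [Function.iterate_succ_apply', P, Pk_pr (hx.Pi_mem (by omega) i) (by omega) (by omega),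
      ih (by omega), show i + (j+1) = i + 1 + j by omega]

/-- peaks are preserved -/
lemma Pk_La (hx : InX n N x) (hN : 4 ≤ N) {j : ℕ} (hj : j + 2 < N) : Pk (La N x) j ↔ Pk x j := by
  have h := Pk_P_iter (i := j) (j := 0) hx hN (by omega)
  rw [add_zero] at h
  rw [← h]
  have hy := hx.Pi_mem (by omega : 0 < N) j
  have e : ∀ i, La N x (j+i) = La N ((P N)^[j] x) i := fun i => (La_iter N x j i).symm
  unfold Pk at *
  rw [show La N x j = La N x (j+0) from rfl, e, e, e]
  generalize (P N)^[j] x = y at *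
  obtain ⟨k, rfl⟩ : ∃ k, N = k + 4 := ⟨N - 4, by omega⟩
  obtain ⟨h1, h2, h3, -⟩ := La_Lw k y
  rw [h1, h2, h3, Lw_Pk (hy.G_mem (by omega)) rfl, Pk_G hy (by omega)]
  rfl

lemma P4_sta (hx : InX n N x) {k : ℕ} (hk : k + 4 = N) :
    (P N)^[4] (sta 0 x) = sta k ((P N)^[4] x) := by
  subst hk
  have a := (P_iter k x).2.2.2
  have b := (P_iter k (sta 0 x)).2.2.2
  simp only [Function.iterate_succ, Function.iterate_zero, Function.comp_apply, id]
  rw [a, b, G_sta hx (by omega), (Dw_sta (hx.G_mem (by omega)) rfl).1]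

lemma P_iter_sta (hx : InX n N x) {k i : ℕ} (hk : k + i + 4 ≤ N) :
    (P N)^[i] (sta (k+i) x) = sta k ((P N)^[i] x) := by
  induction i generalizing k with
  | zero => rfl
  | succ i ih =>
    rw [Function.iterate_succ_apply', Function.iterate_succ_apply',
      show k + (i+1) = k + 1 + i by omega, ih (by omega),
      P_sta (hx.Pi_mem (by omega) i) (by omega)]

lemma wst_ne {k j : ℕ} (x : ℕ → ℕ) (h : j < k ∨ k + 3 < j) : wst k x j = x j := by
  unfold wst; split_ifs
  all_goals first
    | exact sta_ne x h
    | skip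
  all_goals
    by_cases e : j = k + 4
    · subst e; rw [w5_4]
    · rw [w5_ne _ _ _ _ _ _ _ (by omega)]

/-- the main equivariance -/
lemma La_sta (hx : InX n N x) {k j : ℕ} (hk : k + 4 ≤ N) (hj : j < N) :
    La N (sta k x) j = wst k (La N x) j := by
  rcases Nat.lt_or_ge j k with h | h
  · rw [wst_ne _ (Or.inl h)]
    unfold La
    obtain ⟨r, rfl⟩ : ∃ r, k = r + (j+1) := ⟨k - (j+1), by omega⟩
    rw [P_iter_sta hx (by omega), sta_ne _ (by omega)]
  obtain ⟨M, rfl⟩ : ∃ M, N = M + 4 := ⟨N - 4, by omega⟩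
  have h0 := P_iter_sta hx (k := 0) (i := k) (by omega)
  rw [zero_add] at h0
  have hy := hx.Pi_mem (by omega : 0 < M+4) k
  rcases Nat.lt_or_ge j (k+4) with h' | h'
  · have e : ∀ z i, La (M+4) z (k+i) = La (M+4) ((P (M+4))^[k] z) i := fun z i =>
      (La_iter (M+4) z k i).symm
    have ex := e x
    have es := e (sta k x)
    rw [h0] at es
    generalize (P (M+4))^[k] x = y at *
    have g := (Dw_sta (hy.G_mem (m := M) (by omega)) rfl).2 k (La (M+4) x (k+4)) (La (M+4) x)
    rw [← G_sta hy (by omega)] at g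
    obtain ⟨a1, a2, a3, a4⟩ := La_Lw M y
    obtain ⟨b1, b2, b3, b4⟩ := La_Lw M (sta 0 y)
    rw [← a1, ← a2, ← a3, ← a4, ← b1, ← b2, ← b3, ← b4, ← ex, ← ex, ← ex, ← ex, ← es, ← es, ← es,
      ← es, add_zero, w5_self] at g
    rw [← g]
    obtain rfl | rfl | rfl | rfl : j = k ∨ j = k + 1 ∨ j = k + 2 ∨ j = k + 3 := by omega
    · rw [w5_0]
    · rw [w5_1]
    · rw [w5_2]
    · rw [w5_3]
  · rw [wst_ne _ (by omega)]
    unfold La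
    obtain ⟨r, rfl⟩ : ∃ r, j = r + 4 + k := ⟨j - k - 4, by omega⟩
    have e : ∀ z, (P (M+4))^[r+4+k+1] z = (P (M+4))^[r+1] ((P (M+4))^[4] ((P (M+4))^[k] z)) := by
      intro z; rw [← Function.iterate_add_apply, ← Function.iterate_add_apply]; congr 1; omega
    rw [e, e, h0, P4_sta hy rfl]
    obtain ⟨s, hs⟩ : ∃ s, M = s + (r+1) := ⟨M - (r+1), by omega⟩
    rw [hs, P_iter_sta (by rw [← hs]; exact hy.Pi_mem (by omega) 4) (by omega),
      sta_ne _ (by omega)]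

end PSB

namespace PSB
variable {n N : ℕ} {x y : ℕ → ℕ}

/-- case distinction for `sta` -/
def StT (a b c d : ℕ) : Prop :=
  ¬ (((a < c ∧ c < b) ∨ (b < c ∧ c < a)) ∧ d < c) ∧
  ¬ ((a < b ∨ a < c) ∧ (d < b ∨ d < c) ∧ ((b < a ∨ c < a) ∨ (b < d ∨ c < d))) ∧
  ¬ (((c < b ∧ b < d) ∨ (d < b ∧ b < c)) ∧ a < b)

lemma sta_of_StT {k : ℕ} (h : StT (x k) (x (k+1)) (x (k+2)) (x (k+3))) : sta k x = x := by
  unfold sta; rw [if_neg h.1, if_neg h.2.1, if_neg h.2.2]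

lemma StT_of_sta {k : ℕ} (h : sta k x = x) : StT (x k) (x (k+1)) (x (k+2)) (x (k+3)) := by
  have hs : ∀ i, sw i x = x → x i = x (i+1) := by
    intro i h
    have := congrFun h i
    rw [sw_left] at this; exact this.symm
  unfold sta at h
  split_ifs at h with g1 g2 g3
  · have := hs _ h; omega
  · have := hs _ h; rw [show k+1+1=k+2 from rfl] at this; omega
  · have := hs _ h; rw [show k+2+1=k+3 from rfl] at this; omega
  · exact ⟨g1, g2, g3⟩

lemma sta_sta_aux (k a b c d e : ℕ) (y : ℕ → ℕ) :
    sta k (sta k (w5 k a b c d e y)) = w5 k a b c d e y := by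
  by_cases g1 : ((a < c ∧ c < b) ∨ (b < c ∧ c < a)) ∧ d < c
  · rw [sb1 g1, sb1 (by omega)]
  by_cases g2 : (a < b ∨ a < c) ∧ (d < b ∨ d < c) ∧ ((b < a ∨ c < a) ∨ (b < d ∨ c < d))
  · rw [sb2 g1 g2, sb2 (by omega) (by omega)]
  by_cases g3 : ((c < b ∧ b < d) ∨ (d < b ∧ b < c)) ∧ a < b
  · rw [sb3 g1 g2 g3, sb3 (by omega) (by omega) (by omega)]
  · rw [sb4 g1 g2 g3, sb4 g1 g2 g3]

lemma sta_sta (k : ℕ) (x : ℕ → ℕ) : sta k (sta k x) = x := by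
  have := sta_sta_aux k (x k) (x (k+1)) (x (k+2)) (x (k+3)) (x (k+4)) x
  rwa [w5_self] at this

/-- reachable by stars on the first `m` letters -/
def StR (m : ℕ) : (ℕ → ℕ) → (ℕ → ℕ) → Prop :=
  Relation.ReflTransGen (fun x y => ∃ k, k + 4 ≤ m ∧ y = sta k x)

/-- reachable by toggles on the first `m` letters -/
def TgR (m : ℕ) : (ℕ → ℕ) → (ℕ → ℕ) → Prop :=
  Relation.ReflTransGen (fun x y => ∃ k, k + 2 ≤ m ∧ y = tg k x)

lemma StR.mono {m m' : ℕ} (h : m ≤ m') (hr : StR m x y) : StR m' x y := by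
  induction hr with
  | refl => exact Relation.ReflTransGen.refl
  | tail _ hs ih =>
    obtain ⟨k, hk, e⟩ := hs
    exact Relation.ReflTransGen.tail ih ⟨k, by omega, e⟩

lemma TgR.mono {m m' : ℕ} (h : m ≤ m') (hr : TgR m x y) : TgR m' x y := by
  induction hr with
  | refl => exact Relation.ReflTransGen.refl
  | tail _ hs ih =>
    obtain ⟨k, hk, e⟩ := hs
    exact Relation.ReflTransGen.tail ih ⟨k, by omega, e⟩

lemma StR.symm {m : ℕ} (hr : StR m x y) : StR m y x := by
  induction hr with
  | refl => exact Relation.ReflTransGen.refl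
  | tail _ hs ih =>
    obtain ⟨k, hk, rfl⟩ := hs
    exact Relation.ReflTransGen.head ⟨k, hk, (sta_sta k _).symm⟩ ih

lemma TgR.symm {m : ℕ} (hr : TgR m x y) : TgR m y x := by
  induction hr with
  | refl => exact Relation.ReflTransGen.refl
  | tail _ hs ih =>
    obtain ⟨k, hk, rfl⟩ := hs
    exact Relation.ReflTransGen.head ⟨k, hk, (tg_tg k _).symm⟩ ih

lemma StR.mem {m : ℕ} (hr : StR m x y) (hx : InX n N x) (hm : m ≤ N) : InX n N y := by
  induction hr with
  | refl => exact hx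
  | tail _ h ih => obtain ⟨k, hk, rfl⟩ := h; exact ih.sta_mem (by omega)

lemma TgR.mem {m : ℕ} (hr : TgR m x y) (hx : InX n N x) (hm : m ≤ N) : InX n N y := by
  induction hr with
  | refl => exact hx
  | tail _ h ih => obtain ⟨k, hk, rfl⟩ := h; exact ih.tg_mem (by omega)

lemma StR.ge {m : ℕ} (hr : StR m x y) {i : ℕ} (hi : m ≤ i) : y i = x i := by
  induction hr with
  | refl => rfl
  | tail _ h ih => obtain ⟨k, hk, rfl⟩ := h; rw [sta_ne _ (by omega), ih]

lemma TgR.ge {m : ℕ} (hr : TgR m x y) {i : ℕ} (hi : m ≤ i) : y i = x i := by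
  induction hr with
  | refl => rfl
  | tail _ h ih => obtain ⟨k, hk, rfl⟩ := h; rw [tg_ne _ (by omega) (by omega), ih]

/-- move a letter to the right -/
lemma move {j p : ℕ} (hjp : j ≤ p) (x : ℕ → ℕ)
    (h : ∀ i, j < i → i ≤ p → ¬ near (x j) (x i)) :
    ∃ y, TgR (p+1) x y ∧ y p = x j := by
  obtain ⟨d, rfl⟩ : ∃ d, p = j + d := ⟨p - j, by omega⟩
  clear hjp
  induction d generalizing j x with
  | zero => exact ⟨x, Relation.ReflTransGen.refl, rfl⟩
  | succ d ih =>
    have e : tg j x = sw j x := by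
      unfold tg; rw [if_neg (h (j+1) (by omega) (by omega))]
    obtain ⟨y, h1, h2⟩ := ih (j := j+1) (sw j x) (by
      intro i hi1 hi2
      rw [sw_right, sw_ne _ (by omega) (by omega)]
      exact h i (by omega) (by omega))
    rw [sw_right] at h2
    rw [show j + 1 + d = j + (d+1) by omega] at h1 h2
    exact ⟨y, Relation.ReflTransGen.head ⟨j, by omega, e.symm⟩ h1, h2⟩

/-- move a letter to the left -/
lemma move_left {m q : ℕ} (hq : m ≤ q) (x : ℕ → ℕ)
    (h : ∀ i, m ≤ i → i < q → ¬ near (x i) (x q)) :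
    ∃ y, TgR (q+1) x y ∧ y m = x q ∧ ∀ i < m, y i = x i := by
  obtain ⟨d, rfl⟩ : ∃ d, q = m + d := ⟨q - m, by omega⟩
  clear hq
  induction d generalizing x with
  | zero => exact ⟨x, Relation.ReflTransGen.refl, rfl, fun _ _ => rfl⟩
  | succ d ih =>
    have e : tg (m+d) x = sw (m+d) x := by
      unfold tg; rw [if_neg (show ¬ near (x (m+d)) (x (m+d+1)) from h (m+d) (by omega) (by omega))]
    obtain ⟨y, h1, h2, h3⟩ := ih (sw (m+d) x) (by
      intro i hi1 hi2
      rw [sw_left, sw_ne _ (by omega) (by omega)]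
      exact h i (by omega) (by omega))
    rw [sw_left] at h2
    refine ⟨y, Relation.ReflTransGen.head ⟨m+d, by omega, e.symm⟩ (TgR.mono (by omega) h1), h2, ?_⟩
    intro i hi
    rw [h3 i hi, sw_ne _ (by omega) (by omega)]

/-- the last index below `m` with a property -/
lemma last_idx {p : ℕ → Prop} {m : ℕ} (h : ∃ j < m, p j) :
    ∃ j < m, p j ∧ ∀ i, j < i → i < m → ¬ p i := by
  induction m with
  | zero => obtain ⟨j, hj, -⟩ := h; omega
  | succ m ih =>
    by_cases hm : p m
    · exact ⟨m, by omega, hm, fun i h1 h2 => by omega⟩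
    · obtain ⟨j, hj, hp⟩ := h
      have : j ≠ m := fun e => hm (e ▸ hp)
      obtain ⟨j', h1, h2, h3⟩ := ih ⟨j, by omega, hp⟩
      refine ⟨j', by omega, h2, fun i hi hi' => ?_⟩
      by_cases e : i = m
      · rw [e]; exact hm
      · exact h3 i hi (by omega)

/-- arrange a smaller letter just before position `p` -/
lemma prepA (hx : InX n N x) {p : ℕ} (hp : p < N) (h0 : 1 ≤ x p) :
    1 ≤ p ∧ ∃ y, TgR p x y ∧ y (p-1) < x p := by
  obtain ⟨l, hl, he⟩ := hx.pre hp h0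
  obtain ⟨j, hj, hz, hlast⟩ := last_idx (p := fun j => x j < x p) ⟨l, hl, by omega⟩
  refine ⟨by omega, ?_⟩
  obtain ⟨y, h1, h2⟩ := move (j := j) (p := p-1) (by omega) x (by
    intro i hi1 hi2 hn
    have hi := hlast i hi1 (by omega)
    unfold near at hn
    have : x i = x p := by omega
    obtain ⟨l', a1, a2, a3⟩ := hx.down (i := i) (j := p) (by omega) hp this (by omega)
    exact hlast l' (by omega) a2 (by omega))
  rw [show p - 1 + 1 = p by omega] at h1
  exact ⟨y, h1, by omega⟩

/-- arrange an ascending pair ending strictly between `l` and `u` -/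
lemma prep (hx : InX n N x) {m l u : ℕ} (hm : m ≤ N) (hlu : ∃ j < m, l < x j ∧ x j < u)
    (hl : ∀ i < m, x i = l → ∃ j, i < j ∧ j < m ∧ x j = l + 1)
    (hu : ∀ i < m, x i = u → ∃ j, i < j ∧ j < m ∧ x j + 1 = u) :
    2 ≤ m ∧ ∃ y, TgR m x y ∧ y (m-2) < y (m-1) ∧ l < y (m-1) ∧ y (m-1) < u := by
  obtain ⟨j, hj, hz, hlast⟩ := last_idx hlu
  obtain ⟨y, h1, h2⟩ := move (j := j) (p := m-1) (by omega) x (by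
    intro i hi1 hi2 hn
    have hi := hlast i hi1 (by omega)
    unfold near at hn
    have : x i = l ∨ x i = u := by omega
    rcases this with e | e
    · obtain ⟨l', a1, a2, a3⟩ := hl i (by omega) e
      exact hlast l' (by omega) a2 (by omega)
    · obtain ⟨l', a1, a2, a3⟩ := hu i (by omega) e
      exact hlast l' (by omega) a2 (by omega))
  rw [show m - 1 + 1 = m by omega] at h1
  obtain ⟨hp, y', h3, h4⟩ := prepA (h1.mem hx hm) (p := m-1) (by omega) (by omega)
  have h5 := h3.ge (i := m-1) le_rfl
  refine ⟨by omega, y', Relation.ReflTransGen.trans h1 (h3.mono (by omega)), ?_, by omega, by omega⟩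
  rw [h5]; rw [show m-1-1 = m-2 by omega] at h4; exact h4

lemma prep2_aux (hx : InX n N x) {m i1 i2 : ℕ} (h1 : m ≤ i1) (h2 : m ≤ i2) (h3 : i1 ≤ m + 1)
    (h4 : i2 ≤ m + 1) (hm : m + 1 < N) (h : x i1 + 2 ≤ x i2) :
    2 ≤ m ∧ ∃ y, TgR m x y ∧ y (m-2) < y (m-1) ∧ x i1 < y (m-1) ∧ y (m-1) < x i2 := by
  have hne : i1 ≠ i2 := by rintro rfl; omega
  have aux : ∀ j, j < m + 2 → x i1 < x j → x j < x i2 → j < m := by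
    intro j hj a b
    by_contra hc
    have : j = i1 ∨ j = i2 := by omega
    rcases this with rfl | rfl <;> omega
  refine prep hx (by omega) ?_ ?_ ?_
  · obtain ⟨j, a, b⟩ := hx.pre_le (j := i2) (c := x i1 + 1) (by omega) (by omega)
    exact ⟨j, aux j (by omega) (by omega) (by omega), by omega, by omega⟩
  · intro i hi e
    obtain ⟨j, a, b, c⟩ := hx.up (i := i) (j := i1) (by omega) (by omega) e
    exact ⟨j, a, aux j (by omega) (by omega) (by omega), by omega⟩
  · intro i hi e
    obtain ⟨j, a, b, c⟩ := hx.down (i := i) (j := i2) (by omega) (by omega) e (by omega)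
    exact ⟨j, a, aux j (by omega) (by omega) (by omega), by omega⟩

lemma sta_eq_sw2 {k : ℕ} (h1 : x k < x (k+1))
    (h2 : (x (k+2) < x (k+1) ∧ x (k+1) < x (k+3)) ∨ (x (k+3) < x (k+1) ∧ x (k+1) < x (k+2))) :
    sta k x = sw (k+2) x := by
  unfold sta
  rw [if_neg (by omega), if_neg (by omega), if_pos ⟨h2, h1⟩]

lemma prep2 (hx : InX n N x) {m : ℕ} (hm : m + 1 < N) (h : ¬ near (x m) (x (m+1))) :
    ∃ k, k + 2 = m ∧ ∃ y, TgR m x y ∧ sta k y = tg m y := by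
  have : (x m + 2 ≤ x (m+1)) ∨ (x (m+1) + 2 ≤ x m) := by unfold near at h; omega
  have key : 2 ≤ m ∧ ∃ y, TgR m x y ∧ y (m-2) < y (m-1) ∧
      ((x m < y (m-1) ∧ y (m-1) < x (m+1)) ∨ (x (m+1) < y (m-1) ∧ y (m-1) < x m)) := by
    rcases this with g | g
    · obtain ⟨a, y, b, c, d, e⟩ := prep2_aux hx (m := m) (i1 := m) (i2 := m+1) (by omega) (by omega)
        (by omega) (by omega) hm g
      exact ⟨a, y, b, c, Or.inl ⟨d, e⟩⟩
    · obtain ⟨a, y, b, c, d, e⟩ := prep2_aux hx (m := m) (i1 := m+1) (i2 := m) (by omega) (by omega)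
        (by omega) (by omega) hm g
      exact ⟨a, y, b, c, Or.inr ⟨d, e⟩⟩
  obtain ⟨hm2, y, b, c, d⟩ := key
  obtain ⟨k, rfl⟩ : ∃ k, m = k + 2 := ⟨m - 2, by omega⟩
  refine ⟨k, rfl, y, b, ?_⟩
  have e1 := b.ge (i := k+2) le_rfl
  have e2 := b.ge (i := k+2+1) (by omega)
  rw [← e1, ← e2] at d h
  unfold tg
  rw [if_neg h]
  exact sta_eq_sw2 c d

lemma StR.tg {m k : ℕ} (hk : m ≤ k) (h : StR m x y) : StR m (tg k x) (tg k y) := by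
  induction h with
  | refl => exact Relation.ReflTransGen.refl
  | tail _ h ih =>
    obtain ⟨j, hj, rfl⟩ := h
    exact Relation.ReflTransGen.tail ih ⟨j, hj, tg_sta_comm (by omega) _⟩

/-- toggles are products of stars -/
lemma conn (k : ℕ) : ∀ {x : ℕ → ℕ}, InX n N x → k + 1 < N → StR (k+2) x (tg k x) := by
  induction k using Nat.strong_induction_on with
  | _ k ih =>
    intro x hx hk
    by_cases h : near (x k) (x (k+1))
    · have : tg k x = x := by unfold tg; rw [if_pos h]
      rw [this]; exact Relation.ReflTransGen.refl
    obtain ⟨j, rfl, y, hy, e⟩ := prep2 hx hk h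
    have hs : StR (j+2) x y := by
      clear e
      induction hy with
      | refl => exact Relation.ReflTransGen.refl
      | @tail b c hb hc ih' =>
        obtain ⟨i, hi, rfl⟩ := hc
        exact Relation.ReflTransGen.trans ih'
          ((ih i (by omega) (TgR.mem hb hx (by omega)) (by omega)).mono (by omega))
    have h2 : StR (j+2+2) y (PSB.tg (j+2) y) :=
      Relation.ReflTransGen.single ⟨j, by omega, e.symm⟩
    exact Relation.ReflTransGen.trans (hs.mono (by omega))
      (Relation.ReflTransGen.trans h2 (((hs.tg le_rfl).symm).mono (by omega)))

lemma TgR.toSt {m : ℕ} (h : TgR m x y) (hx : InX n N x) (hm : m ≤ N) : StR m x y := by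
  induction h with
  | refl => exact Relation.ReflTransGen.refl
  | @tail b c hb hc ih' =>
    obtain ⟨i, hi, rfl⟩ := hc
    exact Relation.ReflTransGen.trans ih'
      ((conn i (TgR.mem hb hx (by omega)) (by omega)).mono (by omega))

lemma full_step (hx : InX n N x) (hy : InX n N y) {m : ℕ} (hm : m < N) (h : ∀ i < m, x i = y i) :
    ∃ x', TgR N x x' ∧ ∀ i < m + 1, x' i = y i := by
  have hc : ∀ c, cnt x c m = cnt y c m := cnt_congr h
  have ex : ∃ q, m ≤ q ∧ q < N ∧ x q = y m := by
    apply exists_of_cnt_lt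
    have h1 := cnt_lt_of (x := y) (i := m) (j := N) (l := m) le_rfl hm rfl
    rw [hc, hx.tot, ← hy.tot]; exact h1
  classical
  have hq := Nat.find_spec ex
  have hmin : ∀ i, m ≤ i → i < Nat.find ex → x i ≠ y m := by
    intro i h1 h2 h3
    exact Nat.find_min ex h2 ⟨h1, by omega, h3⟩
  generalize Nat.find ex = q at *
  obtain ⟨hq1, hq2, hq3⟩ := hq
  have flat : ∀ i, i ≤ q → m ≤ i → cnt x (y m) i = cnt x (y m) m := by
    intro i hi hi'
    by_contra hne
    have := cnt_mono x (y m) hi'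
    obtain ⟨l, a, b, c⟩ := exists_of_cnt_lt (x := x) (c := y m) (i := m) (j := i) (by omega)
    exact hmin l a (by omega) c
  obtain ⟨x', a, b, c⟩ := move_left hq1 x (by
    intro i h1 h2 hn
    have hne := hmin i h1 h2
    rw [hq3] at hn
    unfold near at hn
    have hf := flat (i+1) (by omega) (by omega)
    have s0 := cnt_succ y (y m) m
    rw [if_pos rfl] at s0
    have : x i = y m + 1 ∨ x i + 1 = y m := by omega
    rcases this with e | e
    · have l1 := cnt_lt_of (x := x) (c := y m + 1) h1 (Nat.lt_succ_self i) e
      have l2 := hx.lat1 (i+1) (by omega) (y m)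
      have l3 := hy.lat2 (m+1) (by omega) (y m)
      have s1 := cnt_succ y (y m + 1) m
      rw [if_neg (by omega)] at s1
      have := hc (y m); have := hc (y m + 1)
      simp only [Nat.succ_eq_add_one] at l1
      omega
    · have l1 := cnt_lt_of (x := x) (c := x i) h1 (Nat.lt_succ_self i) rfl
      have l2 := hx.lat2 (i+1) (by omega) (x i)
      have l3 := hy.lat1 (m+1) (by omega) (x i)
      have s1 := cnt_succ y (x i) m
      rw [if_neg (by omega)] at s1
      rw [e] at l2 l3
      have := hc (y m); have := hc (x i)
      simp only [Nat.succ_eq_add_one] at l1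
      omega)
  refine ⟨x', a.mono (by omega), fun i hi => ?_⟩
  by_cases e : i = m
  · rw [e, b, hq3]
  · rw [c i (by omega), h i (by omega)]

lemma full_conn (hx : InX n N x) (hy : InX n N y) : TgR N x y := by
  have key : ∀ m ≤ N, ∃ x', TgR N x x' ∧ ∀ i < m, x' i = y i := by
    intro m hm
    induction m with
    | zero => exact ⟨x, Relation.ReflTransGen.refl, fun i hi => by omega⟩
    | succ m ih =>
      obtain ⟨x', h1, h2⟩ := ih (by omega)
      obtain ⟨x'', h3, h4⟩ := full_step (h1.mem hx le_rfl) hy (by omega) h2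
      exact ⟨x'', Relation.ReflTransGen.trans h1 h3, h4⟩
  obtain ⟨x', h1, h2⟩ := key N le_rfl
  have : x' = y := by
    funext i
    by_cases hi : i < N
    · exact h2 i hi
    · rw [(h1.mem hx le_rfl).zer i (by omega), hy.zer i (by omega)]
  rw [← this]; exact h1

lemma star_conn (hx : InX n N x) (hy : InX n N y) : StR N x y :=
  (full_conn hx hy).toSt hx le_rfl

/-- the row superstandard word -/
def T0 : ℕ → ℕ → ℕ
  | 0, _ => 0
  | n+1, i => if i < 2*n+1 then i else T0 n (i - (2*n+1))

lemma cnt_shift (x : ℕ → ℕ) (c r m : ℕ) :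
    cnt x c (r + m) = cnt x c r + cnt (fun i => x (r + i)) c m := by
  induction m with
  | zero => simp [cnt_zero]
  | succ m ih => rw [← add_assoc, cnt_succ, cnt_succ, ih, add_assoc]

lemma cnt_id {x : ℕ → ℕ} {m : ℕ} (h : ∀ i < m, x i = i) (c : ℕ) :
    cnt x c m = if c < m then 1 else 0 := by
  induction m with
  | zero => simp [cnt_zero]
  | succ m ih =>
    rw [cnt_succ, ih (fun i hi => h i (by omega)), h m (by omega)]
    split_ifs <;> omega

lemma InX.cnt_big (hx : InX n N x) {m c : ℕ} (hm : m ≤ N) (hc : 2 * n ≤ c + 1) : cnt x c m = 0 := by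
  have h1 := cnt_mono x c hm
  rw [hx.tot] at h1; omega

lemma InX.cons {x x' : ℕ → ℕ} (h : ∀ i < 2*n+1, x' i = i)
    (hs : ∀ i, x' (2*n+1+i) = x i) : InX n N x ↔ InX (n+1) (2*n+1+N) x' := by
  have e : (fun i => x' (2*n+1+i)) = x := funext hs
  have c1 : ∀ c m, cnt x' c (2*n+1+m) = (if c < 2*n+1 then 1 else 0) + cnt x c m := by
    intro c m; rw [cnt_shift, e, cnt_id h]
  have c0 : ∀ c m, m ≤ 2*n+1 → cnt x' c m = if c < m then 1 else 0 := by
    intro c m hm; exact cnt_id (fun i hi => h i (by omega)) c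
  constructor
  · intro hx
    refine ⟨fun m hm c => ?_, fun m hm c => ?_, fun c => ?_, fun i hi => ?_⟩
    · rcases Nat.lt_or_ge m (2*n+1) with g | g
      · rw [c0 _ _ (by omega), c0 _ _ (by omega)]; split_ifs <;> omega
      · obtain ⟨r, rfl⟩ := Nat.exists_eq_add_of_le g
        rw [c1, c1]
        have := hx.lat1 r (by omega) c
        split_ifs <;> omega
    · rcases Nat.lt_or_ge m (2*n+1) with g | g
      · rw [c0 _ _ (by omega), c0 _ _ (by omega)]; split_ifs <;> omega
      · obtain ⟨r, rfl⟩ := Nat.exists_eq_add_of_le g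
        rw [c1, c1]
        have := hx.lat2 r (by omega) c
        by_cases hc : 2*n ≤ c + 1
        · have := hx.cnt_big (m := r) (by omega) hc
          split_ifs <;> omega
        · split_ifs <;> omega
    · rw [c1, hx.tot]; split_ifs <;> omega
    · obtain ⟨r, rfl⟩ := Nat.exists_eq_add_of_le (show 2*n+1 ≤ i by omega)
      rw [hs]; exact hx.zer r (by omega)
  · intro hx
    have t : ∀ c, cnt x c N = n - (c+1)/2 := by
      intro c
      have := hx.tot c
      rw [c1] at this
      split_ifs at this <;> omega
    have big : ∀ m ≤ N, ∀ c, 2*n ≤ c + 1 → cnt x c m = 0 := by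
      intro m hm c hc
      have h1 := cnt_mono x c hm
      rw [t] at h1; omega
    refine ⟨fun m hm c => ?_, fun m hm c => ?_, t, fun i hi => ?_⟩
    · have := hx.lat1 (2*n+1+m) (by omega) c
      rw [c1, c1] at this
      by_cases hc : 2*n ≤ c + 1 + 1
      · rw [big m hm (c+1) hc]; omega
      · split_ifs at this <;> omega
    · have := hx.lat2 (2*n+1+m) (by omega) c
      rw [c1, c1] at this
      by_cases hc : 2*n ≤ c + 1
      · rw [big m hm c hc]; omega
      · split_ifs at this <;> omega
    · rw [← hs]; exact hx.zer _ (by omega)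

lemma T0_mem (n : ℕ) : InX n (n^2) (T0 n) := by
  induction n with
  | zero =>
    refine ⟨fun m hm c => ?_, fun m hm c => ?_, fun c => ?_, fun i _ => rfl⟩
    · obtain rfl : m = 0 := by simpa using hm
      simp [cnt_zero]
    · obtain rfl : m = 0 := by simpa using hm
      simp [cnt_zero]
    · simp [cnt_zero]
  | succ n ih =>
    rw [show (n+1)^2 = 2*n+1+n^2 by ring]
    refine (InX.cons (x := T0 n) ?_ ?_).1 ih
    · intro i hi; simp [T0, hi]
    · intro i; simp [T0]; omega

/-- stars commute with the full power of promotion -/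
lemma PN_sta (hx : InX n N x) {k : ℕ} (hk : k + 4 ≤ N) :
    (P N)^[N] (sta k x) = sta k ((P N)^[N] x) := by
  obtain ⟨r, rfl⟩ : ∃ r, N = k + r + 4 := ⟨N - (k+4), by omega⟩
  have e : ∀ z, (P (k+r+4))^[k+r+4] z =
      (P (k+r+4))^[r] ((P (k+r+4))^[4] ((P (k+r+4))^[k] z)) := by
    intro z; rw [← Function.iterate_add_apply, ← Function.iterate_add_apply]; congr 1; omega
  have h0 := P_iter_sta hx (k := 0) (i := k) (by omega)
  rw [zero_add] at h0
  have hy := hx.Pi_mem (by omega) k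
  rw [e, e, h0, P4_sta hy rfl, P_iter_sta (hy.Pi_mem (by omega) 4) (by omega)]

lemma T0_unique (n : ℕ) : ∀ {y : ℕ → ℕ}, InX n (n^2) y → (2 ≤ n → y 2 = 2) →
    (∀ k, k + 4 ≤ n^2 → StT (T0 n k) (T0 n (k+1)) (T0 n (k+2)) (T0 n (k+3)) →
      StT (y k) (y (k+1)) (y (k+2)) (y (k+3))) → y = T0 n := by
  induction n with
  | zero => intro y hy _ _; funext i; rw [hy.zer i (by simp)]; rfl
  | succ n ih =>
    intro y hy h2 hk
    have hN : (n+1)^2 = 2*n+1+n^2 := by ring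
    rw [hN] at hy hk
    have T1 : ∀ i < 2*n+1, T0 (n+1) i = i := by intro i hi; simp [T0, hi]
    have T2 : ∀ i, T0 (n+1) (2*n+1+i) = T0 n i := by intro i; simp [T0]; omega
    have y0 : y 0 = 0 := by
      by_contra h
      obtain ⟨l, h1, -⟩ := hy.pre (j := 0) (by omega) (by omega)
      omega
    have key : ∀ i < 2*n+1, y i = i := by
      intro i
      induction i using Nat.strong_induction_on with
      | _ i hi =>
        intro hin
        by_cases e0 : i = 0
        · rw [e0]; exact y0
        have hlt : i < 2*n+1+n^2 := by omega
        have hne : y i ≠ 0 := by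
          by_cases e1 : i = 1
          · subst e1
            have := hy.l1 (k := 0) (by omega)
            rw [zero_add] at this; omega
          by_cases e2 : i = 2
          · subst e2; rw [h2 (by omega)]; omega
          obtain ⟨k, rfl⟩ : ∃ k, i = k + 3 := ⟨i - 3, by omega⟩
          have := hk k (by omega) (by
            rw [T1 _ (by omega), T1 _ (by omega), T1 _ (by omega), T1 _ (by omega)]
            unfold StT; omega)
          rw [hi k (by omega) (by omega), hi (k+1) (by omega) (by omega),
            hi (k+2) (by omega) (by omega)] at this
          intro hz
          rw [hz] at this
          have := this.2.2
          omega
        obtain ⟨l, a, b⟩ := hy.pre hlt (by omega)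
        rw [hi l a (by omega)] at b
        by_contra hcon
        have hv : y (y i) = y i := hi (y i) (by omega) (by omega)
        obtain ⟨l', a1, a2, a3⟩ := hy.down (i := y i) (j := i) (by omega) hlt hv (by omega)
        rw [hv, hi l' a2 (by omega)] at a3
        omega
    have hy' : InX n (n^2) (fun i => y (2*n+1+i)) :=
      (InX.cons (x' := y) key (fun _ => rfl)).2 hy
    have := ih hy' (by
      intro hn
      have hn4 : 4 ≤ n^2 := by nlinarith
      obtain ⟨a, b, c⟩ := hy'.first4 hn4
      obtain ⟨a', b', c'⟩ := (T0_mem n).first4 hn4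
      have t2 : T0 n 2 = 2 := by
        obtain ⟨r, rfl⟩ : ∃ r, n = r + 1 := ⟨n - 1, by omega⟩
        simp [T0]; omega
      have := hk (2*n) (by omega) (by
        rw [T1 _ (by omega), show 2*n+1 = 2*n+1+0 from rfl, T2, show 2*n+2 = 2*n+1+1 from rfl, T2,
          show 2*n+3 = 2*n+1+2 from rfl, T2, a', b', t2]
        unfold StT; omega)
      rw [key _ (by omega)] at this
      rcases c with c | c | c
      · exact c.1
      · exact c.1
      · exfalso
        simp only [add_zero] at a
        have c1 := c.1
        rw [show 2*n+1+1 = 2*n+2 from rfl] at b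
        rw [show 2*n+1+2 = 2*n+3 from rfl] at c1
        rw [a, b, c1] at this
        have := this.1
        omega) (by
      intro k hkn hs
      have := hk (2*n+1+k) (by omega) (by
        rw [show 2*n+1+k+1 = 2*n+1+(k+1) by omega, show 2*n+1+k+2 = 2*n+1+(k+2) by omega,
          show 2*n+1+k+3 = 2*n+1+(k+3) by omega, T2, T2, T2, T2]
        exact hs)
      exact this)
    funext i
    rcases Nat.lt_or_ge i (2*n+1) with g | g
    · rw [key i g, T1 i g]
    · obtain ⟨r, rfl⟩ := Nat.exists_eq_add_of_le g
      rw [T2, ← this]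

lemma PN_T0 (n : ℕ) (hn : 3 ≤ n) : (P (n^2))^[n^2] (T0 n) = T0 n := by
  have hn9 : 9 ≤ n^2 := by nlinarith
  have hm := (T0_mem n).Pi_mem (by omega : 0 < n^2) (n^2)
  have hk : ∀ k, k + 4 ≤ n^2 → StT (T0 n k) (T0 n (k+1)) (T0 n (k+2)) (T0 n (k+3)) →
      StT ((P (n^2))^[n^2] (T0 n) k) ((P (n^2))^[n^2] (T0 n) (k+1))
        ((P (n^2))^[n^2] (T0 n) (k+2)) ((P (n^2))^[n^2] (T0 n) (k+3)) := by
    intro k hk h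
    apply StT_of_sta
    rw [← PN_sta (T0_mem n) hk, sta_of_StT h]
  refine T0_unique n hm (fun _ => ?_) hk
  obtain ⟨a, b, c⟩ := hm.first4 (by omega)
  have := hk 0 (by omega) (by
    obtain ⟨r, rfl⟩ : ∃ r, n = r + 1 := ⟨n - 1, by omega⟩
    have T1 : ∀ i < 2*r+1, T0 (r+1) i = i := by intro i hi; simp [T0, hi]
    rw [T1 _ (by omega), T1 _ (by omega), T1 _ (by omega), T1 _ (by omega)]
    unfold StT; omega)
  simp only [zero_add] at this
  rcases c with c | c | c
  · exact c.1
  · exact c.1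
  · rw [a, b, c.1, c.2] at this
    have := this.2.2
    omega

lemma PN_2 {x : ℕ → ℕ} (hx : InX 2 4 x) : (P 4)^[4] x = x := by
  have a := (P_iter 0 x).2.2.2
  simp only [Function.iterate_succ, Function.iterate_zero, Function.comp_apply, id]
  rw [zero_add] at a
  rw [a, G0_eq hx (by omega)]
  have h := hx.first4 (by omega)
  have hb := hx.bound (j := 3) (by omega)
  have h' : x 0 = 0 ∧ x 1 = 1 ∧ ((x 2 = 0 ∧ x 3 = 2) ∨ (x 2 = 2 ∧ x 3 = 0)) := by omega
  have e := w5_self 0 x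
  simp only [zero_add] at e
  have h3 : sta 0 x = w5 0 (x 0) (x 1) (x 3) (x 2) (x 4) x := by
    conv_lhs => rw [← e]
    exact sb3 (by omega) (by omega) (by omega)
  rw [h3, (DL4 0 _ _ _ _ _ x (by omega)).1, e]

/-- promotion has order dividing the number of cells -/
lemma PN (hn : 0 < n) (hx : InX n (n^2) x) : (P (n^2))^[n^2] x = x := by
  obtain rfl | rfl | h3 : n = 1 ∨ n = 2 ∨ 3 ≤ n := by omega
  · rfl
  · exact PN_2 hx
  · have hr := star_conn (T0_mem n) hx
    have : ∀ z, StR (n^2) (T0 n) z → (P (n^2))^[n^2] z = z := by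
      intro z hz
      induction hz with
      | refl => exact PN_T0 n h3
      | @tail b c hb hc ih =>
        obtain ⟨k, hk, rfl⟩ := hc
        rw [PN_sta (StR.mem hb (T0_mem n) le_rfl) hk, ih]
    exact this x hr

end PSB

namespace PSB
variable {n N : ℕ} {x y : ℕ → ℕ}

/-- relation between the last four letters of the promotion word and of the content word -/
def F4 (a b c d p q r s : ℕ) : Prop :=
  c = r ∧ d = s ∧ a % 2 = 0 ∧ b % 2 = 0 ∧ c % 2 = 0 ∧ d % 2 = 0 ∧ a ≠ b ∧ b ≠ c ∧ c ≠ d ∧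
  ((a = p ∧ b = q ∧ a ≠ c ∧ a ≠ d ∧ b ≠ d) ∨
   (a = c ∧ b = d ∧ p = 0 ∧ q = 1 ∧ ((c = 0 ∧ d = 2) ∨ (c = 2 ∧ d = 0))) ∨
   (a = d ∧ b = q ∧ p % 2 = 1 ∧ a ≠ c) ∨
   (a = p ∧ b = d ∧ a ≠ c ∧ ((q = c + 1 ∧ d = c + 2) ∨ (q = d + 1 ∧ c = d + 2))) ∨
   (a = c ∧ b = q ∧ p % 2 = 1 ∧ b ≠ d))

lemma F4_aux (k a b c d e : ℕ) (y : ℕ → ℕ) (H : U4 a b c d) :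
    F4 (Lw k (w5 k a b c d e y) 0) (Lw k (w5 k a b c d e y) 1) (Lw k (w5 k a b c d e y) 2)
      (Lw k (w5 k a b c d e y) 3) (Dw k (w5 k a b c d e y) k) (Dw k (w5 k a b c d e y) (k+1))
      (Dw k (w5 k a b c d e y) (k+2)) (Dw k (w5 k a b c d e y) (k+3)) := by
  rcases H.cases with h | h | ⟨m, z, hm, hz, hs, h⟩
  · obtain ⟨u0, u1, u2, u3, u4⟩ := DL1 k _ _ _ _ e y h
    rw [u0, u1, u2, u3, u4, w5_0, w5_1, w5_2, w5_3]
    obtain ⟨ha, hb, hc, hd, h1, h2, h3, h4, h5, h6⟩ := h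
    exact ⟨rfl, rfl, hd, hc, hb, ha, h6.symm, h4.symm, h1.symm,
      Or.inl ⟨rfl, rfl, h5.symm, h3.symm, h2.symm⟩⟩
  · obtain ⟨u0, u1, u2, u3, u4⟩ := DL4 k _ _ _ _ e y h
    rw [u0, u1, u2, u3, u4, w5_0, w5_1, w5_2, w5_3]
    clear u0 u1 u2 u3 u4 H
    refine ⟨rfl, rfl, by omega, by omega, by omega, by omega, by omega, by omega, by omega,
      Or.inr (Or.inl ⟨rfl, rfl, by omega, by omega, by omega⟩)⟩
  · clear H
    obtain ⟨e1, e2, e3, e4⟩ | ⟨e1, e2, e3, e4⟩ | ⟨e1, e2, e3, e4⟩ |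
      ⟨e1, e2, e3, e4⟩ | ⟨e1, e2, e3, e4⟩ | ⟨e1, e2, e3, e4⟩ |
      ⟨e1, e2, e3, e4⟩ | ⟨e1, e2, e3, e4⟩ := h
    · obtain ⟨u0, u1, u2, u3, u4⟩ := DL2 k a b c d e y (by omega) (by omega) (by omega) (by omega)
      rw [u0, u1, u2, u3, u4, w5_0, w5_1, w5_2, w5_3]
      clear u0 u1 u2 u3 u4
      refine ⟨rfl, rfl, by omega, by omega, by omega, by omega, by omega, by omega, by omega,
        Or.inr (Or.inr (Or.inl ⟨rfl, rfl, by omega, by omega⟩))⟩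
    · obtain ⟨u0, u1, u2, u3, u4⟩ := DL2 k a b c d e y (by omega) (by omega) (by omega) (by omega)
      rw [u0, u1, u2, u3, u4, w5_0, w5_1, w5_2, w5_3]
      clear u0 u1 u2 u3 u4
      refine ⟨rfl, rfl, by omega, by omega, by omega, by omega, by omega, by omega, by omega,
        Or.inr (Or.inr (Or.inl ⟨rfl, rfl, by omega, by omega⟩))⟩
    · obtain ⟨u0, u1, u2, u3, u4⟩ := DL2 k a b c d e y (by omega) (by omega) (by omega) (by omega)
      rw [u0, u1, u2, u3, u4, w5_0, w5_1, w5_2, w5_3]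
      clear u0 u1 u2 u3 u4
      refine ⟨rfl, rfl, by omega, by omega, by omega, by omega, by omega, by omega, by omega,
        Or.inr (Or.inr (Or.inl ⟨rfl, rfl, by omega, by omega⟩))⟩
    · obtain ⟨u0, u1, u2, u3, u4⟩ := DL2 k a b c d e y (by omega) (by omega) (by omega) (by omega)
      rw [u0, u1, u2, u3, u4, w5_0, w5_1, w5_2, w5_3]
      clear u0 u1 u2 u3 u4
      refine ⟨rfl, rfl, by omega, by omega, by omega, by omega, by omega, by omega, by omega,
        Or.inr (Or.inr (Or.inl ⟨rfl, rfl, by omega, by omega⟩))⟩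
    · obtain ⟨u0, u1, u2, u3, u4⟩ :=
        DL3 k a b c d e y (by omega) (by omega) (by omega) (by omega) (by omega)
      rw [u0, u1, u2, u3, u4, w5_0, w5_1, w5_2, w5_3]
      clear u0 u1 u2 u3 u4
      refine ⟨rfl, rfl, by omega, by omega, by omega, by omega, by omega, by omega, by omega,
        Or.inr (Or.inr (Or.inr (Or.inl ⟨rfl, rfl, by omega, by omega⟩)))⟩
    · obtain ⟨u0, u1, u2, u3, u4⟩ :=
        DL3 k a b c d e y (by omega) (by omega) (by omega) (by omega) (by omega)
      rw [u0, u1, u2, u3, u4, w5_0, w5_1, w5_2, w5_3]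
      clear u0 u1 u2 u3 u4
      refine ⟨rfl, rfl, by omega, by omega, by omega, by omega, by omega, by omega, by omega,
        Or.inr (Or.inr (Or.inr (Or.inl ⟨rfl, rfl, by omega, by omega⟩)))⟩
    · obtain ⟨u0, u1, u2, u3, u4⟩ :=
        DL5 k a b c d e y (by omega) (by omega) (by omega) (by omega) (by omega)
      rw [u0, u1, u2, u3, u4, w5_0, w5_1, w5_2, w5_3]
      clear u0 u1 u2 u3 u4
      refine ⟨rfl, rfl, by omega, by omega, by omega, by omega, by omega, by omega, by omega,
        Or.inr (Or.inr (Or.inr (Or.inr ⟨rfl, rfl, by omega, by omega⟩)))⟩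
    · obtain ⟨u0, u1, u2, u3, u4⟩ :=
        DL5 k a b c d e y (by omega) (by omega) (by omega) (by omega) (by omega)
      rw [u0, u1, u2, u3, u4, w5_0, w5_1, w5_2, w5_3]
      clear u0 u1 u2 u3 u4
      refine ⟨rfl, rfl, by omega, by omega, by omega, by omega, by omega, by omega, by omega,
        Or.inr (Or.inr (Or.inr (Or.inr ⟨rfl, rfl, by omega, by omega⟩)))⟩

lemma F4_of (hx : InX n N x) {k : ℕ} (hk : k + 4 = N) :
    F4 (La N x 0) (La N x 1) (La N x 2) (La N x 3) ((P N)^[4] x k) ((P N)^[4] x (k+1))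
      ((P N)^[4] x (k+2)) ((P N)^[4] x (k+3)) := by
  subst hk
  obtain ⟨a1, a2, a3, a4⟩ := La_Lw k x
  have a5 := (P_iter k x).2.2.2
  have a6 : (P (k+4))^[4] x = Dw k (G k x) := by
    rw [← a5]; rfl
  rw [a1, a2, a3, a4, a6]
  have h := F4_aux k _ _ _ _ (G k x (k+4)) (G k x) ((hx.G_mem (m := k) (by omega)).u4 rfl)
  rwa [w5_self] at h

section

lemma N_pos (hn : 0 < n) (hN : N = n^2)
    : 0 < N := by subst hN; positivity

lemma PN' (hn : 0 < n) (hN : N = n^2)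
    (hx : InX n N x) : (P N)^[N] x = x := by subst hN; exact PN hn hx

lemma La_add_N (hn : 0 < n) (hN : N = n^2)
    (hx : InX n N x) (j : ℕ) : La N x (j + N) = La N x j := by
  have := La_iter N x N j
  rw [PN' hn hN hx] at this
  rw [this, add_comm]

lemma fin4 (hn : 0 < n) (hN : N = n^2)
    (hx : InX n N x) {k : ℕ} (hk : k + 4 = N) :
    F4 (La N x k) (La N x (k+1)) (La N x (k+2)) (La N x (k+3)) (x k) (x (k+1)) (x (k+2)) (x (k+3)) := by
  have h := F4_of (hx.Pi_mem (N_pos hn hN) k) hk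
  rw [← Function.iterate_add_apply, show 4 + k = N by omega, PN' hn hN hx] at h
  simpa only [La_iter, add_zero] using h

lemma La_last (hn : 0 < n) (hN : N = n^2)
    (hx : InX n N x) {k : ℕ} (hk : k + 1 = N) : La N x k = x k := by
  unfold La
  rw [hk, PN' hn hN hx]; congr 1; omega

lemma La_even (hn : 0 < n) (hN : N = n^2)
    (hx : InX n N x) (j : ℕ) : La N x j % 2 = 0 ∧ La N x j + 2 ≤ 2 * n := by
  have hp := N_pos hn hN
  have h := hx.Pi_mem hp (j+1)
  exact ⟨h.last_even (k := N-1) (by omega), h.bound (by omega)⟩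

/-- rotating a tableau by `s` steps -/
lemma rot (hn : 0 < n) (hN : N = n^2)
    (hx : InX n N x) {s : ℕ} (hs : s ≤ N) :
    (∀ i < s, La N ((P N)^[s] x) (N - s + i) = La N x i) ∧
    (∀ i, s ≤ i → La N ((P N)^[s] x) (i - s) = La N x i) := by
  constructor
  · intro i hi
    rw [La_iter, show s + (N - s + i) = i + N by omega, La_add_N hn hN hx]
  · intro i hi
    rw [La_iter, show s + (i - s) = i by omega]

lemma rot_back (hn : 0 < n) (hN : N = n^2)
    (hy : InX n N y) {s : ℕ} (hs : s ≤ N) : ∃ x', InX n N x' ∧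
    (∀ i < s, La N x' i = La N y (N - s + i)) ∧
    (∀ i, s ≤ i → La N x' i = La N y (i - s)) := by
  refine ⟨(P N)^[N-s] y, hy.Pi_mem (N_pos hn hN) _, fun i hi => La_iter _ _ _ _, fun i hi => ?_⟩
  rw [La_iter, show N - s + i = (i - s) + N by omega, La_add_N hn hN hy]

lemma La_adj (hn : 0 < n) (hN : N = n^2)
    (hx : InX n N x) (h4 : 4 ≤ N) (j : ℕ) : La N x j ≠ La N x (j+1) := by
  have h := F4_of (hx.Pi_mem (N_pos hn hN) j) (k := N-4) (by omega)
  simp only [La_iter, add_zero] at h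
  exact h.2.2.2.2.2.2.1

end

lemma sta_congr {k m : ℕ} (hk : k + 4 ≤ m) (h : ∀ i < m, x i = y i) :
    ∀ i < m, sta k x i = sta k y i := by
  intro i hi
  have e0 := h k (by omega)
  have e1 := h (k+1) (by omega)
  have e2 := h (k+2) (by omega)
  have e3 := h (k+3) (by omega)
  have ei := h i hi
  have hs : ∀ j, j + 1 < m → sw j x i = sw j y i := by
    intro j hj
    unfold sw; rw [h j (by omega), h (j+1) (by omega), ei]
  unfold sta; rw [e0, e1, e2, e3]
  split_ifs
  · exact hs _ (by omega)
  · exact hs _ (by omega)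
  · exact hs _ (by omega)
  · exact ei

lemma wst_congr {k m : ℕ} (hk : k + 4 ≤ m) (h : ∀ i < m, x i = y i) :
    ∀ i < m, wst k x i = wst k y i := by
  intro i hi
  have e0 := h k (by omega)
  have e1 := h (k+1) (by omega)
  have e2 := h (k+2) (by omega)
  have e3 := h (k+3) (by omega)
  have ei := h i hi
  have es := sta_congr hk h i hi
  unfold wst; rw [e0, e1, e2, e3]
  have hw : ∀ a b c d, w5 k a b c d (x (k+4)) x i = w5 k a b c d (y (k+4)) y i := by
    intro a b c d
    unfold w5
    by_cases h4 : i = k + 4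
    · subst h4; simp [ei]
    · simp [h4, ei]
  split_ifs
  · exact hw _ _ _ _
  · exact hw _ _ _ _
  · exact hw _ _ _ _
  · exact hw _ _ _ _
  · exact es

/-- apply the same stars to two words -/
lemma couple (hx : InX n N x) (hy : InX n N y) {m : ℕ} (hm : m ≤ N) (h : ∀ i < m, x i = y i)
    (hL : ∀ i < N, La N x i = La N y i) {x1 : ℕ → ℕ} (hr : StR m x x1) :
    ∃ y1, StR m y y1 ∧ (∀ i < m, x1 i = y1 i) ∧ ∀ i < N, La N x1 i = La N y1 i := by
  induction hr with
  | refl => exact ⟨y, Relation.ReflTransGen.refl, h, hL⟩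
  | @tail b c hb hc ih =>
    obtain ⟨k, hk, rfl⟩ := hc
    obtain ⟨y1, h1, h2, h3⟩ := ih
    refine ⟨sta k y1, Relation.ReflTransGen.tail h1 ⟨k, hk, rfl⟩, sta_congr hk h2, ?_⟩
    intro i hi
    rw [La_sta (StR.mem hb hx hm) (by omega) hi, La_sta (h1.mem hy hm) (by omega) hi]
    exact wst_congr (m := N) (by omega) h3 i hi

lemma La_inj_aux (hx : InX n N x) (hy : InX n N y) (h4 : 4 ≤ N)
    (hL : ∀ i < N, La N x i = La N y i) {m : ℕ} (hm : m < N) (h : ∀ i < m, x i = y i) :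
    ¬ (x m < y m) := by
  intro hlt
  have hc : ∀ c, cnt x c m = cnt y c m := cnt_congr h
  have h2 : x m + 2 ≤ y m := by
    by_contra hcon
    have e : y m = x m + 1 := by omega
    have a1 := cnt_succ x (x m) m
    have a2 := cnt_succ x (x m + 1) m
    have b1 := cnt_succ y (x m) m
    have b2 := cnt_succ y (x m + 1) m
    rw [if_pos rfl] at a1
    rw [if_neg (by omega)] at a2 b1
    rw [if_pos e] at b2
    have c1 := hx.lat2 (m+1) (by omega) (x m)
    have c2 := hy.lat1 (m+1) (by omega) (x m)
    have := hc (x m); have := hc (x m + 1)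
    omega
  obtain ⟨hm2, x1, r1, p1, p2, p3⟩ := prep hx (m := m) (l := x m) (u := y m) (by omega) (by
      obtain ⟨j, a, b⟩ := hy.pre_le (j := m) (c := x m + 1) hm (by omega)
      rw [← h j a] at b
      exact ⟨j, a, by omega, by omega⟩) (by
      intro i hi e
      obtain ⟨j, a, b, c⟩ := hx.up hi hm e
      exact ⟨j, a, b, by omega⟩) (by
      intro i hi e
      obtain ⟨j, a, b, c⟩ := hy.down hi hm (by rw [← h i hi]; exact e) (by rw [← h i hi]; omega)
      exact ⟨j, a, b, by rw [h j b, c, ← h i hi, e]⟩)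
  have r2 := r1.toSt hx (by omega)
  obtain ⟨y1, r3, q1, q2⟩ := couple hx hy (by omega) h hL r2
  have hx1 := r2.mem hx (by omega)
  have hy1 := r3.mem hy (by omega)
  have e1 := r2.ge (i := m) le_rfl
  have e2 := r3.ge (i := m) le_rfl
  have g1 := q1 (m-2) (by omega)
  have g2 := q1 (m-1) (by omega)
  obtain ⟨k, rfl⟩ : ∃ k, m = k + 2 := ⟨m - 2, by omega⟩
  rw [show k + 2 - 2 = k by omega, show k + 2 - 1 = k + 1 by omega] at *
  have P1 : Pk x1 k := ⟨p1, by omega⟩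
  rw [← Pk_La hx1 h4 hm] at P1
  have P2 : Pk (La N y1) k := by
    rwa [Pk_congr (q2 k (by omega)) (q2 (k+1) (by omega)) (q2 (k+2) (by omega))] at P1
  rw [Pk_La hy1 h4 hm] at P2
  have := P2.2
  omega

lemma La_inj (hx : InX n N x) (hy : InX n N y) (h4 : 4 ≤ N)
    (hL : ∀ i < N, La N x i = La N y i) : x = y := by
  have key : ∀ m ≤ N, ∀ i < m, x i = y i := by
    intro m
    induction m with
    | zero => intro _ i hi; omega
    | succ m ih =>
      intro hm i hi
      have ih := ih (by omega)
      rcases Nat.lt_or_ge i m with h | h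
      · exact ih i h
      · obtain rfl : i = m := by omega
        have a := La_inj_aux hx hy h4 hL (by omega) ih
        have b := La_inj_aux hy hx h4 (fun i hi => (hL i hi).symm) (by omega)
          (fun i hi => (ih i hi).symm)
        omega
  funext i
  rcases Nat.lt_or_ge i N with h | h
  · exact key N le_rfl i h
  · rw [hx.zer i h, hy.zer i h]

lemma inv_back {m p : ℕ} (hx : InX n N x) (hmp : m ≤ p) (hp : p + 2 ≤ N) {v : ℕ → ℕ}
    (hr : StR m x v) (h : ∀ j < m, La N v j = La N (tg p v) j) :
    ∀ j < m, La N x j = La N (tg p x) j := by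
  have hs := hr.symm
  have hv := hr.mem hx (by omega)
  clear hr hx
  induction hs with
  | refl => exact h
  | @tail b c hb hc ih =>
    obtain ⟨k, hk, rfl⟩ := hc
    intro j hj
    have hbm := StR.mem hb hv (by omega)
    rw [tg_sta_comm (i := p) (k := k) (by omega) b, La_sta hbm (by omega) (by omega),
      La_sta (hbm.tg_mem (by omega)) (by omega) (by omega)]
    exact wst_congr hk ih j hj

end PSB

namespace PSB
variable {n N : ℕ} {x y : ℕ → ℕ}

lemma wst_swap {k a b c d e : ℕ} {z : ℕ → ℕ} (h : c + 4 ≤ d ∨ d + 4 ≤ c)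
    (h2 : wst k (w5 k a b c d e z) (k+2) = d) (h3 : wst k (w5 k a b c d e z) (k+3) = c) :
    wst k (w5 k a b c d e z) = w5 k a b d c e z := by
  have aux : ∀ p q r s, wst k (w5 k a b c d e z) = w5 k p q r s e z → r = d ∧ s = c := by
    intro p q r s h
    rw [h] at h2 h3
    rw [w5_2] at h2; rw [w5_3] at h3
    exact ⟨h2, h3⟩
  have hne : d ≠ c := by clear aux h2 h3; omega
  by_cases b1 : a = 0 ∧ b = 2 ∧ c = 0 ∧ d = 2
  · omega
  by_cases b2 : a = 2 ∧ b = 0 ∧ c = 2 ∧ d = 0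
  · omega
  by_cases b3 : a < b ∧ b = d ∧ (b = c + 2 ∨ c = b + 2)
  · clear aux; omega
  by_cases b4 : a = c ∧ d < c ∧ (b = a + 2 ∨ a = b + 2)
  · exact absurd (aux _ _ _ _ (wb4 b1 b2 b3 b4)).2 hne
  have w := wb5 (k := k) (e := e) (y := z) b1 b2 b3 b4
  by_cases g1 : ((a < c ∧ c < b) ∨ (b < c ∧ c < a)) ∧ d < c
  · rw [sb1 g1] at w
    exact absurd (aux _ _ _ _ w).2 hne
  by_cases g2 : (a < b ∨ a < c) ∧ (d < b ∨ d < c) ∧ ((b < a ∨ c < a) ∨ (b < d ∨ c < d))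
  · rw [sb2 g1 g2] at w
    exact absurd (aux _ _ _ _ w).2 hne
  by_cases g3 : ((c < b ∧ b < d) ∨ (d < b ∧ b < c)) ∧ a < b
  · rw [sb3 g1 g2 g3] at w
    exact w
  · rw [sb4 g1 g2 g3] at w
    exact absurd (aux _ _ _ _ w).2 hne

lemma tg_far {k : ℕ} (h : ¬ near (x k) (x (k+1))) : tg k x = sw k x := by
  unfold tg; rw [if_neg h]

section

lemma M2_end (hn : 0 < n) (hN : N = n^2)
    (hy : InX n N y) {k : ℕ} (hk : k + 4 = N)
    (h : La N y (k+2) + 4 ≤ La N y (k+3) ∨ La N y (k+3) + 4 ≤ La N y (k+2)) :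
    ∃ y', InX n N y' ∧ (∀ j < k + 2, La N y' j = La N y j) ∧ La N y' (k+2) = La N y (k+3) ∧
      La N y' (k+3) = La N y (k+2) := by
  have f := fin4 hn hN hy hk
  have f2 := f.1
  have f3 := f.2.1
  have hnn : ¬ near (y (k+2)) (y (k+3)) := by unfold near; omega
  have hy' := hy.tg_mem (k := k+2) (by omega)
  refine ⟨tg (k+2) y, hy', ?_, ?_, ?_⟩
  · obtain ⟨k', hk', v, hr, hs⟩ := prep2 hy (m := k+2) (by omega) hnn
    obtain rfl : k' = k := by omega
    have hr := hr.toSt hy (by omega)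
    have hv := hr.mem hy (by omega)
    have v2 := hr.ge (i := k'+2) le_rfl
    have v3 := hr.ge (i := k'+3) (by omega)
    have g := fin4 hn hN hv hk
    have g' := fin4 hn hN (hv.sta_mem (k := k') (by omega)) hk
    have t2 : sta k' v (k'+2) = v (k'+3) := by
      rw [hs, tg_far (by rw [v2, v3]; exact hnn), sw_left]
    have t3 : sta k' v (k'+3) = v (k'+2) := by
      rw [hs, tg_far (by rw [v2, v3]; exact hnn), sw_right]
    have g2 := g.1
    have g3 := g.2.1
    have g2' := g'.1
    have g3' := g'.2.1
    rw [La_sta hv (by omega) (by omega)] at g2' g3'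
    rw [← w5_self k' (La N v)] at g2' g3'
    have w := wst_swap (show La N v (k'+2) + 4 ≤ La N v (k'+3) ∨ _ by omega)
      (g2'.trans (by rw [t2, g3])) (g3'.trans (by rw [t3, g2]))
    rw [w5_self] at w
    intro j hj
    refine (inv_back hy le_rfl (by omega) hr ?_ j hj).symm
    intro i hi
    rw [← hs, La_sta hv (by omega) (by omega), w]
    unfold w5; split_ifs <;> first | rfl | omega | (subst_vars; rfl)
  · have f' := fin4 hn hN hy' hk
    rw [f'.1, f.2.1, tg_far hnn, sw_left]
  · have f' := fin4 hn hN hy' hk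
    rw [f'.2.1, f.1, tg_far hnn, sw_right]

lemma M3_end (hn : 0 < n) (hN : N = n^2)
    (hy : InX n N y) {k : ℕ} (hk : k + 4 = N) (h13 : La N y (k+1) = La N y (k+3))
    (h : (La N y (k+2) + 2 = La N y (k+3) ∧ 1 ≤ La N y (k+2)) ∨
      (La N y (k+3) + 2 = La N y (k+2) ∧ 1 ≤ La N y (k+3))) :
    ∃ y', InX n N y' ∧ (∀ j < k + 1, La N y' j = La N y j) ∧ La N y' (k+1) = La N y (k+2) ∧
      La N y' (k+2) = La N y (k+3) ∧ La N y' (k+3) = La N y (k+2) := by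
  have f := fin4 hn hN hy hk
  have f2 := f.1
  have f3 := f.2.1
  have hq : (y (k+1) = y (k+2) + 1 ∧ y (k+3) = y (k+2) + 2) ∨
      (y (k+1) = y (k+3) + 1 ∧ y (k+2) = y (k+3) + 2) := by
    obtain ⟨-, -, -, -, -, -, n1, n2, n3, f | f | f | f | f⟩ := f <;> omega
  have hnn : ¬ near (y (k+2)) (y (k+3)) := by unfold near; omega
  have hy' := hy.tg_mem (k := k+2) (by omega)
  have f' := fin4 hn hN hy' hk
  have t1 : tg (k+2) y (k+1) = y (k+1) := tg_ne _ (by omega) (by omega)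
  have t2 : tg (k+2) y (k+2) = y (k+3) := by rw [tg_far hnn, sw_left]
  have t3 : tg (k+2) y (k+3) = y (k+2) := by rw [tg_far hnn, sw_right]
  refine ⟨tg (k+2) y, hy', ?_, ?_, by rw [f'.1, t2, f3], by rw [f'.2.1, t3, f2]⟩
  · obtain ⟨-, v, hr, hs⟩ := prepA hy (p := k+1) (by omega) (by omega)
    have hr := hr.toSt hy (by omega)
    have hv := hr.mem hy (by omega)
    have v1 := hr.ge (i := k+1) le_rfl
    have v2 := hr.ge (i := k+2) (by omega)
    have v3 := hr.ge (i := k+3) (by omega)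
    rw [show k + 1 - 1 = k by omega, ← v1] at hs
    have e : sta k v = tg (k+2) v := by
      rw [sta_eq_sw2 hs (by omega), tg_far]
      rw [v2, v3]; exact hnn
    have g := fin4 hn hN hv hk
    intro j hj
    refine (inv_back (m := k+1) hy (by omega) (by omega) hr ?_ j hj).symm
    intro i hi
    rw [← e, La_sta hv (by omega) (by omega)]
    have w : wst k (La N v) = w5 k (La N v k) (La N v (k+2)) (La N v (k+1)) (La N v (k+2))
        (La N v (k+4)) (La N v) := by
      conv_lhs => rw [← w5_self k (La N v)]
      obtain ⟨g1, g2, m1, m2, m3, m4, n1, n2, n3, g⟩ := g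
      have : La N v k = v k ∧ La N v (k+1) = La N v (k+3) := by
        rcases g with g | g | g | g | g <;> omega
      exact wb3 (by omega) (by omega) (by omega)
    rw [w]
    unfold w5; split_ifs <;> first | rfl | omega | (subst_vars; rfl)
  · obtain ⟨g1, g2, m1, m2, m3, m4, n1, n2, n3, g⟩ := f'
    rcases g with g | g | g | g | g <;> omega

lemma M4_end (hn : 0 < n) (hN : N = n^2)
    (hy : InX n N y) {k : ℕ} (hk : k + 4 = N)
    (h : (La N y k = 0 ∧ La N y (k+1) = 2 ∧ La N y (k+2) = 0 ∧ La N y (k+3) = 2) ∨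
      (La N y k = 2 ∧ La N y (k+1) = 0 ∧ La N y (k+2) = 2 ∧ La N y (k+3) = 0)) :
    ∃ y', InX n N y' ∧ (∀ j < k, La N y' j = La N y j) ∧ La N y' k = La N y (k+1) ∧
      La N y' (k+1) = La N y k ∧ La N y' (k+2) = La N y (k+1) ∧ La N y' (k+3) = La N y k := by
  have key : wst k (La N y) = w5 k (La N y (k+1)) (La N y k) (La N y (k+1)) (La N y k)
      (La N y (k+4)) (La N y) := by
    rcases h with h | h
    · unfold wst; rw [if_pos h, h.1, h.2.1]
    · unfold wst; rw [if_neg (by omega), if_pos h, h.1, h.2.1]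
  refine ⟨sta k y, hy.sta_mem (by omega), ?_, ?_, ?_, ?_, ?_⟩
  · intro j hj
    rw [La_sta hy (by omega) (by omega), wst_ne _ (by omega)]
  · rw [La_sta hy (by omega) (by omega), key, w5_0]
  · rw [La_sta hy (by omega) (by omega), key, w5_1]
  · rw [La_sta hy (by omega) (by omega), key, w5_2]
  · rw [La_sta hy (by omega) (by omega), key, w5_3]

lemma M2 (hn : 0 < n) (hN : N = n^2)
    (hx : InX n N x) (h4 : 4 ≤ N) {j : ℕ} (hj : j + 2 ≤ N)
    (h : La N x j + 4 ≤ La N x (j+1) ∨ La N x (j+1) + 4 ≤ La N x j) :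
    ∃ x', InX n N x' ∧ La N x' j = La N x (j+1) ∧ La N x' (j+1) = La N x j ∧
      ∀ i < N, i ≠ j → i ≠ j+1 → La N x' i = La N x i := by
  obtain ⟨k, hk⟩ : ∃ k, k + 4 = N := ⟨N - 4, by omega⟩
  have hy := hx.Pi_mem (N_pos hn hN) (j+2)
  obtain ⟨r1, r2⟩ := rot hn hN hx hj
  have e0 := r1 j (by omega)
  have e1 := r1 (j+1) (by omega)
  rw [show N - (j+2) + j = k + 2 by omega] at e0
  rw [show N - (j+2) + (j+1) = k + 3 by omega] at e1
  obtain ⟨y', hy', a, b, c⟩ := M2_end hn hN hy hk (by omega)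
  obtain ⟨x', hx', s1, s2⟩ := rot_back hn hN hy' hj
  refine ⟨x', hx', ?_, ?_, ?_⟩
  · rw [s1 j (by omega), show N - (j+2) + j = k + 2 by omega, b, e1]
  · rw [s1 (j+1) (by omega), show N - (j+2) + (j+1) = k + 3 by omega, c, e0]
  · intro i hi h1 h2
    rcases Nat.lt_or_ge i (j+2) with g | g
    · rw [s1 i g, a _ (by omega), r1 i g]
    · rw [s2 i g, a _ (by omega), r2 i g]

lemma M3 (hn : 0 < n) (hN : N = n^2)
    (hx : InX n N x) (h4 : 4 ≤ N) {j : ℕ} (hj : j + 3 ≤ N) (h13 : La N x j = La N x (j+2))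
    (h : (La N x (j+1) + 2 = La N x j ∧ 1 ≤ La N x (j+1)) ∨
      (La N x j + 2 = La N x (j+1) ∧ 1 ≤ La N x j)) :
    ∃ x', InX n N x' ∧ La N x' j = La N x (j+1) ∧ La N x' (j+1) = La N x j ∧
      La N x' (j+2) = La N x (j+1) ∧
      ∀ i < N, i ≠ j → i ≠ j+1 → i ≠ j+2 → La N x' i = La N x i := by
  obtain ⟨k, hk⟩ : ∃ k, k + 4 = N := ⟨N - 4, by omega⟩
  have hy := hx.Pi_mem (N_pos hn hN) (j+3)
  obtain ⟨r1, r2⟩ := rot hn hN hx hj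
  have e0 := r1 j (by omega)
  have e1 := r1 (j+1) (by omega)
  have e2 := r1 (j+2) (by omega)
  rw [show N - (j+3) + j = k + 1 by omega] at e0
  rw [show N - (j+3) + (j+1) = k + 2 by omega] at e1
  rw [show N - (j+3) + (j+2) = k + 3 by omega] at e2
  obtain ⟨y', hy', a, b, c, d⟩ := M3_end hn hN hy hk (by omega) (by omega)
  obtain ⟨x', hx', s1, s2⟩ := rot_back hn hN hy' hj
  refine ⟨x', hx', ?_, ?_, ?_, ?_⟩
  · rw [s1 j (by omega), show N - (j+3) + j = k + 1 by omega, b, e1]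
  · rw [s1 (j+1) (by omega), show N - (j+3) + (j+1) = k + 2 by omega, c, e2, h13]
  · rw [s1 (j+2) (by omega), show N - (j+3) + (j+2) = k + 3 by omega, d, e1]
  · intro i hi h1 h2 h3
    rcases Nat.lt_or_ge i (j+3) with g | g
    · rw [s1 i g, a _ (by omega), r1 i g]
    · rw [s2 i g, a _ (by omega), r2 i g]

lemma M4 (hn : 0 < n) (hN : N = n^2)
    (hx : InX n N x) (h4 : 4 ≤ N) {j : ℕ} (hj : j + 4 ≤ N)
    (h : (La N x j = 0 ∧ La N x (j+1) = 2 ∧ La N x (j+2) = 0 ∧ La N x (j+3) = 2) ∨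
      (La N x j = 2 ∧ La N x (j+1) = 0 ∧ La N x (j+2) = 2 ∧ La N x (j+3) = 0)) :
    ∃ x', InX n N x' ∧ La N x' j = La N x (j+1) ∧ La N x' (j+1) = La N x j ∧
      La N x' (j+2) = La N x (j+1) ∧ La N x' (j+3) = La N x j ∧
      ∀ i < N, i ≠ j → i ≠ j+1 → i ≠ j+2 → i ≠ j+3 → La N x' i = La N x i := by
  obtain ⟨k, hk⟩ : ∃ k, k + 4 = N := ⟨N - 4, by omega⟩
  have hy := hx.Pi_mem (N_pos hn hN) (j+4)
  obtain ⟨r1, r2⟩ := rot hn hN hx hj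
  have e0 := r1 j (by omega)
  have e1 := r1 (j+1) (by omega)
  have e2 := r1 (j+2) (by omega)
  have e3 := r1 (j+3) (by omega)
  rw [show N - (j+4) + j = k by omega] at e0
  rw [show N - (j+4) + (j+1) = k + 1 by omega] at e1
  rw [show N - (j+4) + (j+2) = k + 2 by omega] at e2
  rw [show N - (j+4) + (j+3) = k + 3 by omega] at e3
  obtain ⟨y', hy', a, b, c, d, e⟩ := M4_end hn hN hy hk (by omega)
  obtain ⟨x', hx', s1, s2⟩ := rot_back hn hN hy' hj
  refine ⟨x', hx', ?_, ?_, ?_, ?_, ?_⟩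
  · rw [s1 j (by omega), show N - (j+4) + j = k by omega, b, e1]
  · rw [s1 (j+1) (by omega), show N - (j+4) + (j+1) = k + 1 by omega, c, e0]
  · rw [s1 (j+2) (by omega), show N - (j+4) + (j+2) = k + 2 by omega, d, e1]
  · rw [s1 (j+3) (by omega), show N - (j+4) + (j+3) = k + 3 by omega, e, e0]
  · intro i hi h1 h2 h3 h5
    rcases Nat.lt_or_ge i (j+4) with g | g
    · rw [s1 i g, a _ (by omega), r1 i g]
    · rw [s2 i g, a _ (by omega), r2 i g]

lemma exists_last (hn : 0 < n) (hN : N = n^2)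
    {a : ℕ} (ha : a < n) : ∃ x, InX n N x ∧ La N x (N-1) = 2 * a := by
  have hp := N_pos hn hN
  have hx : InX n N (T0 n) := by subst hN; exact T0_mem n
  obtain ⟨l, hl, e⟩ := hx.occurs (c := 2*a) (by omega)
  obtain ⟨j, hj, ej, hlast⟩ := last_idx (p := fun j => T0 n j = 2 * a) ⟨l, hl, e⟩
  obtain ⟨y, hr, hy⟩ := move (j := j) (p := N-1) (by omega) (T0 n) (by
    intro i hi1 hi2 hnear
    have h0 := hlast i hi1 (by omega)
    unfold near at hnear
    have : T0 n i = 2*a+1 ∨ T0 n i + 1 = 2*a := by omega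
    rcases this with g | g
    · obtain ⟨l, b1, b2, b3⟩ := hx.odd_down (j := i) (by omega) (by omega)
      exact hlast l (by omega) b2 (by omega)
    · obtain ⟨l, b1, b2, b3⟩ := hx.odd_up (j := i) (by omega) (by omega)
      exact hlast l (by omega) b2 (by omega))
  have hym := hr.mem hx (by omega)
  exact ⟨y, hym, by rw [La_last hn hN hym (by omega), hy, ej]⟩

end
end PSB

namespace PSB
variable {n N : ℕ} {x y : ℕ → ℕ}

lemma shape_iff (n a b : ℕ) : shiftCell (dblStair n) (a, b) ↔ a ≤ b ∧ a + b + 2 ≤ 2 * n := by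
  unfold shiftCell dblStair
  simp only [List.getD_eq_getElem?_getD, List.getElem?_map]
  rcases Nat.lt_or_ge a n with h | h
  · rw [List.getElem?_range h]; simp; omega
  · rw [List.getElem?_eq_none (by simpa using h)]; simp; omega

lemma exists_cnt {c a m : ℕ} (h : a < cnt x c m) : ∃ i < m, x i = c ∧ cnt x c i = a := by
  induction m with
  | zero => rw [cnt_zero] at h; omega
  | succ m ih =>
    by_cases g : a < cnt x c m
    · obtain ⟨i, h1, h2⟩ := ih g
      exact ⟨i, by omega, h2⟩
    · rw [cnt_succ] at h
      split_ifs at h with e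
      · exact ⟨m, by omega, e, by omega⟩
      · omega

/-- the filling with content word `x` -/
noncomputable def fil (n : ℕ) (x : ℕ → ℕ) (p : ℕ × ℕ) : ℕ :=
  open Classical in
  if p.1 ≤ p.2 ∧ p.1 + p.2 + 2 ≤ 2 * n then sInf {v | p.1 < cnt x (p.2 - p.1) v} else 0

lemma fil_off {a b : ℕ} (h : ¬ (a ≤ b ∧ a + b + 2 ≤ 2 * n)) : fil n x (a, b) = 0 := by
  unfold fil; exact if_neg h

lemma InX.cell (hx : InX n N x) {a c : ℕ} (h : 2 * a + c + 2 ≤ 2 * n) :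
    ∃ i < N, x i = c ∧ cnt x c i = a := by
  apply exists_cnt
  rw [hx.tot]; omega

lemma fil_of {a c i : ℕ} (h : 2 * a + c + 2 ≤ 2 * n) (h1 : x i = c) (h2 : cnt x c i = a) :
    fil n x (a, a + c) = i + 1 := by
  unfold fil
  rw [if_pos (by simp; omega)]
  simp only [Nat.add_sub_cancel_left]
  apply le_antisymm
  · apply Nat.sInf_le
    simp only [Set.mem_setOf_eq]
    rw [cnt_succ, if_pos h1]; omega
  · apply le_csInf
    · exact ⟨i + 1, by simp only [Set.mem_setOf_eq]; rw [cnt_succ, if_pos h1]; omega⟩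
    · intro v hv
      simp only [Set.mem_setOf_eq] at hv
      by_contra hc
      have := cnt_mono x c (show v ≤ i by omega)
      omega

lemma InX.shape (hx : InX n N x) {i : ℕ} (hi : i < N) :
    2 * cnt x (x i) i + x i + 2 ≤ 2 * n := by
  have h1 := cnt_mono x (x i) (show i + 1 ≤ N by omega)
  rw [cnt_succ, if_pos rfl, hx.tot] at h1
  omega

lemma InX.fil_at (hx : InX n N x) {i : ℕ} (hi : i < N) :
    fil n x (cnt x (x i) i, cnt x (x i) i + x i) = i + 1 :=
  fil_of (hx.shape hi) rfl rfl

lemma InX.fil_iff (hx : InX n N x) {a c i : ℕ} (h : 2 * a + c + 2 ≤ 2 * n) :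
    fil n x (a, a + c) = i + 1 ↔ x i = c ∧ cnt x c i = a := by
  constructor
  · intro e
    obtain ⟨j, hj, h1, h2⟩ := hx.cell h
    have := fil_of h h1 h2
    obtain rfl : i = j := by omega
    exact ⟨h1, h2⟩
  · rintro ⟨h1, h2⟩
    exact fil_of h h1 h2

/-- value `i+1` sits exactly at one cell -/
lemma InX.fil_pos (hx : InX n N x) {a b i : ℕ} (h : fil n x (a, b) = i + 1) :
    i < N ∧ a = cnt x (x i) i ∧ b = a + x i ∧ 2 * a + x i + 2 ≤ 2 * n := by
  by_cases hs : a ≤ b ∧ a + b + 2 ≤ 2 * n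
  · obtain ⟨c, rfl⟩ : ∃ c, b = a + c := ⟨b - a, by omega⟩
    have hs' : 2 * a + c + 2 ≤ 2 * n := by omega
    obtain ⟨j, hj, h1, h2⟩ := hx.cell hs'
    have := fil_of hs' h1 h2
    obtain rfl : i = j := by omega
    subst h1
    exact ⟨hj, h2.symm, rfl, hs'⟩
  · rw [fil_off hs] at h; omega

lemma InX.fil_ne (hx : InX n N x) {a b : ℕ} (h : a ≤ b ∧ a + b + 2 ≤ 2 * n) :
    1 ≤ fil n x (a, b) ∧ fil n x (a, b) ≤ N := by
  obtain ⟨c, rfl⟩ : ∃ c, b = a + c := ⟨b - a, by omega⟩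
  obtain ⟨j, hj, h1, h2⟩ := hx.cell (a := a) (c := c) (by omega)
  rw [fil_of (by omega) h1 h2]; omega

/-- the entry to the right is larger -/
lemma InX.fil_right (hx : InX n N x) {a b i j : ℕ} (h : fil n x (a, b) = i + 1)
    (h' : fil n x (a, b + 1) = j + 1) : i < j := by
  obtain ⟨h1, h2, h3, h4⟩ := hx.fil_pos h
  obtain ⟨k1, k2, k3, k4⟩ := hx.fil_pos h'
  have e : x j = x i + 1 := by omega
  by_contra hc
  have l1 := hx.lat1 (j+1) (by omega) (x i)
  rw [← e, cnt_succ, if_pos rfl] at l1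
  have l2 := cnt_mono x (x i) (show j + 1 ≤ i by
    rcases Nat.lt_or_ge j i with g | g
    · omega
    · obtain rfl : i = j := by omega
      omega)
  omega

lemma InX.fil_below (hx : InX n N x) {a b i j : ℕ} (h : fil n x (a, b) = i + 1)
    (h' : fil n x (a + 1, b) = j + 1) : i < j := by
  obtain ⟨h1, h2, h3, h4⟩ := hx.fil_pos h
  obtain ⟨k1, k2, k3, k4⟩ := hx.fil_pos h'
  have e : x i = x j + 1 := by omega
  by_contra hc
  have l1 := hx.lat2 (j+1) (by omega) (x j)
  rw [cnt_succ, if_pos rfl] at l1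
  have l2 := cnt_mono x (x j + 1) (show j + 1 ≤ i by
    rcases Nat.lt_or_ge j i with g | g
    · omega
    · obtain rfl : i = j := by omega
      omega)
  rw [← e] at l2 l1
  omega

lemma InX.fil_std (hx : InX n N x) : IsStdFilling (shiftCell (dblStair n)) N (fil n x) := by
  have hp : ∀ a b, shiftCell (dblStair n) (a, b) → ∃ i, fil n x (a, b) = i + 1 := by
    intro a b h
    rw [shape_iff] at h
    have := hx.fil_ne h
    exact ⟨fil n x (a, b) - 1, by omega⟩
  refine ⟨?_, ?_, ?_, ?_, ?_, ?_⟩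
  · rintro ⟨a, b⟩ h
    rw [shape_iff] at h
    exact fil_off h
  · rintro ⟨a, b⟩ h
    rw [shape_iff] at h
    exact hx.fil_ne h
  · rintro ⟨a, b⟩ ⟨a', b'⟩ h h' e
    obtain ⟨i, hi⟩ := hp a b h
    obtain ⟨h1, h2, h3, h4⟩ := hx.fil_pos hi
    obtain ⟨k1, k2, k3, k4⟩ := hx.fil_pos (e.symm.trans hi)
    rw [h3, k3, h2, k2]
  · intro v h1 h2
    obtain ⟨i, rfl⟩ : ∃ i, v = i + 1 := ⟨v - 1, by omega⟩
    refine ⟨_, ?_, hx.fil_at (i := i) (by omega)⟩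
    rw [shape_iff]
    have := hx.shape (i := i) (by omega)
    omega
  · intro a b h h'
    obtain ⟨i, hi⟩ := hp a b h
    obtain ⟨j, hj⟩ := hp _ _ h'
    have := hx.fil_right hi hj
    omega
  · intro a b h h'
    obtain ⟨i, hi⟩ := hp a b h
    obtain ⟨j, hj⟩ := hp _ _ h'
    have := hx.fil_below hi hj
    omega

lemma fil_inj (hx : InX n N x) (hy : InX n N y) (h : fil n x = fil n y) : x = y := by
  funext i
  rcases Nat.lt_or_ge i N with hi | hi
  · have e := hx.fil_at hi
    rw [h] at e
    have := (hy.fil_pos e).2.2.1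
    omega
  · rw [hx.zer i hi, hy.zer i hi]

lemma std_aux {f : ℕ × ℕ → ℕ} (hf : IsStdFilling (shiftCell (dblStair n)) N f) :
    ∃ x, InX n N x ∧ f = fil n x := by
  obtain ⟨h1, h2, h3, h4, h5, h6⟩ := hf
  have hex : ∀ i, ∃ p : ℕ × ℕ, i < N → (2 * p.1 + p.2 + 2 ≤ 2 * n ∧ f (p.1, p.1 + p.2) = i + 1) := by
    intro i
    by_cases hi : i < N
    · obtain ⟨⟨a, b⟩, hs, e⟩ := h4 (i+1) (by omega) (by omega)
      rw [shape_iff] at hs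
      refine ⟨(a, b - a), fun _ => ⟨?_, ?_⟩⟩
      · show 2 * a + (b - a) + 2 ≤ 2 * n
        omega
      · show f (a, a + (b - a)) = i + 1
        rw [show a + (b - a) = b by omega, e]
    · exact ⟨(0, 0), fun h => absurd h hi⟩
  choose p hp using hex
  let x : ℕ → ℕ := fun i => if i < N then (p i).2 else 0
  have xdef : ∀ i < N, x i = (p i).2 := fun i hi => if_pos hi
  have diag : ∀ a c, 2 * (a + 1) + c + 2 ≤ 2 * n → f (a, a + c) < f (a + 1, a + 1 + c) := by
    intro a c h
    have q1 := h5 a (a + c) (by rw [shape_iff]; omega) (by rw [shape_iff]; omega)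
    have q2 := h6 a (a + c + 1) (by rw [shape_iff]; omega) (by rw [shape_iff]; omega)
    rw [show a + 1 + c = a + c + 1 by omega]; omega
  have diag2 : ∀ c d a, 0 < d → 2 * (a + d) + c + 2 ≤ 2 * n → f (a, a + c) < f (a + d, a + d + c) := by
    intro c d
    induction d with
    | zero => intro a h; omega
    | succ d ih =>
      intro a _ h
      rcases Nat.eq_zero_or_pos d with rfl | hd
      · exact diag a c h
      · exact (ih a hd (by omega)).trans (diag (a + d) c h)
  have dlt : ∀ c a a', a < a' → 2 * a' + c + 2 ≤ 2 * n → f (a, a + c) < f (a', a' + c) := by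
    intro c a a' h h'
    have := diag2 c (a' - a) a (by omega) (by omega)
    rwa [show a + (a' - a) = a' by omega] at this
  have inj : ∀ a c a' c', 2 * a + c + 2 ≤ 2 * n → 2 * a' + c' + 2 ≤ 2 * n →
      f (a, a + c) = f (a', a' + c') → a = a' ∧ c = c' := by
    intro a c a' c' g1 g2 e
    have := h3 (a, a + c) (a', a' + c') (by rw [shape_iff]; omega) (by rw [shape_iff]; omega) e
    rw [Prod.mk.injEq] at this
    omega
  have key : ∀ m ≤ N, ∀ c, cnt x c m ≤ n - (c+1)/2 ∧
      ∀ a, 2 * a + c + 2 ≤ 2 * n → (f (a, a + c) ≤ m ↔ a < cnt x c m) := by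
    intro m
    induction m with
    | zero =>
      intro _ c
      rw [cnt_zero]
      refine ⟨by omega, fun a ha => ?_⟩
      have := (h2 (a, a + c) (by rw [shape_iff]; omega)).1
      omega
    | succ m ih =>
      intro hm c
      obtain ⟨w, ihc⟩ := ih (by omega) c
      obtain ⟨q1, q2⟩ := hp m (by omega)
      rw [cnt_succ, xdef m (by omega)]
      generalize (p m).1 = a0 at *
      generalize (p m).2 = c0 at *
      by_cases e : c0 = c
      · subst e
        rw [if_pos rfl]
        have ha0 : cnt x c0 m = a0 := by
          have u1 := ihc a0 q1
          have u2 : ¬ cnt x c0 m < a0 := by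
            intro hlt
            have u3 := dlt c0 _ _ hlt q1
            have u4 := (ihc (cnt x c0 m) (by omega)).1 (by omega)
            omega
          omega
        rw [ha0]
        refine ⟨by omega, fun a ha => ?_⟩
        rcases Nat.lt_trichotomy a a0 with g | rfl | g
        · have := dlt c0 _ _ g q1; omega
        · omega
        · have := dlt c0 _ _ g ha; omega
      · rw [if_neg e, add_zero]
        refine ⟨w, fun a ha => ?_⟩
        rw [← ihc a ha]
        have : f (a, a + c) ≠ m + 1 := by
          intro h
          exact e (inj _ _ _ _ q1 ha (q2.trans h.symm)).2
        omega
  have hx : InX n N x := by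
    refine ⟨?_, ?_, ?_, ?_⟩
    · intro m hm c
      by_contra hc
      obtain ⟨k1, k2⟩ := key m hm (c+1)
      obtain ⟨k3, k4⟩ := key m hm c
      obtain ⟨t, ht⟩ : ∃ t, cnt x (c+1) m = t + 1 := ⟨cnt x (c+1) m - 1, by omega⟩
      have u1 := (k2 t (by omega)).2 (by omega)
      have u2 := h5 t (t + c) (by rw [shape_iff]; omega) (by rw [shape_iff]; omega)
      rw [show t + (c+1) = t + c + 1 by omega] at u1
      have u3 := (k4 t (by omega)).1 (by omega)
      omega
    · intro m hm c
      by_contra hc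
      obtain ⟨k1, k2⟩ := key m hm (c+1)
      obtain ⟨k3, k4⟩ := key m hm c
      obtain ⟨t, ht⟩ : ∃ t, cnt x c m = t + 2 := ⟨cnt x c m - 2, by omega⟩
      have u1 := (k4 (t+1) (by omega)).2 (by omega)
      have u2 := h6 t (t + c + 1) (by rw [shape_iff]; omega) (by rw [shape_iff]; omega)
      rw [show t + 1 + c = t + c + 1 by omega] at u1
      have u3 := (k2 t (by omega)).1 (by rw [show t + (c + 1) = t + c + 1 by omega]; omega)
      omega
    · intro c
      obtain ⟨k3, k4⟩ := key N le_rfl c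
      by_contra hc
      have hlt : cnt x c N < n - (c+1)/2 := by omega
      have hs : 2 * cnt x c N + c + 2 ≤ 2 * n := by omega
      have := (k4 _ hs).1 (h2 _ (by rw [shape_iff]; omega)).2
      omega
    · intro i hi
      exact if_neg (by omega)
  refine ⟨x, hx, ?_⟩
  funext ⟨a, b⟩
  by_cases hs : a ≤ b ∧ a + b + 2 ≤ 2 * n
  · obtain ⟨c, rfl⟩ : ∃ c, b = a + c := ⟨b - a, by omega⟩
    have hs' : 2 * a + c + 2 ≤ 2 * n := by omega
    obtain ⟨j, hj, e1, e2⟩ := hx.cell hs'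
    rw [fil_of hs' e1 e2]
    have k1 := ((key (j+1) (by omega) c).2 a hs').2 (by rw [cnt_succ, if_pos e1]; omega)
    have k2 := (key j (by omega) c).2 a hs'
    omega
  · rw [fil_off hs, h1]
    rw [shape_iff]; exact hs

end PSB

namespace PSB
variable {n N : ℕ} {x y : ℕ → ℕ}

/-- relabelling: entry `m+1` is the hole -/
def rl (m v : ℕ) : ℕ := if v ≤ m then v else if v = m + 1 then 0 else v - 1

/-- position of the hole -/
def hl (m : ℕ) (x : ℕ → ℕ) : ℕ × ℕ := (cnt x (x m) m, cnt x (x m) m + x m)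

lemma cnt_sw_lt {m i : ℕ} (c : ℕ) (h : i ≤ m) : cnt (sw m x) c i = cnt x c i :=
  cnt_congr (fun j hj => sw_ne x (by omega) (by omega)) c

lemma cnt_sw_ge {m i : ℕ} (c : ℕ) (h : m + 2 ≤ i) : cnt (sw m x) c i = cnt x c i := by
  induction i, h using Nat.le_induction with
  | base =>
    rw [cnt_succ, cnt_succ, cnt_succ, cnt_succ, cnt_sw_lt c le_rfl, sw_left, sw_right]
    omega
  | succ i hi ih =>
    rw [cnt_succ, cnt_succ, ih, sw_ne x (by omega) (by omega)]

lemma swap_fil (hx : InX n N x) {m : ℕ} (hm : m + 1 < N) (h : ¬ near (x m) (x (m+1)))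
    (p : ℕ × ℕ) : rl m (fil n x p) = rl (m+1) (fil n (sw m x) p) := by
  obtain ⟨a, b⟩ := p
  by_cases hs : a ≤ b ∧ a + b + 2 ≤ 2 * n
  · obtain ⟨c, rfl⟩ : ∃ c, b = a + c := ⟨b - a, by omega⟩
    have hs' : 2 * a + c + 2 ≤ 2 * n := by omega
    obtain ⟨i, hi, h1, h2⟩ := hx.cell hs'
    rw [fil_of hs' h1 h2]
    have hne : x m ≠ x (m+1) := by intro e; apply h; unfold near; omega
    rcases Nat.lt_trichotomy i m with g | g | g
    · rw [fil_of (i := i) hs' (by rw [sw_ne x (by omega) (by omega)]; exact h1)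
        (by rw [cnt_sw_lt c (by omega)]; exact h2)]
      unfold rl; rw [if_pos (by omega), if_pos (by omega)]
    · subst g
      rw [fil_of (i := i+1) hs' (by rw [sw_right]; exact h1)
        (by rw [cnt_succ, cnt_sw_lt c le_rfl, sw_left, if_neg (by omega)]; exact h2)]
      unfold rl; rw [if_neg (by omega), if_pos rfl, if_neg (by omega), if_pos rfl]
    · rcases Nat.lt_or_ge (m+1) i with g' | g'
      · rw [fil_of (i := i) hs' (by rw [sw_ne x (by omega) (by omega)]; exact h1)
          (by rw [cnt_sw_ge c (by omega)]; exact h2)]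
        unfold rl
        rw [if_neg (by omega), if_neg (by omega), if_neg (by omega), if_neg (by omega)]
      · obtain rfl : i = m + 1 := by omega
        rw [fil_of (i := m) hs' (by rw [sw_left]; exact h1)
          (by rw [cnt_sw_lt c le_rfl]; rw [cnt_succ, if_neg (by omega)] at h2; exact h2)]
        unfold rl; rw [if_neg (by omega), if_neg (by omega), if_pos (by omega)]; omega
  · rw [fil_off hs, fil_off hs]; simp [rl]

lemma swap_hl {m : ℕ} (h : ¬ near (x m) (x (m+1))) :
    hl (m+1) (sw m x) = hl m x := by
  have hne : x m ≠ x (m+1) := by intro e; apply h; unfold near; omega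
  unfold hl
  rw [sw_right, cnt_succ, sw_left, if_neg (by omega), cnt_sw_lt _ le_rfl]
  rfl

/-- in the near case the next value is adjacent to the hole -/
lemma near_cell (hx : InX n N x) {m : ℕ} (hm : m + 1 < N) (h : near (x m) (x (m+1))) :
    (hl (m+1) x = ((hl m x).1, (hl m x).2 + 1)) ∨ (hl (m+1) x = ((hl m x).1 + 1, (hl m x).2)) := by
  have hne := hx.l1 hm
  unfold near at h
  unfold hl
  dsimp only
  rcases (show x (m+1) = x m + 1 ∨ x m = x (m+1) + 1 by omega) with e | e
  · left
    have a1 := hx.lat1 (m+2) (by omega) (x m)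
    have a2 := hx.lat2 (m+1) (by omega) (x m)
    have b1 : cnt x (x m + 1) (m+1) = cnt x (x m + 1) m := by
      rw [cnt_succ, if_neg (by omega)]; omega
    have b2 : cnt x (x m) (m+1) = cnt x (x m) m + 1 := by
      rw [cnt_succ, if_pos rfl]
    have b3 : cnt x (x m + 1) (m+2) = cnt x (x m + 1) (m+1) + 1 := by
      rw [cnt_succ, if_pos e]
    have b4 : cnt x (x m) (m+2) = cnt x (x m) (m+1) := by
      rw [cnt_succ, if_neg (by omega)]; omega
    rw [e]
    ext <;> dsimp only <;> omega
  · right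
    have a1 := hx.lat1 (m+1) (by omega) (x (m+1))
    have a2 := hx.lat2 (m+2) (by omega) (x (m+1))
    have b1 : cnt x (x (m+1) + 1) (m+1) = cnt x (x (m+1) + 1) m + 1 := by
      rw [cnt_succ, if_pos e]
    have b2 : cnt x (x (m+1)) (m+1) = cnt x (x (m+1)) m := by
      rw [cnt_succ, if_neg (by omega)]; omega
    have b3 : cnt x (x (m+1) + 1) (m+2) = cnt x (x (m+1) + 1) (m+1) := by
      rw [cnt_succ, if_neg (by omega)]; omega
    have b4 : cnt x (x (m+1)) (m+2) = cnt x (x (m+1)) (m+1) + 1 := by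
      rw [cnt_succ, if_pos rfl]
    rw [e]
    ext <;> dsimp only <;> omega

lemma fil_hl (hx : InX n N x) {m : ℕ} (hm : m < N) : fil n x (hl m x) = m + 1 := hx.fil_at hm

lemma fil_hl_iff (hx : InX n N x) {m : ℕ} (p : ℕ × ℕ) (h : fil n x p = m + 1) : p = hl m x := by
  obtain ⟨a, b⟩ := p
  obtain ⟨h1, h2, h3, h4⟩ := hx.fil_pos h
  unfold hl
  ext <;> dsimp only <;> omega

/-- one jeu de taquin step -/
lemma upd (hx : InX n N x) {m : ℕ} (hm : m + 1 < N) :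
    Function.update (Function.update (fun p => rl m (fil n x p)) (hl (m+1) x) 0) (hl m x) (m+1)
      = fun p => rl (m+1) (fil n x p) := by
  funext p
  by_cases h1 : p = hl m x
  · subst h1
    rw [Function.update_self, fil_hl hx (by omega)]
    unfold rl; rw [if_pos (by omega)]
  · rw [Function.update_of_ne h1]
    by_cases h2 : p = hl (m+1) x
    · subst h2
      rw [Function.update_self, fil_hl hx (by omega)]
      unfold rl; rw [if_neg (by omega), if_pos rfl]
    · rw [Function.update_of_ne h2]
      have e1 : fil n x p ≠ m + 1 := fun h => h1 (fil_hl_iff hx p h)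
      have e2 : fil n x p ≠ m + 1 + 1 := fun h => h2 (fil_hl_iff hx p h)
      unfold rl
      split_ifs <;> omega

lemma right_ge (hx : InX n N x) {m : ℕ} (hm : m < N) :
    fil n x ((hl m x).1, (hl m x).2 + 1) = 0 ∨ m + 2 ≤ fil n x ((hl m x).1, (hl m x).2 + 1) := by
  rcases Nat.eq_zero_or_pos (fil n x ((hl m x).1, (hl m x).2 + 1)) with h | h
  · exact Or.inl h
  · right
    have := hx.fil_right (a := (hl m x).1) (b := (hl m x).2) (i := m)
      (j := fil n x ((hl m x).1, (hl m x).2 + 1) - 1) (fil_hl hx hm) (by omega)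
    omega

lemma below_ge (hx : InX n N x) {m : ℕ} (hm : m < N) :
    fil n x ((hl m x).1 + 1, (hl m x).2) = 0 ∨ m + 2 ≤ fil n x ((hl m x).1 + 1, (hl m x).2) := by
  rcases Nat.eq_zero_or_pos (fil n x ((hl m x).1 + 1, (hl m x).2)) with h | h
  · exact Or.inl h
  · right
    have := hx.fil_below (a := (hl m x).1) (b := (hl m x).2) (i := m)
      (j := fil n x ((hl m x).1 + 1, (hl m x).2) - 1) (fil_hl hx hm) (by omega)
    omega

lemma fil_le (hx : InX n N x) (p : ℕ × ℕ) : fil n x p ≤ N := by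
  obtain ⟨a, b⟩ := p
  by_cases hs : a ≤ b ∧ a + b + 2 ≤ 2 * n
  · exact (hx.fil_ne hs).2
  · rw [fil_off hs]; omega

lemma jdt_step (hx : InX n N x) {m : ℕ} (hm : m + 1 < N) (h : near (x m) (x (m+1))) (fuel : ℕ) :
    jdtSlide (fuel+1) (fun p => rl m (fil n x p)) (hl m x) =
      jdtSlide fuel (fun p => rl (m+1) (fil n x p)) (hl (m+1) x) := by
  have hr := right_ge hx (m := m) (by omega)
  have hb := below_ge hx (m := m) (by omega)
  have hu := upd hx hm
  have hf := fil_hl hx hm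
  have hdis : ∀ p q : ℕ × ℕ, fil n x p = m + 2 → fil n x q = m + 2 → p = q := fun p q h1 h2 =>
    (fil_hl_iff hx p h1).trans (fil_hl_iff hx q h2).symm
  rw [jdtSlide]
  rcases near_cell hx hm h with e | e
  · have hd : fil n x ((hl m x).1 + 1, (hl m x).2) ≠ m + 2 := by
      intro h1
      have := hdis _ _ h1 (e ▸ hf)
      simp at this
    have h1 : rl m (fil n x ((hl m x).1, (hl m x).2 + 1)) = m + 1 := by
      rw [← e, hf]; unfold rl; rw [if_neg (by omega), if_neg (by omega)]; omega
    have h2 : rl m (fil n x ((hl m x).1 + 1, (hl m x).2)) = 0 ∨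
        m + 1 < rl m (fil n x ((hl m x).1 + 1, (hl m x).2)) := by
      rcases hb with hb | hb
      · left; rw [hb]; simp [rl]
      · right; unfold rl; rw [if_neg (by omega), if_neg (by omega)]; omega
    rw [if_neg (by omega), if_pos (by omega), h1]
    rw [show ((hl m x).1, (hl m x).2) = hl m x from rfl, ← e, hu]
  · have hd : fil n x ((hl m x).1, (hl m x).2 + 1) ≠ m + 2 := by
      intro h1
      have := hdis _ _ h1 (e ▸ hf)
      simp at this
    have h1 : rl m (fil n x ((hl m x).1 + 1, (hl m x).2)) = m + 1 := by
      rw [← e, hf]; unfold rl; rw [if_neg (by omega), if_neg (by omega)]; omega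
    have h2 : rl m (fil n x ((hl m x).1, (hl m x).2 + 1)) = 0 ∨
        m + 1 < rl m (fil n x ((hl m x).1, (hl m x).2 + 1)) := by
      rcases hr with hb | hb
      · left; rw [hb]; simp [rl]
      · right; unfold rl; rw [if_neg (by omega), if_neg (by omega)]; omega
    rw [if_neg (by omega), if_neg (by omega), h1]
    rw [show ((hl m x).1, (hl m x).2) = hl m x from rfl, ← e, hu]

lemma jdt_all (hx : InX n N x) (d : ℕ) : ∀ m fuel, m + d + 1 = N → d ≤ fuel →
    jdtSlide fuel (fun p => rl m (fil n (pr m x) p)) (hl m (pr m x)) =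
      ((fun p => rl (N-1) (fil n (P N x) p)), hl (N-1) (P N x)) := by
  induction d with
  | zero =>
    intro m fuel hm _
    obtain rfl : m = N - 1 := by omega
    change jdtSlide fuel (fun p => rl (N-1) (fil n (P N x) p)) (hl (N-1) (P N x)) = _
    have hy : InX n N (P N x) := hx.P_mem (by omega)
    cases fuel with
    | zero => rfl
    | succ fuel =>
      rw [jdtSlide]
      rw [if_pos]
      have h1 := fil_le hy ((hl (N-1) (P N x)).1, (hl (N-1) (P N x)).2 + 1)
      have h2 := fil_le hy ((hl (N-1) (P N x)).1 + 1, (hl (N-1) (P N x)).2)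
      rcases right_ge hy (m := N-1) (by omega) with e1 | e1
      · rcases below_ge hy (m := N-1) (by omega) with e2 | e2
        · rw [e1, e2]; simp [rl]
        · omega
      · omega
  | succ d ih =>
    intro m fuel hm hf
    have hy : InX n N (pr m x) := hx.pr_mem (by omega)
    by_cases h : near (pr m x m) (pr m x (m+1))
    · obtain ⟨fuel, rfl⟩ : ∃ f, fuel = f + 1 := ⟨fuel - 1, by omega⟩
      rw [jdt_step hy (by omega) h, ← ih (m+1) fuel (by omega) (by omega)]
      have : pr (m+1) x = pr m x := by
        change tg m (pr m x) = _
        unfold tg; rw [if_pos h]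
      rw [this]
    · rw [← ih (m+1) fuel (by omega) (by omega)]
      have : pr (m+1) x = sw m (pr m x) := by
        change tg m (pr m x) = _
        unfold tg; rw [if_neg h]
      rw [this, swap_hl h]
      congr 1
      funext p
      exact swap_fil hy (by omega) h p

lemma promote_fil (hx : InX n N x) (hN : 0 < N) : promote N (fil n x) = fil n (P N x) := by
  have h0 := jdt_all hx (N-1) 0 N (by omega) (by omega)
  have x0 : x 0 = 0 := by
    by_contra h
    obtain ⟨j, hj, _⟩ := hx.pre hN (by omega)
    omega
  have e1 : (fun p => rl 0 (fil n (pr 0 x) p)) = fun c => fil n x c - 1 := by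
    funext p
    change rl 0 (fil n x p) = _
    unfold rl; split_ifs <;> omega
  have e2 : hl 0 (pr 0 x) = (0, 0) := by
    change hl 0 x = _
    unfold hl
    rw [cnt_zero, x0]
  rw [e1, e2] at h0
  unfold promote
  rw [h0]
  dsimp only
  have hy : InX n N (P N x) := hx.P_mem (by omega)
  funext p
  by_cases h1 : p = hl (N-1) (P N x)
  · subst h1
    rw [Function.update_self, fil_hl hy (by omega)]; omega
  · rw [Function.update_of_ne h1]
    have e1 : fil n (P N x) p ≠ (N - 1) + 1 := fun h => h1 (fil_hl_iff hy p h)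
    have := fil_le hy p
    unfold rl; rw [if_pos (by omega)]

lemma promote_iter (hx : InX n N x) (hN : 0 < N) (i : ℕ) :
    (promote N)^[i] (fil n x) = fil n ((P N)^[i] x) := by
  induction i with
  | zero => rfl
  | succ i ih =>
    rw [Function.iterate_succ_apply', Function.iterate_succ_apply', ih,
      promote_fil (hx.Pi_mem hN i) hN]

lemma rowOf_fil (hx : InX n N x) (hN : 0 < N) : rowOf (fil n x) N = n - 1 - x (N-1) / 2 := by
  have he := hx.last_even (k := N-1) (by omega)
  have h := fil_hl hx (m := N-1) (by omega)
  have ht := hx.tot (x (N-1))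
  have hc : cnt x (x (N-1)) (N-1+1) = _ := cnt_succ x (x (N-1)) (N-1)
  rw [if_pos rfl, show N-1+1 = N by omega, ht] at hc
  have hset : {a | ∃ b, fil n x (a, b) = N} = {n - 1 - x (N-1) / 2} := by
    ext a
    constructor
    · rintro ⟨b, hb⟩
      have := fil_hl_iff hx (m := N-1) (a, b) (by omega)
      unfold hl at this
      have := congrArg Prod.fst this
      dsimp only at this
      show a = _
      omega
    · intro ha
      have ha : a = n - 1 - x (N-1) / 2 := ha
      subst ha
      refine ⟨(hl (N-1) x).2, ?_⟩
      have : n - 1 - x (N-1) / 2 = (hl (N-1) x).1 := by unfold hl; dsimp only; omega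
      rw [this]
      exact h.trans (by omega)
  unfold rowOf
  rw [hset]
  exact csInf_singleton _

/-- letters as elements of `Fin n` -/
def let' (n : ℕ) (hn : 0 < n) (c : ℕ) : Fin n := ⟨n - 1 - c / 2, by omega⟩

lemma phi_fil (hn : 0 < n) (hx : InX n (n^2) x) :
    phiWord n hn (fil n x) = (List.range (n^2)).map (fun i => let' n hn (La (n^2) x i)) := by
  have hN : 0 < n^2 := by positivity
  unfold phiWord
  apply List.map_congr_left
  intro i _
  have hy := hx.Pi_mem hN (i+1)
  rw [Fin.ext_iff]
  change rowOf _ _ % n = n - 1 - La (n^2) x i / 2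
  rw [promote_iter hx hN, rowOf_fil hy hN]
  unfold La
  exact Nat.mod_eq_of_lt (by omega)

lemma phi_rot (hn : 0 < n) (hx : InX n (n^2) x) :
    phiWord n hn (promote (n^2) (fil n x)) = (phiWord n hn (fil n x)).rotate 1 := by
  have hN : 0 < n^2 := by positivity
  rw [promote_fil hx hN, phi_fil hn (hx.P_mem hN), phi_fil hn hx]
  apply List.ext_getElem
  · simp
  · intro i h1 h2
    rw [List.getElem_rotate]
    simp only [List.length_map, List.length_range] at h1
    simp only [List.getElem_map, List.getElem_range, List.length_map, List.length_range]
    congr 1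
    have := La_iter (n^2) x 1 i
    rw [Function.iterate_one] at this
    rw [this]
    rcases Nat.lt_or_ge (i+1) (n^2) with h | h
    · rw [Nat.mod_eq_of_lt h, add_comm]
    · have : i + 1 = n^2 := by omega
      rw [show 1 + i = 0 + n^2 by omega, La_add_N hn rfl hx, this, Nat.mod_self]

end PSB

namespace PSB
open CoxeterSystem
variable {B W : Type*} [Group W] {M : CoxeterMatrix B} (cs : CoxeterSystem M W)

open Classical in
/-- the action on reflections with signs -/
noncomputable def eta (i : B) : Function.End (W × ZMod 2) :=
  fun p => (cs.simple i * p.1 * cs.simple i, p.2 + if p.1 = cs.simple i then 1 else 0)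

open Classical in
lemma eta_pow (i j : B) (k : ℕ) (t : W) (e : ZMod 2) :
    ((eta cs i * eta cs j) ^ k) (t, e) =
      ((cs.simple i * cs.simple j) ^ k * t * (cs.simple j * cs.simple i) ^ k,
        e + ∑ r ∈ Finset.range (2 * k),
          if t = (cs.simple j * cs.simple i) ^ r * cs.simple j then 1 else 0) := by
  induction k with
  | zero => simp; rfl
  | succ k ih =>
    have hinv : ∀ k : ℕ, ((cs.simple i * cs.simple j) ^ k)⁻¹ = (cs.simple j * cs.simple i) ^ k := by
      intro k
      rw [← inv_pow, mul_inv_rev, cs.inv_simple, cs.inv_simple]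
    have hinv' : ∀ k : ℕ, ((cs.simple j * cs.simple i) ^ k)⁻¹ = (cs.simple i * cs.simple j) ^ k := by
      intro k
      rw [← inv_pow, mul_inv_rev, cs.inv_simple, cs.inv_simple]
    have hc : ∀ k : ℕ, cs.simple j * (cs.simple i * cs.simple j) ^ k
        = (cs.simple j * cs.simple i) ^ k * cs.simple j := by
      intro k
      induction k with
      | zero => simp
      | succ k ih => rw [pow_succ', pow_succ']; simp only [mul_assoc]; rw [ih]
    rw [pow_succ']
    change eta cs i (eta cs j (((eta cs i * eta cs j) ^ k) (t, e))) = _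
    rw [ih]
    unfold eta
    dsimp only
    refine Prod.ext ?_ ?_
    · dsimp only
      rw [pow_succ' (cs.simple i * cs.simple j), pow_succ (cs.simple j * cs.simple i)]
      simp only [mul_assoc]
    · dsimp only
      rw [show 2 * (k+1) = 2 * k + 1 + 1 by ring, Finset.sum_range_succ, Finset.sum_range_succ,
        ← add_assoc, ← add_assoc]
      have e1 : ((cs.simple i * cs.simple j) ^ k * t * (cs.simple j * cs.simple i) ^ k = cs.simple j)
          ↔ t = (cs.simple j * cs.simple i) ^ (2 * k) * cs.simple j := by
        rw [← eq_mul_inv_iff_mul_eq, ← eq_inv_mul_iff_mul_eq, hinv, hinv', hc, two_mul, pow_add,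
          mul_assoc]
      have e2 : (cs.simple j * ((cs.simple i * cs.simple j) ^ k * t *
            (cs.simple j * cs.simple i) ^ k) * cs.simple j = cs.simple i)
          ↔ t = (cs.simple j * cs.simple i) ^ (2 * k + 1) * cs.simple j := by
        rw [← eq_mul_inv_iff_mul_eq, ← eq_inv_mul_iff_mul_eq, ← eq_mul_inv_iff_mul_eq,
          ← eq_inv_mul_iff_mul_eq, hinv, hinv', cs.inv_simple]
        have : (cs.simple j * cs.simple i) ^ k *
            (cs.simple j * (cs.simple i * cs.simple j) * (cs.simple i * cs.simple j) ^ k)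
            = (cs.simple j * cs.simple i) ^ (2 * k + 1) * cs.simple j := by
          rw [mul_assoc, ← pow_succ', hc, ← mul_assoc, ← pow_add]
          congr 2; ring
        rw [this]
      rw [if_congr e1 rfl rfl, if_congr e2 rfl rfl]

lemma eta_liftable : M.IsLiftable (eta cs) := by
  classical
  intro i j
  funext p
  obtain ⟨t, e⟩ := p
  rw [eta_pow]
  have h1 : (cs.simple i * cs.simple j) ^ M i j = 1 := cs.simple_mul_simple_pow i j
  have h2 : (cs.simple j * cs.simple i) ^ M i j = 1 := cs.simple_mul_simple_pow' i j
  rw [h1, h2, two_mul, Finset.sum_range_add]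
  have : ∀ r, (cs.simple j * cs.simple i) ^ (M i j + r) = (cs.simple j * cs.simple i) ^ r := by
    intro r; rw [pow_add, h2, one_mul]
  simp only [this]
  rw [CharTwo.add_self_eq_zero]
  simp
  rfl

open Classical in
lemma eta_word (ω : List B) (t : W) (e : ZMod 2) :
    ((ω.map (eta cs)).prod) (t, e) =
      (cs.wordProd ω * t * (cs.wordProd ω)⁻¹, e + ((cs.rightInvSeq ω).count t : ℕ)) := by
  induction ω with
  | nil => simp; rfl
  | cons i ω ih =>
    rw [List.map_cons, List.prod_cons]
    change eta cs i (((ω.map (eta cs)).prod) (t, e)) = _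
    rw [ih]
    unfold eta
    dsimp only
    rw [cs.wordProd_cons]
    refine Prod.ext ?_ ?_
    · simp [mul_assoc]
    · dsimp only
      rw [rightInvSeq, List.count_cons, Nat.cast_add, add_assoc]
      congr 2
      have e1 : (cs.wordProd ω * t * (cs.wordProd ω)⁻¹ = cs.simple i) ↔
          (((cs.wordProd ω)⁻¹ * cs.simple i * cs.wordProd ω == t) = true) := by
        rw [beq_iff_eq, ← eq_mul_inv_iff_mul_eq, ← eq_inv_mul_iff_mul_eq, inv_inv, mul_assoc, eq_comm]
      rw [if_congr e1 rfl rfl]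
      split_ifs <;> simp

open Classical in
lemma count_parity {ω ω' : List B} (h : cs.wordProd ω = cs.wordProd ω') (t : W) :
    (((cs.rightInvSeq ω).count t : ℕ) : ZMod 2) = ((cs.rightInvSeq ω').count t : ℕ) := by
  have hl : ∀ ω : List B, (ω.map (eta cs)).prod = cs.lift ⟨eta cs, eta_liftable cs⟩ (cs.wordProd ω) := by
    intro ω
    induction ω with
    | nil => simp
    | cons i ω ih =>
      rw [List.map_cons, List.prod_cons, ih, cs.wordProd_cons, map_mul, cs.lift_apply_simple]
  have h1 := eta_word cs ω t 0
  have h2 := eta_word cs ω' t 0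
  rw [hl, h, ← hl, h2] at h1
  have := congrArg Prod.snd h1
  simpa using this.symm

/-- exchange condition -/
lemma exchange {w : W} {i : B} (hi : cs.IsRightDescent w i) {ω : List B} (hω : cs.wordProd ω = w) :
    ∃ j < ω.length, w * cs.simple i = cs.wordProd (ω.eraseIdx j) := by
  classical
  obtain ⟨v, hv, ev⟩ := cs.exists_isReduced (w * cs.simple i)
  have e1 : cs.wordProd (v ++ [i]) = w := by
    rw [cs.wordProd_append, ← ev]; simp
  have r1 : cs.IsReduced (v ++ [i]) := by
    unfold CoxeterSystem.IsReduced
    rw [e1, List.length_append, ← hv.eq, ← ev]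
    exact (cs.isRightDescent_iff.mp hi).symm
  have hp := count_parity cs (e1.trans hω.symm) (cs.simple i)
  have hm : cs.simple i ∈ cs.rightInvSeq (v ++ [i]) := by
    have := cs.rightInvSeq_concat v i
    rw [List.concat_eq_append] at this
    rw [this]; simp
  rw [List.count_eq_one_of_mem r1.nodup_rightInvSeq hm] at hp
  have hm' : cs.simple i ∈ cs.rightInvSeq ω := by
    by_contra hc
    rw [List.count_eq_zero_of_not_mem hc] at hp
    simp at hp
  obtain ⟨j, hj, e⟩ := List.getElem_of_mem hm'
  refine ⟨j, by simpa using hj, ?_⟩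
  rw [← cs.wordProd_mul_getD_rightInvSeq, List.getD_eq_getElem _ _ hj, e, hω]

open Classical in
/-- a word whose inversion sequence has no repetition is reduced -/
lemma reduced_of_nodup {ω : List B} (h : (cs.rightInvSeq ω).Nodup) : cs.IsReduced ω := by
  obtain ⟨v, hv, ev⟩ := cs.exists_isReduced (cs.wordProd ω)
  have hs : cs.rightInvSeq ω ⊆ cs.rightInvSeq v := by
    intro t ht
    have hp := count_parity cs ev t
    rw [List.count_eq_one_of_mem h ht] at hp
    by_contra hc
    rw [List.count_eq_zero_of_not_mem hc] at hp
    simp at hp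
  have := (h.subperm hs).length_le
  rw [cs.length_rightInvSeq, cs.length_rightInvSeq] at this
  have h2 := cs.length_wordProd_le ω
  unfold CoxeterSystem.IsReduced
  have := hv.eq
  rw [← ev] at this
  omega

/-- extension lemma -/
lemma extend {u : W} {a : B} (ha : cs.IsRightDescent u a) {ω ν : List B}
    (h : cs.IsReduced (ω ++ ν)) (hu : cs.wordProd (ω ++ ν) = u) (hν : cs.IsReduced (ν ++ [a])) :
    ∃ ω', cs.IsReduced (ω' ++ (ν ++ [a])) ∧ cs.wordProd (ω' ++ (ν ++ [a])) = u := by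
  obtain ⟨j, hj, e⟩ := exchange cs ha hu
  rw [List.length_append] at hj
  have hl := h.eq
  rw [List.length_append] at hl
  rcases Nat.lt_or_ge j ω.length with g | g
  · rw [List.eraseIdx_append_of_lt_length g] at e
    have e2 : cs.wordProd (ω.eraseIdx j ++ (ν ++ [a])) = u := by
      rw [← List.append_assoc, cs.wordProd_append, ← e]; simp
    refine ⟨ω.eraseIdx j, ?_, e2⟩
    unfold CoxeterSystem.IsReduced
    rw [e2, ← hu, hl]
    simp only [List.length_append, List.length_eraseIdx_of_lt g, List.length_singleton]
    omega
  · exfalso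
    rw [List.eraseIdx_append_of_length_le g, ← hu, cs.wordProd_append, cs.wordProd_append,
      mul_assoc] at e
    have e := mul_left_cancel e
    have h1 := hν.eq
    rw [cs.wordProd_append, cs.wordProd_singleton, e] at h1
    have h2 := cs.length_wordProd_le (ν.eraseIdx (j - ω.length))
    rw [List.length_eraseIdx_of_lt (by omega), h1, List.length_append] at h2
    simp only [List.length_singleton] at h2
    omega

lemma alt_reduced {i j : B} {m k : ℕ} (h : cs.IsReduced (alternatingWord i j m)) (hk : k ≤ m) :
    cs.IsReduced (alternatingWord i j k) := by
  induction m, hk using Nat.le_induction with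
  | base => exact h
  | succ m hm ih =>
    apply ih
    rw [alternatingWord_succ'] at h
    exact h.drop 1

/-- an elementary braid move -/
def Bst (M : CoxeterMatrix B) (l l' : List B) : Prop :=
  ∃ l₁ l₂ i j, i ≠ j ∧ l = l₁ ++ alternatingWord i j (M i j) ++ l₂ ∧
    l' = l₁ ++ alternatingWord j i (M i j) ++ l₂

/-- braid equivalence -/
def Br (M : CoxeterMatrix B) : List B → List B → Prop := Relation.ReflTransGen (Bst M)

lemma Bst.app {l l' : List B} (h : Bst M l l') (r : List B) : Bst M (l ++ r) (l' ++ r) := by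
  obtain ⟨l₁, l₂, i, j, h1, h2, h3⟩ := h
  exact ⟨l₁, l₂ ++ r, i, j, h1, by simp [h2], by simp [h3]⟩

lemma Br.app {l l' : List B} (h : Br M l l') (r : List B) : Br M (l ++ r) (l' ++ r) := by
  induction h with
  | refl => exact Relation.ReflTransGen.refl
  | tail _ h ih => exact ih.tail (h.app r)


lemma two_desc (hO : ∀ i j, i ≠ j → cs.IsReduced (alternatingWord i j (M i j)) ∧ M i j ≠ 0)
    {u : W} {p q : B} (hpq : p ≠ q) (hp : cs.IsRightDescent u p)
    (hq : cs.IsRightDescent u q) (k : ℕ) (hk : k ≤ M p q) :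
    (∃ v, cs.IsReduced (v ++ alternatingWord p q k) ∧ cs.wordProd (v ++ alternatingWord p q k) = u) ∧
    (∃ v, cs.IsReduced (v ++ alternatingWord q p k) ∧
      cs.wordProd (v ++ alternatingWord q p k) = u) := by
  induction k with
  | zero =>
    obtain ⟨v, hv, ev⟩ := cs.exists_isReduced u
    simp only [alternatingWord, List.append_nil]
    exact ⟨⟨v, hv, ev.symm⟩, ⟨v, hv, ev.symm⟩⟩
  | succ k ih =>
    obtain ⟨⟨v, h1, h2⟩, ⟨v', h1', h2'⟩⟩ := ih (by omega)
    have r1 := alt_reduced cs (hO p q hpq).1 hk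
    have r2 := alt_reduced cs (hO q p hpq.symm).1 (M.symmetric p q ▸ hk)
    rw [alternatingWord_succ, List.concat_eq_append] at r1 r2
    rw [alternatingWord_succ, alternatingWord_succ, List.concat_eq_append, List.concat_eq_append]
    exact ⟨extend cs hq h1' h2' r1, extend cs hp h1 h2 r2⟩

lemma desc_of_last {u : W} {v : List B} {p : B} (h : cs.IsReduced (v ++ [p]))
    (hu : cs.wordProd (v ++ [p]) = u) : cs.IsRightDescent u p := by
  unfold IsRightDescent
  have h1 := h.eq
  rw [hu, List.length_append, List.length_singleton] at h1
  rw [← hu, cs.wordProd_append, cs.wordProd_singleton, cs.simple_mul_simple_cancel_right]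
  have := cs.length_wordProd_le v
  rw [cs.wordProd_append, cs.wordProd_singleton] at hu
  rw [hu]
  omega

lemma red_init {v r : List B} (h : cs.IsReduced (v ++ r)) : cs.IsReduced v := by
  have := h.take v.length
  simpa using this

/-- Matsumoto's theorem -/
theorem matsumoto (hO : ∀ i j, i ≠ j → cs.IsReduced (alternatingWord i j (M i j)) ∧ M i j ≠ 0)
    (m : ℕ) : ∀ ω ω' : List B, ω.length = m → cs.IsReduced ω → cs.IsReduced ω' →
    cs.wordProd ω = cs.wordProd ω' → Br M ω ω' := by
  induction m with
  | zero =>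
    intro ω ω' h0 h1 h2 h3
    have e := h1.eq
    rw [h3, h2.eq, h0] at e
    rw [List.length_eq_zero_iff] at h0 e
    rw [h0, e]
    exact Relation.ReflTransGen.refl
  | succ m ih =>
    intro ω ω' h0 h1 h2 h3
    have hl := h1.eq
    rw [h3, h2.eq, h0] at hl
    have same : ∀ (v v' : List B) (p : B), (v ++ [p]).length = m + 1 → cs.IsReduced (v ++ [p]) →
        cs.IsReduced (v' ++ [p]) → cs.wordProd (v ++ [p]) = cs.wordProd (v' ++ [p]) →
        Br M (v ++ [p]) (v' ++ [p]) := by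
      intro v v' p g0 g1 g2 g3
      apply Br.app
      apply ih _ _ (by simpa using g0) (red_init cs g1) (red_init cs g2)
      rw [cs.wordProd_append, cs.wordProd_append] at g3
      exact mul_right_cancel g3
    rcases List.eq_nil_or_concat ω with rfl | ⟨v, p, rfl⟩
    · simp at h0
    rcases List.eq_nil_or_concat ω' with rfl | ⟨v', q, rfl⟩
    · simp at hl
    simp only [List.concat_eq_append] at *
    by_cases hpq : p = q
    · subst hpq
      exact same v v' p h0 h1 h2 h3
    · obtain ⟨⟨x, hx1, hx2⟩, ⟨y, hy1, hy2⟩⟩ := two_desc cs hO hpq (desc_of_last cs h1 rfl)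
        (desc_of_last cs h2 h3.symm) (M p q) le_rfl
      have e0 : cs.wordProd (alternatingWord p q (M p q)) = cs.wordProd (alternatingWord q p (M p q)) := by
        have := cs.wordProd_braidWord_eq p q
        unfold braidWord at this
        rwa [M.symmetric q p] at this
      obtain ⟨k, hk⟩ : ∃ k, M p q = k + 1 := ⟨M p q - 1, by have := (hO p q hpq).2; omega⟩
      -- use the same prefix `x`
      have hz2 : cs.wordProd (x ++ alternatingWord q p (M p q)) = cs.wordProd (v ++ [p]) := by
        rw [cs.wordProd_append, ← e0, ← cs.wordProd_append, hx2]
      have hz1 : cs.IsReduced (x ++ alternatingWord q p (M p q)) := by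
        have := hx1.eq
        unfold CoxeterSystem.IsReduced
        rw [hz2, ← hx2, this]
        simp
      have s1 : Br M (v ++ [p]) (x ++ alternatingWord q p (M p q)) := by
        rw [hk, alternatingWord_succ, List.concat_eq_append, ← List.append_assoc] at hz1 hz2 ⊢
        exact same _ _ _ h0 h1 hz1 hz2.symm
      have s2 : Br M (x ++ alternatingWord p q (M p q)) (v' ++ [q]) := by
        have hlen : (x ++ alternatingWord p q (M p q)).length = m + 1 := by
          rw [← hx1.eq, hx2, h1.eq, h0]
        rw [hk, alternatingWord_succ, List.concat_eq_append, ← List.append_assoc] at hx1 hx2 hlen ⊢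
        exact same _ _ _ hlen hx1 h2 (hx2.trans h3)
      refine (s1.tail ⟨x, [], q, p, Ne.symm hpq, ?_, ?_⟩).trans s2
      · rw [M.symmetric q p, List.append_nil]
      · rw [M.symmetric q p, List.append_nil]

lemma nonreduced (hO : ∀ i j, i ≠ j → cs.IsReduced (alternatingWord i j (M i j)) ∧ M i j ≠ 0)
    (ω : List B) (h : ¬ cs.IsReduced ω) :
    ∃ l₁ l₂ i, Br M ω (l₁ ++ [i, i] ++ l₂) := by
  induction ω using List.reverseRecOn with
  | nil => exfalso; apply h; simp [CoxeterSystem.IsReduced]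
  | append_singleton ω i ih =>
    by_cases hr : cs.IsReduced ω
    · have hd : cs.IsRightDescent (cs.wordProd ω) i := by
        by_contra hc
        apply h
        unfold CoxeterSystem.IsReduced
        rw [cs.wordProd_append, cs.wordProd_singleton, cs.not_isRightDescent_iff.mp hc, hr.eq]
        simp
      obtain ⟨v, hv⟩ := extend cs hd (ω := ω) (ν := []) (by simpa using hr) (by simp)
        (by simp [CoxeterSystem.IsReduced])
      have := matsumoto cs hO _ ω (v ++ [i]) rfl hr hv.1 hv.2.symm
      refine ⟨v, [], i, ?_⟩
      have := this.app [i]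
      simpa using this
    · obtain ⟨l₁, l₂, j, hb⟩ := ih hr
      exact ⟨l₁, l₂ ++ [i], j, by simpa using hb.app [i]⟩

lemma longest {u : W} (hu : ∀ a, cs.IsRightDescent u a) (ν : List B) (hν : cs.IsReduced ν) :
    ∃ ω, cs.IsReduced (ω ++ ν) ∧ cs.wordProd (ω ++ ν) = u := by
  induction ν using List.reverseRecOn with
  | nil =>
    obtain ⟨v, hv, ev⟩ := cs.exists_isReduced u
    exact ⟨v, by simpa using hv, by simpa using ev.symm⟩
  | append_singleton ν a ih =>
    obtain ⟨ω, h1, h2⟩ := ih (red_init cs hν)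
    exact extend cs (hu a) h1 h2 hν

lemma eq_longest {u w0 : W} (hu : ∀ a, cs.IsRightDescent u a)
    (hw : ∀ v, cs.length v ≤ cs.length w0) : u = w0 := by
  obtain ⟨ν, hν, e⟩ := cs.exists_isReduced w0
  obtain ⟨ω, h1, h2⟩ := longest cs hu ν hν
  have h3 := h1.eq
  rw [h2, List.length_append, ← hν.eq, ← e] at h3
  have h4 := hw u
  have : ω = [] := List.length_eq_zero_iff.mp (by omega)
  subst this
  rw [← h2, e]; rfl

end PSB

namespace PSB
open CoxeterSystem
section
variable {B W : Type*} [Group W] {M : CoxeterMatrix B} (cs : CoxeterSystem M W)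

lemma ris_alt (i j : B) (m : ℕ) : cs.rightInvSeq (alternatingWord i j m) =
    ((List.range m).map (fun k => cs.simple j * (cs.simple i * cs.simple j) ^ k)).reverse := by
  have hinv : ∀ k : ℕ, ((cs.simple i * cs.simple j) ^ k)⁻¹ = (cs.simple j * cs.simple i) ^ k := by
    intro k
    rw [← inv_pow, mul_inv_rev, cs.inv_simple, cs.inv_simple]
  have hc : ∀ k : ℕ, (cs.simple j * cs.simple i) ^ k * cs.simple j =
      cs.simple j * (cs.simple i * cs.simple j) ^ k := by
    intro k
    induction k with
    | zero => simp
    | succ k ih => rw [pow_succ', pow_succ']; simp only [mul_assoc]; rw [ih]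
  induction m with
  | zero => simp [alternatingWord]
  | succ m ih =>
    rw [alternatingWord_succ', rightInvSeq, ih, List.range_succ, List.map_append, List.reverse_append,
      prod_alternatingWord_eq_mul_pow]
    congr 1
    by_cases h : Even m
    · obtain ⟨r, rfl⟩ := h
      have h1 : (r + r) / 2 = r := by omega
      rw [if_pos ⟨r, rfl⟩, if_pos ⟨r, rfl⟩, h1, one_mul, hinv, hc, mul_assoc, ← pow_add]
    · have h' : ∃ r, m = 2 * r + 1 := Nat.not_even_iff_odd.mp h
      obtain ⟨r, hr⟩ := h'
      have h1 : m / 2 = r := by omega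
      rw [if_neg h, if_neg h, h1, mul_inv_rev, hinv, cs.inv_simple, hc]
      have : cs.simple j * (cs.simple i * cs.simple j) ^ r * cs.simple i *
          (cs.simple j * (cs.simple i * cs.simple j) ^ r) =
          cs.simple j * ((cs.simple i * cs.simple j) ^ r * ((cs.simple i * cs.simple j) *
            (cs.simple i * cs.simple j) ^ r)) := by simp only [mul_assoc]
      rw [this, ← pow_succ', ← pow_add, hr, show r + (r + 1) = 2 * r + 1 by ring]

lemma alt_red {i j : B} (h : orderOf (cs.simple i * cs.simple j) = M i j) :
    cs.IsReduced (alternatingWord i j (M i j)) := by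
  apply reduced_of_nodup
  rw [ris_alt, List.nodup_reverse]
  apply List.Nodup.map_on _ List.nodup_range
  intro k hk l hl e
  have e := mul_left_cancel e
  rw [List.mem_range] at hk hl
  exact pow_injOn_Iio_orderOf (by rw [h]; exact hk) (by rw [h]; exact hl) e
end

/-- generators of the signed permutation group acting on the integers -/
def sg (k : ℤ) : Function.End ℤ := fun z =>
  if z = k then k + 1 else if z = k + 1 then k else if z = -k then 1 - k
    else if z = 1 - k then -k else z

lemma sg_sq (k : ℤ) : sg k * sg k = 1 := by
  funext z
  change sg k (sg k z) = z
  unfold sg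
  grind

lemma sg_comm (k l : ℤ) (hk : 0 ≤ k) (h : k + 2 ≤ l) : sg k * sg l = sg l * sg k := by
  funext z
  change sg k (sg l z) = sg l (sg k z)
  have key : ∀ k l : ℤ, 0 ≤ k → 0 ≤ l → (k + 2 ≤ l ∨ l + 2 ≤ k) →
      (z = k ∨ z = k + 1 ∨ z = -k ∨ z = 1 - k) → sg k (sg l z) = sg l (sg k z) := by
    intro k l hk hl h hz
    have e1 : sg l z = z := by unfold sg; grind
    have e2 : sg l (sg k z) = sg k z := by unfold sg; grind
    rw [e1, e2]
  by_cases h1 : z = k ∨ z = k + 1 ∨ z = -k ∨ z = 1 - k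
  · exact key k l hk (by omega) (by omega) h1
  by_cases h2 : z = l ∨ z = l + 1 ∨ z = -l ∨ z = 1 - l
  · exact (key l k (by omega) hk (by omega) h2).symm
  have e1 : sg k z = z := by unfold sg; grind
  have e2 : sg l z = z := by unfold sg; grind
  rw [e1, e2, e1]

lemma sg_braid (k : ℤ) (hk : 1 ≤ k) : sg k * (sg (k+1) * sg k) = sg (k+1) * (sg k * sg (k+1)) := by
  funext z
  change sg k (sg (k+1) (sg k z)) = sg (k+1) (sg k (sg (k+1) z))
  have a1 : sg k k = k + 1 := by unfold sg; grind
  have a2 : sg k (k + 1) = k := by unfold sg; grind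
  have a3 : sg k (k + 2) = k + 2 := by unfold sg; grind
  have a4 : sg k (-k) = 1 - k := by unfold sg; grind
  have a5 : sg k (1 - k) = -k := by unfold sg; grind
  have a6 : sg k (-k - 1) = -k - 1 := by unfold sg; grind
  have b1 : sg (k + 1) k = k := by unfold sg; grind
  have b2 : sg (k + 1) (k + 1) = k + 2 := by unfold sg; grind
  have b3 : sg (k + 1) (k + 2) = k + 1 := by unfold sg; grind
  have b4 : sg (k + 1) (-k) = -k - 1 := by unfold sg; grind
  have b5 : sg (k + 1) (1 - k) = 1 - k := by unfold sg; grind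
  have b6 : sg (k + 1) (-k - 1) = -k := by unfold sg; grind
  by_cases h : z = k ∨ z = k + 1 ∨ z = k + 2 ∨ z = -k ∨ z = 1 - k ∨ z = -k - 1
  · rcases h with rfl | rfl | rfl | rfl | rfl | rfl
    · rw [a1, b2, a3, b1, a1, b2]
    · rw [a2, b1, a1, b2, a3, b3]
    · rw [a3, b3, a2, b1]
    · rw [a4, b5, a5, b4, a6, b6]
    · rw [a5, b4, a6, b5, a5, b4]
    · rw [a6, b6, a4, b5]
  · have c1 : sg k z = z := by unfold sg; grind
    have c2 : sg (k + 1) z = z := by unfold sg; grind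
    rw [c1, c2, c1, c2]

lemma sg_braid4 : sg 0 * (sg 1 * (sg 0 * sg 1)) = sg 1 * (sg 0 * (sg 1 * sg 0)) := by
  funext z
  change sg 0 (sg 1 (sg 0 (sg 1 z))) = sg 1 (sg 0 (sg 1 (sg 0 z)))
  by_cases h : z = -1 ∨ z = 0 ∨ z = 1 ∨ z = 2
  · rcases h with rfl | rfl | rfl | rfl <;> decide
  · have h0 : sg 0 z = z := by unfold sg; grind
    have h1 : sg 1 z = z := by unfold sg; grind
    simp [h0, h1]

lemma sg_ne {k l : ℤ} (hk : 0 ≤ k) (h : k < l) : sg k ≠ sg l := by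
  intro e
  have := congrFun e k
  unfold sg at this
  grind

lemma sg_ne4 : sg 0 * (sg 1 * (sg 0 * sg 1)) ≠ 1 := by
  intro e
  have := congrFun e (0 : ℤ)
  change sg 0 (sg 1 (sg 0 (sg 1 0))) = 0 at this
  revert this
  decide

section
variable {G : Type*} [Monoid G] {a b : G}
lemma mon2 (ha : a * a = 1) (hb : b * b = 1) (h : a * b = b * a) : (a * b) ^ 2 = 1 := by
  rw [pow_two]; nth_rw 2 [h]
  rw [mul_assoc, ← mul_assoc b b a, hb, one_mul, ha]
lemma mon3 (ha : a * a = 1) (hb : b * b = 1) (h : a * (b * a) = b * (a * b)) :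
    (a * b) ^ 3 = 1 := by
  have : (a * b) ^ 3 = (a * (b * a)) * (b * (a * b)) := by
    rw [pow_succ, pow_two]; simp only [mul_assoc]
  rw [this, ← h]
  simp only [mul_assoc]
  rw [← mul_assoc a a, ha, one_mul, ← mul_assoc b b, hb, one_mul, ha]
lemma mon4 (ha : a * a = 1) (hb : b * b = 1) (h : a * (b * (a * b)) = b * (a * (b * a))) :
    (a * b) ^ 4 = 1 := by
  have : (a * b) ^ 4 = (a * (b * (a * b))) * (a * (b * (a * b))) := by
    rw [pow_succ, pow_succ, pow_two]; simp only [mul_assoc]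
  rw [this]
  nth_rw 2 [h]
  simp only [mul_assoc]
  rw [← mul_assoc b b, hb, one_mul, ← mul_assoc a a, ha, one_mul, ← mul_assoc b b, hb, one_mul, ha]
end

lemma B_apply (n : ℕ) (i j : Fin n) : (CoxeterMatrix.B n) i j =
    if i = j then 1
      else (if (i : ℕ) = n - 1 ∧ (j : ℕ) = n - 2 ∨ (j : ℕ) = n - 1 ∧ (i : ℕ) = n - 2 then 4
        else (if (j : ℕ) + 1 = i ∨ (i : ℕ) + 1 = j then 3 else 2)) := rfl

/-- the generators in the model -/
def gB (n : ℕ) (i : Fin n) : Function.End ℤ := sg ((n : ℤ) - 1 - (i : ℕ))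

lemma gB_liftable (n : ℕ) : (CoxeterMatrix.B n).IsLiftable (gB n) := by
  intro i j
  have hi := i.isLt
  have hj := j.isLt
  rw [B_apply]
  unfold gB
  split_ifs with h1 h2 h3
  · subst h1; rw [pow_one, sg_sq]
  · have h1 : (i : ℕ) ≠ j := fun e => h1 (Fin.ext e)
    rcases h2 with ⟨h2, h3⟩ | ⟨h2, h3⟩
    · rw [show (n : ℤ) - 1 - (i : ℕ) = 0 by omega, show (n : ℤ) - 1 - (j : ℕ) = 1 by omega]
      exact mon4 (sg_sq _) (sg_sq _) sg_braid4
    · rw [show (n : ℤ) - 1 - (i : ℕ) = 1 by omega, show (n : ℤ) - 1 - (j : ℕ) = 0 by omega]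
      exact mon4 (sg_sq _) (sg_sq _) sg_braid4.symm
  · rcases h3 with h3 | h3
    · rw [show (n : ℤ) - 1 - (j : ℕ) = (n : ℤ) - 1 - (i : ℕ) + 1 by omega]
      exact mon3 (sg_sq _) (sg_sq _) (sg_braid _ (by omega))
    · rw [show (n : ℤ) - 1 - (i : ℕ) = (n : ℤ) - 1 - (j : ℕ) + 1 by omega]
      exact mon3 (sg_sq _) (sg_sq _) (sg_braid _ (by omega)).symm
  · have h1 : (i : ℕ) ≠ j := fun e => h1 (Fin.ext e)
    rcases Nat.lt_or_ge (i : ℕ) j with g | g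
    · exact mon2 (sg_sq _) (sg_sq _) (sg_comm _ _ (by omega) (by omega)).symm
    · exact mon2 (sg_sq _) (sg_sq _) (sg_comm _ _ (by omega) (by omega))

section
variable {W : Type*} [Group W] {n : ℕ} (cs : CoxeterSystem (CoxeterMatrix.B n) W)

lemma simple_ne {i j : Fin n} (h : i ≠ j) : cs.simple i * cs.simple j ≠ 1 := by
  intro e
  have h1 : (i : ℕ) ≠ j := fun e => h (Fin.ext e)
  have hi := i.isLt
  have hj := j.isLt
  have e2 : cs.simple i = cs.simple j := by
    rw [← cs.inv_simple j]; exact eq_inv_of_mul_eq_one_left e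
  have e3 : gB n i = gB n j := by
    rw [← cs.lift_apply_simple (gB_liftable n), e2, cs.lift_apply_simple]
  unfold gB at e3
  rcases Nat.lt_or_ge (i : ℕ) j with g | g
  · exact sg_ne (by omega) (by omega) e3.symm
  · exact sg_ne (by omega) (by omega) e3

lemma simple_ne4 {i j : Fin n} (h : i ≠ j)
    (h2 : (i : ℕ) = n - 1 ∧ (j : ℕ) = n - 2 ∨ (j : ℕ) = n - 1 ∧ (i : ℕ) = n - 2) :
    ¬ (cs.simple i * cs.simple j) ^ 2 = 1 := by
  intro e
  have h1 : (i : ℕ) ≠ j := fun e => h (Fin.ext e)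
  have hi := i.isLt
  have hj := j.isLt
  have e3 : (gB n i * gB n j) ^ 2 = 1 := by
    rw [← cs.lift_apply_simple (gB_liftable n), ← cs.lift_apply_simple (gB_liftable n) j,
      ← map_mul, ← map_pow, e, map_one]
  rw [pow_two, mul_assoc] at e3
  unfold gB at e3
  rcases h2 with ⟨h2, h3⟩ | ⟨h2, h3⟩
  · rw [show (n : ℤ) - 1 - (i : ℕ) = 0 by omega, show (n : ℤ) - 1 - (j : ℕ) = 1 by omega] at e3
    exact sg_ne4 e3
  · rw [show (n : ℤ) - 1 - (i : ℕ) = 1 by omega, show (n : ℤ) - 1 - (j : ℕ) = 0 by omega] at e3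
    exact sg_ne4 (sg_braid4.trans e3)

lemma hO_B (i j : Fin n) (h : i ≠ j) :
    cs.IsReduced (alternatingWord i j ((CoxeterMatrix.B n) i j)) ∧ (CoxeterMatrix.B n) i j ≠ 0 := by
  have hp : (cs.simple i * cs.simple j) ^ (CoxeterMatrix.B n) i j = 1 := cs.simple_mul_simple_pow i j
  constructor
  · apply alt_red
    rw [B_apply, if_neg h] at hp ⊢
    split_ifs at hp ⊢ with h2 h3
    · exact orderOf_eq_prime_pow (p := 2) (n := 1) (simple_ne4 cs h h2) hp
    · exact orderOf_eq_prime hp (simple_ne cs h)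
    · exact orderOf_eq_prime hp (simple_ne cs h)
  · rw [B_apply]; split_ifs <;> simp
end

end PSB

namespace PSB
open CoxeterSystem

lemma seg_get {α : Type*} {g : ℕ → α} {N : ℕ} {l₁ A l₂ : List α}
    (h : (List.range N).map g = l₁ ++ A ++ l₂) :
    l₁.length + A.length + l₂.length = N ∧
    ∀ t (ht : t < A.length), g (l₁.length + t) = A[t] := by
  have hl := congrArg List.length h
  simp only [List.length_map, List.length_range, List.length_append] at hl
  refine ⟨hl.symm, ?_⟩
  intro t ht
  have h1 : ((List.range N).map g)[l₁.length + t]? = some (g (l₁.length + t)) := by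
    rw [List.getElem?_map, List.getElem?_range (by omega)]; rfl
  rw [h, List.append_assoc, List.getElem?_append_right (by omega), Nat.add_sub_cancel_left,
    List.getElem?_append_left ht, List.getElem?_eq_getElem ht] at h1
  exact (Option.some.inj h1).symm

lemma seg_set {α : Type*} {g g' : ℕ → α} {N : ℕ} {l₁ A A' l₂ : List α}
    (h : (List.range N).map g = l₁ ++ A ++ l₂) (hA : A.length = A'.length)
    (h1 : ∀ t (ht : t < A'.length), g' (l₁.length + t) = A'[t])
    (h2 : ∀ i < N, (i < l₁.length ∨ l₁.length + A.length ≤ i) → g' i = g i) :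
    (List.range N).map g' = l₁ ++ A' ++ l₂ := by
  have hl := (seg_get h).1
  apply List.ext_getElem
  · simp; omega
  · intro i hi hi'
    have hiN : i < N := by simpa using hi
    have e0 : ((List.range N).map g')[i] = g' i := by simp
    have e1 : ((List.range N).map g)[i]'(by simpa using hiN) = g i := by simp
    rw [e0]
    rcases Nat.lt_or_ge i l₁.length with c | c
    · rw [h2 i hiN (Or.inl c), ← e1]
      simp only [h]
      rw [List.getElem_append_left (by simp; omega), List.getElem_append_left c,
        List.getElem_append_left (by simp; omega), List.getElem_append_left c]
    · rcases Nat.lt_or_ge i (l₁.length + A.length) with c' | c'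
      · obtain ⟨t, rfl⟩ : ∃ t, i = l₁.length + t := ⟨i - l₁.length, by omega⟩
        rw [h1 t (by omega), List.getElem_append_left (by simp; omega),
          List.getElem_append_right (by omega)]
        simp
      · rw [h2 i hiN (Or.inr c'), ← e1]
        simp only [h]
        rw [List.getElem_append_right (by simp; omega), List.getElem_append_right (by simp; omega)]
        simp [hA]

/-- the word of a tableau -/
def Wd (n : ℕ) (hn : 0 < n) (x : ℕ → ℕ) : List (Fin n) :=
  (List.range (n^2)).map (fun i => let' n hn (La (n^2) x i))

variable {n : ℕ} (hn : 0 < n) {x : ℕ → ℕ}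

lemma let_val (c : ℕ) : (let' n hn c : ℕ) = n - 1 - c / 2 := rfl

/-- a letter as a content -/
lemma let_eq {c : ℕ} {i : Fin n} (h : let' n hn c = i) (h1 : c % 2 = 0) (h2 : c + 2 ≤ 2 * n) :
    c = 2 * (n - 1 - i) := by
  rw [← h, let_val]; omega

lemma let_of {c : ℕ} {i : Fin n} (h : c = 2 * (n - 1 - i)) : let' n hn c = i := by
  rw [Fin.ext_iff, let_val]; have := i.isLt; omega

lemma sq_ge (h : 2 ≤ n) : 4 ≤ n^2 := by nlinarith

lemma Wd_step (hx : InX n (n^2) x) {l : List (Fin n)} (h : Bst (CoxeterMatrix.B n) (Wd n hn x) l) :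
    ∃ x', InX n (n^2) x' ∧ Wd n hn x' = l := by
  obtain ⟨l₁, l₂, i, j, hij, h1, rfl⟩ := h
  have hij' : (i : ℕ) ≠ j := fun e => hij (Fin.ext e)
  have hi := i.isLt
  have hj := j.isLt
  have h4 : 4 ≤ n^2 := sq_ge (by omega)
  obtain ⟨hl, hg⟩ := seg_get h1
  have hev := La_even hn rfl hx
  have key : ∀ t (ht : t < (alternatingWord i j ((CoxeterMatrix.B n) i j)).length),
      La (n^2) x (l₁.length + t) =
        2 * (n - 1 - ((alternatingWord i j ((CoxeterMatrix.B n) i j))[t] : Fin n)) :=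
    fun t ht => let_eq hn (hg t ht) (hev _).1 (hev _).2
  rw [length_alternatingWord] at hl
  have fin : ∀ x', InX n (n^2) x' →
      (∀ t (ht : t < (alternatingWord j i ((CoxeterMatrix.B n) i j)).length),
        La (n^2) x' (l₁.length + t) =
          2 * (n - 1 - ((alternatingWord j i ((CoxeterMatrix.B n) i j))[t] : Fin n))) →
      (∀ i' < n^2, (i' < l₁.length ∨ l₁.length + (CoxeterMatrix.B n) i j ≤ i') →
        La (n^2) x' i' = La (n^2) x i') →
      ∃ x', InX n (n^2) x' ∧
        Wd n hn x' = l₁ ++ alternatingWord j i ((CoxeterMatrix.B n) i j) ++ l₂ := by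
    intro x' hx' g1 g2
    refine ⟨x', hx', seg_set h1 (by simp) (fun t ht => let_of hn (g1 t ht)) ?_⟩
    intro i' hi' hc
    rw [length_alternatingWord] at hc
    rw [g2 i' hi' hc]
  rw [B_apply, if_neg hij] at hl key fin ⊢
  split_ifs at hl key fin ⊢ with c1 c2
  · have ea : ∀ i j : Fin n, alternatingWord i j 4 = [i, j, i, j] := fun _ _ => rfl
    simp only [ea] at key fin ⊢
    have k0 := key 0 (by simp)
    have k1 := key 1 (by simp)
    have k2 := key 2 (by simp)
    have k3 := key 3 (by simp)
    simp only [List.getElem_cons_zero, List.getElem_cons_succ, Nat.add_zero] at k0 k1 k2 k3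
    obtain ⟨x', hx', e0, e1, e2, e3, e4⟩ := M4 hn rfl hx h4 (j := l₁.length) (by omega) (by omega)
    refine fin x' hx' ?_ ?_
    · intro t ht
      have ht' : t < 4 := ht
      interval_cases t <;>
        simp only [List.getElem_cons_zero, List.getElem_cons_succ, Nat.add_zero] <;> omega
    · intro i' hi' hc
      exact e4 i' hi' (by omega) (by omega) (by omega) (by omega)
  · have ea : ∀ i j : Fin n, alternatingWord i j 3 = [j, i, j] := fun _ _ => rfl
    simp only [ea] at key fin ⊢
    have k0 := key 0 (by simp)
    have k1 := key 1 (by simp)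
    have k2 := key 2 (by simp)
    simp only [List.getElem_cons_zero, List.getElem_cons_succ, Nat.add_zero] at k0 k1 k2
    obtain ⟨x', hx', e0, e1, e2, e4⟩ := M3 hn rfl hx h4 (j := l₁.length) (by omega) (by omega)
      (by omega)
    refine fin x' hx' ?_ ?_
    · intro t ht
      have ht' : t < 3 := ht
      interval_cases t <;>
        simp only [List.getElem_cons_zero, List.getElem_cons_succ, Nat.add_zero] <;> omega
    · intro i' hi' hc
      exact e4 i' hi' (by omega) (by omega) (by omega)
  · have ea : ∀ i j : Fin n, alternatingWord i j 2 = [i, j] := fun _ _ => rfl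
    simp only [ea] at key fin ⊢
    have k0 := key 0 (by simp)
    have k1 := key 1 (by simp)
    simp only [List.getElem_cons_zero, List.getElem_cons_succ, Nat.add_zero] at k0 k1
    obtain ⟨x', hx', e0, e1, e4⟩ := M2 hn rfl hx h4 (j := l₁.length) (by omega) (by omega)
    refine fin x' hx' ?_ ?_
    · intro t ht
      have ht' : t < 2 := ht
      interval_cases t <;>
        simp only [List.getElem_cons_zero, List.getElem_cons_succ, Nat.add_zero] <;> omega
    · intro i' hi' hc
      exact e4 i' hi' (by omega) (by omega)

lemma Wd_br (hx : InX n (n^2) x) {l : List (Fin n)} (h : Br (CoxeterMatrix.B n) (Wd n hn x) l) :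
    ∃ x', InX n (n^2) x' ∧ Wd n hn x' = l := by
  unfold Br at h
  induction h with
  | refl => exact ⟨x, hx, rfl⟩
  | tail _ h ih =>
    obtain ⟨x', hx', rfl⟩ := ih
    exact Wd_step hn hx' h

lemma Wd_red {W : Type*} [Group W] (h2 : 2 ≤ n) (cs : CoxeterSystem (CoxeterMatrix.B n) W)
    (hx : InX n (n^2) x) : cs.IsReduced (Wd n hn x) := by
  by_contra hr
  obtain ⟨l₁, l₂, i, hb⟩ := nonreduced cs (hO_B cs) _ hr
  obtain ⟨x', hx', e⟩ := Wd_br hn hx hb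
  obtain ⟨hl, hg⟩ := seg_get e
  have hev := La_even hn rfl hx'
  have k0 := let_eq hn (hg 0 (by simp)) (hev _).1 (hev _).2
  have k1 := let_eq hn (hg 1 (by simp)) (hev _).1 (hev _).2
  exact La_adj hn rfl hx' (sq_ge h2) l₁.length (by
    simp only [List.getElem_cons_zero, List.getElem_cons_succ, Nat.add_zero] at k0 k1; omega)

lemma range_split {α : Type*} (g : ℕ → α) {N p m : ℕ} (h : p + m ≤ N) :
    (List.range N).map g = (List.range p).map g ++ (List.range m).map (fun t => g (p + t)) ++
      (List.range (N - (p + m))).map (fun t => g (p + m + t)) := by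
  obtain ⟨q, rfl⟩ := Nat.exists_eq_add_of_le h
  rw [Nat.add_sub_cancel_left, List.range_add, List.range_add]
  simp [List.map_append, List.map_map, Function.comp_def]

lemma Bst_prod {B W : Type*} [Group W] {M : CoxeterMatrix B} (cs : CoxeterSystem M W)
    {l l' : List B} (h : Bst M l l') : cs.wordProd l = cs.wordProd l' := by
  obtain ⟨l₁, l₂, i, j, hij, rfl, rfl⟩ := h
  have := cs.wordProd_braidWord_eq i j
  unfold braidWord at this
  rw [M.symmetric j i] at this
  simp only [cs.wordProd_append, this]

/-- a braid move on a window -/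
lemma Bst_win {B : Type*} {M : CoxeterMatrix B} {g g' : ℕ → B} {N p m : ℕ} (h : p + m ≤ N)
    (ho : ∀ i < N, (i < p ∨ p + m ≤ i) → g' i = g i) {i j : B} (hij : i ≠ j) (hm : M i j = m)
    (h1 : (List.range m).map (fun t => g (p + t)) = alternatingWord i j m)
    (h2 : (List.range m).map (fun t => g' (p + t)) = alternatingWord j i m) :
    Bst M ((List.range N).map g) ((List.range N).map g') := by
  refine ⟨(List.range p).map g, (List.range (N - (p + m))).map (fun t => g (p + m + t)), i, j,
    hij, ?_, ?_⟩
  · rw [hm, ← h1]; exact range_split g h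
  · rw [hm, ← h2, range_split g' h]
    congr 1
    · congr 1
      apply List.map_congr_left
      intro a ha
      have := List.mem_range.1 ha
      exact ho a (by omega) (Or.inl this)
    · apply List.map_congr_left
      intro a ha
      have := List.mem_range.1 ha
      exact ho _ (by omega) (Or.inr (by omega))
end PSB

namespace PSB
open CoxeterSystem

variable {n : ℕ} (hn : 0 < n) {x : ℕ → ℕ}

lemma win2 {y y' : ℕ → ℕ} {N p : ℕ} (hp : p + 2 ≤ N)
    (hb : ∀ i, y i % 2 = 0 ∧ y i + 2 ≤ 2 * n)
    (ho : ∀ i < N, i ≠ p → i ≠ p + 1 → y' i = y i) (e0 : y' p = y (p + 1)) (e1 : y' (p + 1) = y p)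
    (hd : y p + 4 ≤ y (p + 1) ∨ y (p + 1) + 4 ≤ y p) :
    Bst (CoxeterMatrix.B n) ((List.range N).map (fun i => let' n hn (y i)))
      ((List.range N).map (fun i => let' n hn (y' i))) := by
  have b0 := hb p
  have b1 := hb (p + 1)
  have hne : let' n hn (y p) ≠ let' n hn (y (p + 1)) := by
    rw [Ne, Fin.ext_iff, let_val, let_val]; omega
  refine Bst_win (m := 2) hp ?_ (i := let' n hn (y p)) (j := let' n hn (y (p + 1))) hne ?_ ?_ ?_
  · intro i hi hc
    show let' n hn (y' i) = let' n hn (y i)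
    rw [ho i hi (by omega) (by omega)]
  · rw [B_apply, if_neg hne, if_neg, if_neg] <;> rw [let_val, let_val] <;> omega
  · rfl
  · show [let' n hn (y' p), let' n hn (y' (p + 1))] = [let' n hn (y (p + 1)), let' n hn (y p)]
    rw [e0, e1]

lemma win3 {y y' : ℕ → ℕ} {N p : ℕ} (hp : p + 3 ≤ N)
    (hb : ∀ i, y i % 2 = 0 ∧ y i + 2 ≤ 2 * n)
    (ho : ∀ i < N, i ≠ p → i ≠ p + 1 → i ≠ p + 2 → y' i = y i)
    (h2 : y (p + 2) = y p)
    (e0 : y' p = y (p + 1)) (e1 : y' (p + 1) = y p) (e2 : y' (p + 2) = y (p + 1))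
    (hd : (y p + 2 = y (p + 1) ∧ 1 ≤ y p) ∨ (y (p + 1) + 2 = y p ∧ 1 ≤ y (p + 1))) :
    Bst (CoxeterMatrix.B n) ((List.range N).map (fun i => let' n hn (y i)))
      ((List.range N).map (fun i => let' n hn (y' i))) := by
  have b0 := hb p
  have b1 := hb (p + 1)
  have hne : let' n hn (y (p + 1)) ≠ let' n hn (y p) := by
    rw [Ne, Fin.ext_iff, let_val, let_val]; omega
  refine Bst_win (m := 3) hp ?_ (i := let' n hn (y (p + 1))) (j := let' n hn (y p)) hne ?_ ?_ ?_
  · intro i hi hc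
    show let' n hn (y' i) = let' n hn (y i)
    rw [ho i hi (by omega) (by omega) (by omega)]
  · rw [B_apply, if_neg hne, if_neg, if_pos] <;> rw [let_val, let_val] <;> omega
  · show [let' n hn (y p), let' n hn (y (p + 1)), let' n hn (y (p + 2))] =
      [let' n hn (y p), let' n hn (y (p + 1)), let' n hn (y p)]
    rw [h2]
  · show [let' n hn (y' p), let' n hn (y' (p + 1)), let' n hn (y' (p + 2))] =
      [let' n hn (y (p + 1)), let' n hn (y p), let' n hn (y (p + 1))]
    rw [e0, e1, e2]

lemma win4 {y y' : ℕ → ℕ} {N p : ℕ} (hp : p + 4 ≤ N)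
    (hb : ∀ i, y i % 2 = 0 ∧ y i + 2 ≤ 2 * n)
    (ho : ∀ i < N, i ≠ p → i ≠ p + 1 → i ≠ p + 2 → i ≠ p + 3 → y' i = y i)
    (h2 : y (p + 2) = y p) (h3 : y (p + 3) = y (p + 1))
    (e0 : y' p = y (p + 1)) (e1 : y' (p + 1) = y p) (e2 : y' (p + 2) = y (p + 1))
    (e3 : y' (p + 3) = y p)
    (hd : (y p = 0 ∧ y (p + 1) = 2) ∨ (y p = 2 ∧ y (p + 1) = 0)) :
    Bst (CoxeterMatrix.B n) ((List.range N).map (fun i => let' n hn (y i)))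
      ((List.range N).map (fun i => let' n hn (y' i))) := by
  have b0 := hb p
  have b1 := hb (p + 1)
  have hne : let' n hn (y p) ≠ let' n hn (y (p + 1)) := by
    rw [Ne, Fin.ext_iff, let_val, let_val]; omega
  refine Bst_win (m := 4) hp ?_ (i := let' n hn (y p)) (j := let' n hn (y (p + 1))) hne ?_ ?_ ?_
  · intro i hi hc
    show let' n hn (y' i) = let' n hn (y i)
    rw [ho i hi (by omega) (by omega) (by omega) (by omega)]
  · rw [B_apply, if_neg hne, if_pos]
    rw [let_val, let_val]; omega
  · show [let' n hn (y p), let' n hn (y (p + 1)), let' n hn (y (p + 2)), let' n hn (y (p + 3))] =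
      [let' n hn (y p), let' n hn (y (p + 1)), let' n hn (y p), let' n hn (y (p + 1))]
    rw [h2, h3]
  · show [let' n hn (y' p), let' n hn (y' (p + 1)), let' n hn (y' (p + 2)),
        let' n hn (y' (p + 3))] =
      [let' n hn (y (p + 1)), let' n hn (y p), let' n hn (y (p + 1)), let' n hn (y p)]
    rw [e0, e1, e2, e3]

lemma wst_Bst {y : ℕ → ℕ} {N k : ℕ} (hk : k + 4 ≤ N)
    (hb : ∀ i, y i % 2 = 0 ∧ y i + 2 ≤ 2 * n) (ha : ∀ i, y i ≠ y (i + 1)) :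
    wst k y = y ∨
    Bst (CoxeterMatrix.B n) ((List.range N).map (fun i => let' n hn (y i)))
      ((List.range N).map (fun i => let' n hn (wst k y i))) := by
  have a0 : y k ≠ y (k + 1) := ha k
  have a1 : y (k + 1) ≠ y (k + 2) := ha (k + 1)
  have a2 : y (k + 2) ≠ y (k + 3) := ha (k + 2)
  have b0 := hb k
  have b1 := hb (k + 1)
  have b2 := hb (k + 2)
  have b3 := hb (k + 3)
  by_cases c0 : y k = 0 ∧ y (k+1) = 2 ∧ y (k+2) = 0 ∧ y (k+3) = 2
  · right
    have e : wst k y = w5 k 2 0 2 0 (y (k+4)) y := by unfold wst; rw [if_pos c0]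
    rw [e]
    refine win4 hn hk hb ?_ (by omega) (by omega) ?_ ?_ ?_ ?_ (by omega)
    · intro i _ _ _ _ _
      unfold w5; split_ifs <;> simp_all
    · rw [w5_0]; omega
    · rw [w5_1]; omega
    · rw [w5_2]; omega
    · rw [w5_3]; omega
  by_cases c1 : y k = 2 ∧ y (k+1) = 0 ∧ y (k+2) = 2 ∧ y (k+3) = 0
  · right
    have e : wst k y = w5 k 0 2 0 2 (y (k+4)) y := by unfold wst; rw [if_neg c0, if_pos c1]
    rw [e]
    refine win4 hn hk hb ?_ (by omega) (by omega) ?_ ?_ ?_ ?_ (by omega)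
    · intro i _ _ _ _ _
      unfold w5; split_ifs <;> simp_all
    · rw [w5_0]; omega
    · rw [w5_1]; omega
    · rw [w5_2]; omega
    · rw [w5_3]; omega
  by_cases c2 : y k < y (k+1) ∧ y (k+1) = y (k+3) ∧
      (y (k+1) = y (k+2) + 2 ∨ y (k+2) = y (k+1) + 2)
  · right
    have e : wst k y = w5 k (y k) (y (k+2)) (y (k+1)) (y (k+2)) (y (k+4)) y := by
      unfold wst; rw [if_neg c0, if_neg c1, if_pos c2]
    rw [e]
    refine win3 hn (p := k + 1) hk hb ?_ ?_ ?_ ?_ ?_ ?_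
    · intro i _ _ _ _
      unfold w5; split_ifs <;> simp_all
    · show y (k + 3) = y (k + 1); omega
    · rw [w5_1]
    · show w5 k _ _ _ _ _ y (k + 2) = _; rw [w5_2]
    · show w5 k _ _ _ _ _ y (k + 3) = _; rw [w5_3]
    · show (y (k + 1) + 2 = y (k + 2) ∧ 1 ≤ y (k + 1)) ∨ (y (k + 2) + 2 = y (k + 1) ∧ 1 ≤ y (k + 2))
      omega
  by_cases c3 : y k = y (k+2) ∧ y (k+3) < y (k+2) ∧ (y (k+1) = y k + 2 ∨ y k = y (k+1) + 2)
  · right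
    have e : wst k y = w5 k (y (k+1)) (y k) (y (k+1)) (y (k+3)) (y (k+4)) y := by
      unfold wst; rw [if_neg c0, if_neg c1, if_neg c2, if_pos c3]
    rw [e]
    refine win3 hn (p := k) (by omega) hb ?_ ?_ ?_ ?_ ?_ ?_
    · intro i _ _ _ _
      unfold w5; split_ifs <;> simp_all
    · omega
    · rw [w5_0]
    · rw [w5_1]
    · rw [w5_2]
    · omega
  have e : wst k y = sta k y := by
    unfold wst; rw [if_neg c0, if_neg c1, if_neg c2, if_neg c3]
  have sw0 : ∀ p i, i ≠ p → i ≠ p + 1 → sw p y i = y i := by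
    intro p i h1 h2; simp [sw, h1, h2]
  have sw1 : ∀ p, sw p y p = y (p + 1) := by intro p; simp [sw]
  have sw2 : ∀ p, sw p y (p + 1) = y p := by intro p; simp [sw]
  rw [e]
  unfold sta
  split_ifs with d0 d1 d2
  · right
    exact win2 hn (by omega) hb (fun i _ => sw0 k i) (sw1 k) (sw2 k) (by omega)
  · right
    refine win2 hn (by omega) hb (fun i _ => sw0 (k+1) i) (sw1 (k+1)) (sw2 (k+1)) ?_
    show y (k + 1) + 4 ≤ y (k + 2) ∨ y (k + 2) + 4 ≤ y (k + 1)
    clear c0 c1 c2 c3 d0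
    omega
  · right
    refine win2 hn (by omega) hb (fun i _ => sw0 (k+2) i) (sw1 (k+2)) (sw2 (k+2)) ?_
    show y (k + 2) + 4 ≤ y (k + 3) ∨ y (k + 3) + 4 ≤ y (k + 2)
    clear c0 c1 c2 c3 d0 d1
    omega
  · left; rfl

variable {W : Type*} [Group W] (cs : CoxeterSystem (CoxeterMatrix.B n) W)

lemma Wd_sta (h2 : 2 ≤ n) (hx : InX n (n^2) x) {k : ℕ} (hk : k + 4 ≤ n^2) :
    cs.wordProd (Wd n hn (sta k x)) = cs.wordProd (Wd n hn x) := by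
  have e : Wd n hn (sta k x) =
      (List.range (n^2)).map (fun i => let' n hn (wst k (La (n^2) x) i)) := by
    unfold Wd
    apply List.map_congr_left
    intro i hi
    rw [La_sta hx hk (List.mem_range.1 hi)]
  rcases wst_Bst hn hk (La_even hn rfl hx) (La_adj hn rfl hx (sq_ge h2)) with h | h
  · rw [e, h]; rfl
  · rw [e]; exact (Bst_prod cs h).symm

lemma Wd_prod (h2 : 2 ≤ n) {y : ℕ → ℕ} (hx : InX n (n^2) x) (hy : InX n (n^2) y) :
    cs.wordProd (Wd n hn x) = cs.wordProd (Wd n hn y) := by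
  have h := star_conn hx hy
  have : InX n (n^2) y ∧ cs.wordProd (Wd n hn x) = cs.wordProd (Wd n hn y) := by
    unfold StR at h
    clear hy
    induction h with
    | refl => exact ⟨hx, rfl⟩
    | tail _ h ih =>
      obtain ⟨k, hk, rfl⟩ := h
      exact ⟨ih.1.sta_mem (by omega), ih.2.trans (Wd_sta hn cs h2 ih.1 hk).symm⟩
  exact this.2

lemma Wd_w0 (h2 : 2 ≤ n) (hx : InX n (n^2) x) {w0 : W}
    (hw0 : ∀ u : W, cs.length u ≤ cs.length w0) : cs.wordProd (Wd n hn x) = w0 := by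
  apply eq_longest cs _ hw0
  intro a
  have ha := a.isLt
  have h4 := sq_ge h2
  obtain ⟨y, hy, e⟩ := exists_last hn (N := n^2) rfl (a := n - 1 - a) (by omega)
  have hs : Wd n hn y = (List.range (n^2 - 1)).map (fun i => let' n hn (La (n^2) y i)) ++ [a] := by
    have : n^2 = (n^2 - 1) + 1 := by omega
    unfold Wd
    conv_lhs => rw [this, List.range_succ]
    rw [List.map_append, ← this]
    simp only [List.map_cons, List.map_nil]
    rw [let_of hn e]
  have hr := Wd_red hn h2 cs hy
  rw [hs] at hr
  refine desc_of_last cs hr ?_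
  rw [← hs]
  exact Wd_prod hn cs h2 hy hx

lemma main2 (h2 : 2 ≤ n) {w0 : W} (hw0 : ∀ u : W, cs.length u ≤ cs.length w0) :
    Set.BijOn (Wd n hn) {x | InX n (n^2) x} {ω | cs.IsReduced ω ∧ cs.wordProd ω = w0} := by
  refine ⟨fun x hx => ⟨Wd_red hn h2 cs hx, Wd_w0 hn cs h2 hx hw0⟩, ?_, ?_⟩
  · intro x hx y hy e
    apply La_inj hx hy (sq_ge h2)
    intro i hi
    unfold Wd at e
    have := List.map_inj_left.1 e i (List.mem_range.2 hi)
    have h1 := La_even hn rfl hx i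
    have h2 := La_even hn rfl hy i
    rw [Fin.ext_iff, let_val, let_val] at this
    omega
  · rintro ω ⟨hr, hp⟩
    have hT := T0_mem n
    obtain ⟨x, hx, e⟩ := Wd_br hn hT (matsumoto cs (hO_B cs) _ (Wd n hn (T0 n)) ω rfl
      (Wd_red hn h2 cs hT) hr ((Wd_w0 hn cs h2 hT hw0).trans hp.symm))
    exact ⟨x, hx, e⟩

lemma main1 (h1 : n = 1) {w0 : W} (hw0 : ∀ u : W, cs.length u ≤ cs.length w0) :
    Set.BijOn (Wd n hn) {x | InX n (n^2) x} {ω | cs.IsReduced ω ∧ cs.wordProd ω = w0} := by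
  subst h1
  have hs : ∀ a b : Fin 1, a = b := fun a b => Subsingleton.elim a b
  have hd : ∀ a : Fin 1, cs.IsReduced [a] := by
    intro a
    unfold CoxeterSystem.IsReduced
    simp
  have hwd : ∀ x, Wd 1 hn x = [0] := by
    intro x
    show [let' 1 hn (La (1^2) x 0)] = [0]
    rw [hs (let' 1 hn (La (1^2) x 0)) 0]
  have hp : cs.wordProd [(0 : Fin 1)] = w0 := by
    apply eq_longest cs _ hw0
    intro a
    refine desc_of_last cs (v := []) (hd a) ?_
    rw [hs a 0]; rfl
  refine ⟨?_, ?_, ?_⟩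
  · intro x hx
    show cs.IsReduced (Wd 1 hn x) ∧ cs.wordProd (Wd 1 hn x) = w0
    rw [hwd]
    exact ⟨hd 0, hp⟩
  · intro x hx y hy _
    have hx : InX 1 (1^2) x := hx
    have hy : InX 1 (1^2) y := hy
    funext i
    rcases Nat.lt_or_ge i (1^2) with h | h
    · have a := hx.bound h
      have b := hy.bound h
      omega
    · rw [hx.zer i h, hy.zer i h]
  · rintro ω ⟨hr, hq⟩
    refine ⟨T0 1, T0_mem 1, ?_⟩
    rw [hwd]
    have hl : ω.length = 1 := by
      have h3 : cs.length (cs.wordProd ω) = ω.length := hr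
      have h4 : cs.length (cs.wordProd [(0 : Fin 1)]) = 1 := hd 0
      rw [← h3, hq, ← hp, h4]
    match ω, hl with
    | [a], _ => rw [hs a 0]

lemma main (n : ℕ) (hn : 0 < n) {W : Type*} [Group W] (cs : CoxeterSystem (CoxeterMatrix.B n) W)
    (w0 : W) (hw0 : ∀ u : W, cs.length u ≤ cs.length w0) :
    Set.BijOn (Wd n hn) {x | InX n (n^2) x} {ω | cs.IsReduced ω ∧ cs.wordProd ω = w0} := by
  rcases Nat.lt_or_ge n 2 with h | h
  · exact main1 hn cs (by omega) hw0
  · exact main2 hn cs h hw0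
end PSB

/-- (Haiman, Theorem 5.12.)  The promotion sequence map `T ↦ Φ(T)` is a bijection from the
set of standard shifted Young tableaux of doubled staircase shape `(2n-1, 2n-3, …, 1)` onto
the set `R(w₀)` of reduced words for the longest element `w₀` of the Coxeter group of type
`Bₙ`; moreover `Φ(p(T)) = c(Φ(T))`, where `p` is promotion and `c` moves the first letter
of a word to the end. -/
theorem promotion_sequence_bijection_to_reduced_words
    {W : Type*} [Group W] (n : ℕ) (hn : 0 < n)
    (cs : CoxeterSystem (CoxeterMatrix.Bₙ n) W) (w0 : W)
    (hw0 : ∀ u : W, cs.length u ≤ cs.length w0) :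
    Set.BijOn (phiWord n hn)
      {f | IsStdFilling (shiftCell (dblStair n)) (n ^ 2) f}
      {ω | cs.IsReduced ω ∧ cs.wordProd ω = w0} ∧
    (∀ f, IsStdFilling (shiftCell (dblStair n)) (n ^ 2) f →
      phiWord n hn (promote (n ^ 2) f) = (phiWord n hn f).rotate 1) := by
  exact ⟨⟨by
    intro f hf
    obtain ⟨x, hx, rfl⟩ := PSB.std_aux hf
    have h := (PSB.main n hn cs w0 hw0).1 hx
    rw [PSB.phi_fil hn hx]
    exact h, by
    intro f hf g hg e
    obtain ⟨x, hx, rfl⟩ := PSB.std_aux hf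
    obtain ⟨y, hy, rfl⟩ := PSB.std_aux hg
    rw [PSB.phi_fil hn hx, PSB.phi_fil hn hy] at e
    rw [(PSB.main n hn cs w0 hw0).2.1 hx hy e], by
    intro ω hω
    obtain ⟨x, hx, e⟩ := (PSB.main n hn cs w0 hw0).2.2 hω
    refine ⟨PSB.fil n x, hx.fil_std, ?_⟩
    rw [PSB.phi_fil hn hx]
    exact e⟩, by
    intro f hf
    obtain ⟨x, hx, rfl⟩ := PSB.std_aux hf
    exact PSB.phi_rot hn hx⟩
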